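/- Let k be a field of characteristic zero, let n ≥ 0, and let R be a regular ring that is a finitely generated algebra over the formal power series ring k[[x_1, …, x_n]]. Then for every ideal I ⊆ R and every i ≥ 0, the local cohomology module H^i_I(R) has only finitely many associated prime ideals. -/

import Mathlib

universe u

/-- A Noetherian local ring is regular if its maximal ideal can be generated by
`dim R` many elements. -/
def IsRegularLocalRing' (R : Type u) [CommRing R] [IsLocalRing R] : Prop :=
  IsNoetherianRing R ∧
    ∃ s : Finset R, Ideal.span (s : Set R) = IsLocalRing.maximalIdeal R ∧
      (s.card : WithBot ℕ∞) = ringKrullDim R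

/-- A (Noetherian) ring is regular if all of its localizations at primes are
regular local rings. -/
def IsRegularRing' (R : Type u) [CommRing R] : Prop :=
  IsNoetherianRing R ∧
    ∀ (p : Ideal R) [p.IsPrime], IsRegularLocalRing' (Localization.AtPrime p)

/-- The set of associated primes of a module, with the meaning `associatedPrimes` had in the
older Mathlib: the primes of the form `ann(x)` (no radical). -/
def associatedPrimesAnn (R : Type*) [CommRing R] (M : Type*) [AddCommGroup M] [Module R M] :
    Set (Ideal R) :=
  { I | I.IsPrime ∧ ∃ x : M, I = (Submodule.span R {x}).annihilator }

set_option linter.unusedSectionVars false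
set_option linter.style.haveILetI false

namespace BSLC
open Module

section count1
variable {K Y : Type*} [Field K] [CharZero K] [AddCommGroup Y] [Module K Y]

lemma weyl_pow (D Z : Module.End K Y) (h : D * Z - Z * D = 1) (a : ℕ) :
    Z * D ^ (a + 1) = D ^ (a + 1) * Z - ((a + 1 : ℕ) : K) • D ^ a := by
  have h' : Z * D = D * Z - 1 := by rw [← h]; abel
  induction a with
  | zero => simp [h']
  | succ a ih =>
    rw [pow_succ D (a + 1), ← mul_assoc, ih, sub_mul, mul_assoc, h', mul_sub, smul_mul_assoc,
      ← pow_succ, mul_one, ← mul_assoc, ← pow_succ]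
    push_cast
    module

lemma weyl_indep (N : Submodule K Y) (D Z : Module.End K Y) (h : D * Z - Z * D = 1)
    (hD : ∀ x ∈ N, D x ∈ N) (hZ : ∀ x ∈ N, Z x ∈ N) (p : ℕ) (x : ℕ → Y)
    (hx : ∀ a, Z (x a) ∈ N) (hs : ∑ a ∈ Finset.range p, (D ^ a) (x a) ∈ N) :
    ∀ a < p, x a ∈ N := by
  have hDp : ∀ a, ∀ x ∈ N, (D ^ a) x ∈ N := by
    intro a
    induction a with
    | zero => simp
    | succ a ih => intro x hx; rw [pow_succ]; exact ih _ (hD _ hx)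
  induction p generalizing x with
  | zero => simp
  | succ p ih =>
    have h1 : ∀ a < p, ((a + 1 : ℕ) : K) • x (a + 1) ∈ N := by
      apply ih
      · intro a; rw [map_smul]; exact N.smul_mem _ (hx _)
      · have h2 := hZ _ hs
        rw [map_sum, Finset.sum_range_succ'] at h2
        have h3 : ∀ a, Z ((D ^ (a + 1)) (x (a + 1))) = (D ^ (a + 1)) (Z (x (a + 1)))
            - (D ^ a) (((a + 1 : ℕ) : K) • x (a + 1)) := by
          intro a
          have := LinearMap.congr_fun (weyl_pow D Z h a) (x (a + 1))
          simpa using this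
        simp only [h3, Finset.sum_sub_distrib] at h2
        have h4 : ∑ a ∈ Finset.range p, (D ^ (a + 1)) (Z (x (a + 1))) ∈ N :=
          N.sum_mem fun a _ => hDp _ _ (hx _)
        have h5 : Z ((D ^ 0) (x 0)) ∈ N := by simpa using hx 0
        have h6 := N.sub_mem (N.add_mem h4 h5) h2
        convert h6 using 1
        abel
    have h2 : ∀ a < p, x (a + 1) ∈ N := by
      intro a ha
      have := N.smul_mem (((a + 1 : ℕ) : K)⁻¹) (h1 a ha)
      rwa [smul_smul, inv_mul_cancel₀ (by exact_mod_cast Nat.succ_ne_zero a), one_smul] at this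
    rw [Finset.sum_range_succ'] at hs
    have h3 : x 0 ∈ N := by
      have h4 : ∑ a ∈ Finset.range p, (D ^ (a + 1)) (x (a + 1)) ∈ N :=
        N.sum_mem fun a ha => hDp _ _ (h2 a (Finset.mem_range.1 ha))
      simpa using N.sub_mem hs h4
    intro a ha
    cases a with
    | zero => exact h3
    | succ a => exact h2 a (by omega)

/-- ordered monomial in operators -/
def dmon : {n : ℕ} → (Fin n → Module.End K Y) → (Fin n → ℕ) → Module.End K Y
  | 0, _, _ => 1
  | _ + 1, D, α => D 0 ^ α 0 * dmon (Fin.tail D) (Fin.tail α)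

lemma weyl_indep_multi {n : ℕ} (N : Submodule K Y) (D Z : Fin n → Module.End K Y)
    (h : ∀ i j, D i * Z j - Z j * D i = if i = j then 1 else 0)
    (hD : ∀ i, ∀ x ∈ N, D i x ∈ N) (hZ : ∀ i, ∀ x ∈ N, Z i x ∈ N) (p : ℕ) (w : Y)
    (hw : ∀ i, Z i w ∈ N) (hw' : w ∉ N) (c : (Fin n → Fin p) → K)
    (hs : ∑ α, c α • dmon D (fun i => (α i : ℕ)) w ∈ N) : ∀ α, c α = 0 := by
  induction n with
  | zero =>
    intro α
    rw [Fintype.sum_unique] at hs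
    by_contra hc
    rw [Subsingleton.elim α default] at hc
    have := N.smul_mem (c default)⁻¹ hs
    rw [smul_smul, inv_mul_cancel₀ hc, one_smul] at this
    exact hw' this
  | succ n ih =>
    have hcomm : ∀ (i : Fin n), D i.succ * Z 0 = Z 0 * D i.succ := by
      intro i
      have := h i.succ 0
      rw [if_neg (Fin.succ_ne_zero i)] at this
      exact sub_eq_zero.1 this
    have hmon : ∀ (m : ℕ) (E : Fin m → Module.End K Y) (_ : ∀ i, E i * Z 0 = Z 0 * E i)
        (_ : ∀ i, ∀ x ∈ N, E i x ∈ N)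
        (α : Fin m → ℕ), Z 0 (dmon E α w) ∈ N := by
      intro m E hE hEN α
      have h1 : dmon E α * Z 0 = Z 0 * dmon E α := by
        clear hEN
        induction m with
        | zero => simp [dmon]
        | succ m ihm =>
          have := ihm (Fin.tail E) (fun i => hE i.succ) (Fin.tail α)
          have h2 : Commute (E 0 ^ α 0) (Z 0) := Commute.pow_left (hE 0) _
          simp only [dmon]
          rw [mul_assoc, this, ← mul_assoc, h2.eq, mul_assoc]
      have h2 : ∀ x ∈ N, dmon E α x ∈ N := by
        clear h1 hE
        induction m with
        | zero => simp [dmon]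
        | succ m ihm =>
          intro x hx
          have h3 := ihm (Fin.tail E) (fun i => hEN i.succ) (Fin.tail α) x hx
          have h4 : ∀ a, ∀ x ∈ N, (E 0 ^ a) x ∈ N := by
            intro a
            induction a with
            | zero => simp
            | succ a iha => intro x hx; rw [pow_succ]; exact iha _ (hEN _ _ hx)
          exact h4 _ _ h3
      have := LinearMap.congr_fun h1 w
      simp only [Module.End.mul_apply] at this
      rw [← this]
      exact h2 _ (hw 0)
    -- rewrite the sum
    let x : ℕ → Y := fun a => if ha : a < p then
      ∑ β : Fin n → Fin p, c (Fin.cons ⟨a, ha⟩ β) • dmon (Fin.tail D) (fun i => (β i : ℕ)) w else 0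
    have hx : ∀ a, Z 0 (x a) ∈ N := by
      intro a
      by_cases ha : a < p
      · simp only [x, dif_pos ha, map_sum, map_smul]
        exact N.sum_mem fun β _ => N.smul_mem _
          (hmon n (Fin.tail D) hcomm (fun i => hD i.succ) _)
      · simp [x, ha]
    have hsum : ∑ α, c α • dmon D (fun i => (α i : ℕ)) w
        = ∑ a ∈ Finset.range p, (D 0 ^ a) (x a) := by
      rw [← (Fin.consEquiv (fun _ => Fin p)).sum_comp, Fintype.sum_prod_type,
        Finset.sum_range]
      refine Finset.sum_congr rfl fun a _ => ?_
      simp only [x, dif_pos a.2, map_sum, map_smul]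
      refine Finset.sum_congr rfl fun β _ => ?_
      rfl
    rw [hsum] at hs
    have h00 := h 0 0
    rw [if_pos rfl] at h00
    have key := weyl_indep N (D 0) (Z 0) h00 (hD 0) (hZ 0) p x hx hs
    intro α
    have h1 := key (α 0) (α 0).2
    simp only [x, dif_pos (α 0).2] at h1
    have := ih (Fin.tail D) (Fin.tail Z)
      (fun i j => by
        have := h i.succ j.succ
        simpa [Fin.tail, Fin.succ_inj] using this)
      (fun i => hD i.succ) (fun i => hZ i.succ) (fun i => hw i.succ) _ h1 (Fin.tail α)
    simpa using this
end count1

section count2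
variable {K A X : Type*} [Field K] [CharZero K] [CommRing A] [Algebra K A] [AddCommGroup X]
  [Module K X] [Module A X] [IsScalarTower K A X] {n : ℕ}
  (d : Fin n → Derivation K A A) (D : Fin n → Module.End K X)

/-- Smallest `A`-submodule stable under the operators `D i` and containing `S`. -/
def DSpan (A : Type*) {X : Type*} {ι : Type*} [CommRing A] [AddCommGroup X] [Module A X]
    (D : ι → X → X) (S : Set X) : Submodule A X :=
  sInf {N | S ⊆ N ∧ ∀ i, ∀ x ∈ N, D i x ∈ N}

lemma subset_DSpan {A X ι : Type*} [CommRing A] [AddCommGroup X] [Module A X]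
    (D : ι → X → X) (S : Set X) : S ⊆ DSpan A D S := by
  intro x hx
  simp only [DSpan, Submodule.coe_sInf, Set.mem_iInter]
  intro N hN
  exact hN.1 hx

lemma DSpan_stable {A X ι : Type*} [CommRing A] [AddCommGroup X] [Module A X]
    (D : ι → X → X) (S : Set X) (i : ι) {x : X} (hx : x ∈ DSpan A D S) : D i x ∈ DSpan A D S := by
  rw [DSpan, Submodule.mem_sInf] at hx ⊢
  intro N hN
  exact hN.2 i _ (hx N hN)

lemma DSpan_le {A X ι : Type*} [CommRing A] [AddCommGroup X] [Module A X]
    {D : ι → X → X} {S : Set X} {N : Submodule A X} (h1 : S ⊆ N)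
    (h2 : ∀ i, ∀ x ∈ N, D i x ∈ N) : DSpan A D S ≤ N := sInf_le ⟨h1, h2⟩

/-- Order filtration. -/
def ordF (Y : Submodule A X) : ℕ → Submodule A X
  | 0 => Y
  | k + 1 => ordF Y k ⊔ Submodule.span A (⋃ i, D i '' (ordF Y k : Set X))

lemma ordF_le_succ (Y : Submodule A X) (k : ℕ) : ordF D Y k ≤ ordF D Y (k + 1) := le_sup_left

lemma ordF_mono_right (Y : Submodule A X) {k l : ℕ} (h : k ≤ l) : ordF D Y k ≤ ordF D Y l :=
  monotone_nat_of_le_succ (ordF_le_succ D Y) h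

lemma D_mem_ordF (Y : Submodule A X) (k : ℕ) (i : Fin n) {x : X} (hx : x ∈ ordF D Y k) :
    D i x ∈ ordF D Y (k + 1) :=
  Submodule.mem_sup_right (Submodule.subset_span (Set.mem_iUnion.2 ⟨i, x, hx, rfl⟩))

lemma ordF_mono {Y Y' : Submodule A X} (h : Y ≤ Y') (k : ℕ) : ordF D Y k ≤ ordF D Y' k := by
  induction k with
  | zero => exact h
  | succ k ih =>
    refine sup_le (ih.trans (ordF_le_succ D _ _)) (Submodule.span_le.2 ?_)
    intro x hx
    obtain ⟨i, y, hy, rfl⟩ := Set.mem_iUnion.1 hx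
    exact D_mem_ordF D _ k i (ih hy)

lemma ordF_le_of_stable {Y N : Submodule A X} (h : Y ≤ N) (hN : ∀ i, ∀ x ∈ N, D i x ∈ N) (k : ℕ) :
    ordF D Y k ≤ N := by
  induction k with
  | zero => exact h
  | succ k ih =>
    refine sup_le ih (Submodule.span_le.2 ?_)
    intro x hx
    obtain ⟨i, y, hy, rfl⟩ := Set.mem_iUnion.1 hx
    exact hN _ _ (ih hy)

lemma derivation_pow_mem (δ : Derivation K A A) (m : Ideal A) (a : ℕ) :
    ∀ b ∈ m ^ (a + 1), δ b ∈ m ^ a := by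
  induction a with
  | zero => simp
  | succ a ih =>
    intro b hb
    rw [pow_succ] at hb
    induction hb using Submodule.mul_induction_on' with
    | mem_mul_mem x hx y hy =>
      rw [Derivation.leibniz]
      refine Ideal.add_mem _ (Ideal.mul_mem_right _ _ hx) ?_
      rw [smul_eq_mul, mul_comm, pow_succ]
      exact Ideal.mul_mem_mul (ih x hx) hy
    | add x _ y _ h1 h2 => rw [map_add]; exact Ideal.add_mem _ h1 h2

variable (hL : ∀ i a x, D i (a • x) = a • D i x + d i a • x)
include hL

lemma pow_smul_ordF (m : Ideal A) (Y : Submodule A X) (k a : ℕ) :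
    m ^ (a + k) • ordF D Y k ≤ ordF D (m ^ a • Y) k := by
  induction k generalizing a with
  | zero => exact le_rfl
  | succ k ih =>
    have h0 : ∀ b, m ^ (a + 1 + b) • Y ≤ m ^ a • Y := fun b =>
      Submodule.smul_mono_left (Ideal.pow_le_pow_right (by omega))
    have h1 : m ^ (a + (k + 1)) • ordF D Y k ≤ ordF D (m ^ a • Y) k := by
      have := ih (a + 1)
      rw [show a + 1 + k = a + (k + 1) by omega] at this
      exact this.trans (ordF_mono D (h0 0) k)
    rw [Submodule.smul_le]
    intro r hr x hx
    rw [ordF, Submodule.mem_sup] at hx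
    obtain ⟨x1, hx1, x2, hx2, rfl⟩ := hx
    rw [smul_add]
    refine Submodule.add_mem _ (ordF_le_succ D _ _ (h1 (Submodule.smul_mem_smul hr hx1))) ?_
    clear hx1
    induction hx2 using Submodule.span_induction generalizing r with
    | mem x hx =>
      obtain ⟨i, y, hy, rfl⟩ := Set.mem_iUnion.1 hx
      have : r • D i y = D i (r • y) - d i r • y := by rw [hL]; abel
      rw [this]
      refine Submodule.sub_mem _ (D_mem_ordF D _ k i (h1 (Submodule.smul_mem_smul hr hy))) ?_
      refine ordF_le_succ D _ _ (ih a (Submodule.smul_mem_smul ?_ hy))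
      exact derivation_pow_mem (d i) m _ _ hr
    | zero => simp
    | add x y _ _ h1 h2 => rw [smul_add]; exact Submodule.add_mem _ (h1 r hr) (h2 r hr)
    | smul b x _ h =>
      rw [smul_smul]
      exact h _ (Ideal.mul_mem_right _ _ hr)

lemma chain_le (m : Ideal A) (e : ℤ → X) (s k : ℕ)
    (hs : ∀ j, m ^ s • Submodule.span A {e j} ≤ ordF D (Submodule.span A {e (j + 1)}) k)
    (r : ℕ) (a : ℕ) (j : ℤ) : m ^ (r * (s + k) + a) • Submodule.span A {e j} ≤
      DSpan A (fun i x => D i x) (m ^ a • Submodule.span A {e (j + r)} : Submodule A X) := by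
  induction r generalizing j with
  | zero =>
    intro x hx
    refine subset_DSpan _ _ ?_
    simpa using hx
  | succ r ih =>
    have h1 : m ^ ((r + 1) * (s + k) + a) • Submodule.span A {e j} ≤
        ordF D (m ^ (r * (s + k) + a) • Submodule.span A {e (j + 1)}) k := by
      have : (r + 1) * (s + k) + a = (r * (s + k) + a + k) + s := by ring
      rw [this, pow_add, Submodule.mul_smul]
      exact (Submodule.smul_mono le_rfl (hs j)).trans (pow_smul_ordF d D hL m _ _ _)
    refine h1.trans (ordF_le_of_stable D ?_ (fun i x hx => DSpan_stable _ _ i hx) k)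
    have := ih (j + 1)
    rwa [show j + 1 + (r : ℤ) = j + ((r + 1 : ℕ) : ℤ) by push_cast; ring] at this

omit hL in
lemma pow_span_le_span (z : Fin n → A) (Q : ℕ) :
    Ideal.span (Set.range z) ^ Q ≤ Ideal.span {a | ∃ α : Fin n → ℕ, ∑ i, α i = Q ∧
      a = ∏ i, z i ^ α i} := by
  induction Q with
  | zero =>
    rw [pow_zero, Ideal.one_eq_top, top_le_iff, Ideal.eq_top_iff_one]
    exact Ideal.subset_span ⟨0, by simp, by simp⟩
  | succ Q ih =>
    rw [pow_succ]
    refine (Ideal.mul_mono_left ih).trans ?_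
    rw [Ideal.span_mul_span', Ideal.span_le]
    rintro _ ⟨_, ⟨α, hα, rfl⟩, _, ⟨i, rfl⟩, rfl⟩
    refine Ideal.subset_span ⟨α + Pi.single i 1, ?_, ?_⟩
    · simp [Finset.sum_add_distrib, hα]
    · simp only [Pi.add_apply, pow_add, Finset.prod_mul_distrib]
      congr 1
      rw [Finset.prod_eq_single i]
      · simp
      · intro b _ hb; simp [hb]
      · simp

omit hL in
lemma span_sup_pow_eq_top (z : Fin n → A)
    (hA : ∀ a : A, ∃ c : K, a - algebraMap K A c ∈ Ideal.span (Set.range z)) (Q : ℕ) :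
    ∀ a : A, ∃ b ∈ Submodule.span K {a | ∃ α : Fin n → Fin Q, a = ∏ i, z i ^ (α i : ℕ)},
      a - b ∈ Ideal.span (Set.range z) ^ Q := by
  -- degree version
  have key : ∀ Q : ℕ, ∀ a : A, ∃ b ∈ Submodule.span K {a | ∃ α : Fin n → ℕ, ∑ i, α i < Q ∧
      a = ∏ i, z i ^ (α i)}, a - b ∈ Ideal.span (Set.range z) ^ Q := by
    intro Q
    induction Q with
    | zero => intro a; exact ⟨0, Submodule.zero_mem _, by simp⟩
    | succ Q ih =>
      intro a
      obtain ⟨b, hb, hab⟩ := ih a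
      have hstep : ∀ x ∈ Ideal.span {a | ∃ α : Fin n → ℕ, ∑ i, α i = Q ∧ a = ∏ i, z i ^ α i},
          ∃ b ∈ Submodule.span K {a | ∃ α : Fin n → ℕ, ∑ i, α i < Q + 1 ∧
            a = ∏ i, z i ^ (α i)}, x - b ∈ Ideal.span (Set.range z) ^ (Q + 1) := by
        intro x hx
        induction hx using Submodule.span_induction with
        | mem x hx =>
          obtain ⟨α, hα, rfl⟩ := hx
          exact ⟨_, Submodule.subset_span ⟨α, by omega, rfl⟩, by simp⟩
        | zero => exact ⟨0, Submodule.zero_mem _, by simp⟩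
        | add x y _ _ hx hy =>
          obtain ⟨b, hb, h⟩ := hx
          obtain ⟨b', hb', h'⟩ := hy
          refine ⟨b + b', Submodule.add_mem _ hb hb', ?_⟩
          rw [add_sub_add_comm]; exact Ideal.add_mem _ h h'
        | smul r x hx' hx =>
          obtain ⟨b, hb, h⟩ := hx
          obtain ⟨c, hc⟩ := hA r
          have hxQ : x ∈ Ideal.span (Set.range z) ^ Q := by
            refine (Ideal.span_le.2 ?_ : Ideal.span _ ≤ _) hx'
            rintro _ ⟨α, rfl, rfl⟩
            rw [← Finset.prod_pow_eq_pow_sum]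
            refine Ideal.prod_mem_prod fun i _ => ?_
            exact Ideal.pow_mem_pow (Ideal.subset_span (Set.mem_range_self i)) _
          refine ⟨c • b, Submodule.smul_mem _ _ hb, ?_⟩
          have : r • x - c • b = (r - algebraMap K A c) * x + algebraMap K A c * (x - b) := by
            rw [Algebra.smul_def c b, smul_eq_mul]; ring
          rw [this]
          refine Ideal.add_mem _ ?_ (Ideal.mul_mem_left _ _ h)
          rw [pow_succ, mul_comm (r - _)]
          exact Ideal.mul_mem_mul hxQ hc
      obtain ⟨b', hb', h'⟩ := hstep _ (pow_span_le_span z Q hab)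
      refine ⟨b + b', Submodule.add_mem _ ?_ hb', ?_⟩
      · refine Submodule.span_mono ?_ hb
        rintro _ ⟨α, hα, rfl⟩
        exact ⟨α, by omega, rfl⟩
      · rw [← sub_sub]; exact h'
  intro a
  obtain ⟨b, hb, h⟩ := key Q a
  refine ⟨b, Submodule.span_mono ?_ hb, h⟩
  rintro _ ⟨α, hα, rfl⟩
  refine ⟨fun i => ⟨α i, lt_of_le_of_lt (Finset.single_le_sum (f := α) (fun _ _ => Nat.zero_le _)
    (Finset.mem_univ i)) hα⟩, rfl⟩

lemma dmon_mem_ordF (Y : Submodule A X) {m : ℕ} (E : Fin m → Module.End K X)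
    (hE : ∀ i, ∃ j, E i = D j) (α : Fin m → ℕ) (p : ℕ) (hα : ∀ i, α i ≤ p) (l : ℕ) {x : X}
    (hx : x ∈ ordF D Y l) : dmon E α x ∈ ordF D Y (l + m * p) := by
  induction m with
  | zero => simpa [dmon] using hx
  | succ m ih =>
    have h1 := ih (Fin.tail E) (fun i => hE i.succ) (Fin.tail α) (fun i => hα i.succ)
    obtain ⟨j, hj⟩ := hE 0
    have h2 : ∀ (a l : ℕ) (x : X), x ∈ ordF D Y l → (E 0 ^ a) x ∈ ordF D Y (l + a) := by
      intro a
      induction a with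
      | zero => intro l x hx; simpa using hx
      | succ a iha =>
        intro l x hx
        rw [pow_succ]
        have := iha (l + 1) (E 0 x) (by rw [hj]; exact D_mem_ordF D Y l j hx)
        rwa [show l + 1 + a = l + (a + 1) by omega] at this
    have h3 := h2 (α 0) _ _ h1
    refine ordF_mono_right D Y ?_ h3
    have := hα 0
    rw [Nat.succ_mul]; omega

lemma dmon_mem_of_stable (N : Submodule A X) (hN : ∀ i, ∀ x ∈ N, D i x ∈ N) {m : ℕ}
    (E : Fin m → Module.End K X)
    (hE : ∀ i, ∃ j, E i = D j) (α : Fin m → ℕ) {x : X}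
    (hx : x ∈ N) : dmon E α x ∈ N := by
  have h := dmon_mem_ordF d D hL N E hE α (∑ i, α i)
    (fun i => Finset.single_le_sum (f := α) (fun _ _ => Nat.zero_le _)
    (Finset.mem_univ i)) 0 (x := x) hx
  exact ordF_le_of_stable D le_rfl hN _ h

/-- The counting lemma. -/
theorem count_lemma (z : Fin n → A) (hz : ∀ i j, d i (z j) = if i = j then 1 else 0)
    (hA : ∀ a : A, ∃ c : K, a - algebraMap K A c ∈ Ideal.span (Set.range z))
    (e : ℤ → X) (he : ∀ j, ∃ g : A, e (j + 1) = g • e j)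
    (hDe : ∀ i j, D i (e j) ∈ Submodule.span A {e (j - 1)}) (s k : ℕ)
    (hs : ∀ j, Ideal.span (Set.range z) ^ s • Submodule.span A {e j} ≤
      ordF D (Submodule.span A {e (j + 1)}) k) :
    ∃ j, e j ∈ DSpan A (fun i x => D i x) {e (j + 1)} := by
  by_contra! hne
  set m := Ideal.span (Set.range z) with hm
  set N : ℤ → Submodule A X := fun j => DSpan A (fun i x => D i x) {e j} with hN
  have hNst : ∀ j i, ∀ x ∈ N j, D i x ∈ N j := fun j i x hx => DSpan_stable _ _ i hx
  have heN : ∀ j, e j ∈ N j := fun j => subset_DSpan _ _ rfl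
  have hNle : ∀ j, N (j + 1) ≤ N j := by
    intro j
    refine DSpan_le ?_ (hNst j)
    rintro _ rfl
    obtain ⟨g, hg⟩ := he j
    rw [hg]; exact Submodule.smul_mem _ _ (heN j)
  have hNanti : ∀ j (r : ℕ), N (j + r) ≤ N j := by
    intro j r
    induction r with
    | zero => simp
    | succ r ih =>
      refine le_trans ?_ ih
      have := hNle (j + r)
      rwa [add_assoc, show ((r : ℤ) + 1) = ((r + 1 : ℕ) : ℤ) by push_cast; rfl] at this
  have hsanti : ∀ j (r : ℕ), Submodule.span A {e (j + r)} ≤ Submodule.span A {e j} := by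
    intro j r
    induction r with
    | zero => simp
    | succ r ih =>
      refine le_trans ?_ ih
      rw [Submodule.span_singleton_le_iff_mem]
      obtain ⟨g, hg⟩ := he (j + r)
      rw [show j + ((r + 1 : ℕ) : ℤ) = j + r + 1 by push_cast; ring, hg]
      exact Submodule.smul_mem _ _ (Submodule.mem_span_singleton_self _)
  -- socle elements
  have hw : ∀ j, ∃ w ∈ Submodule.span A {e j}, w ∉ N (j + 1) ∧ ∀ i, z i • w ∈ N (j + 1) := by
    intro j
    have hex : ∃ t, m ^ t • Submodule.span A {e j} ≤ N (j + 1) := by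
      refine ⟨s, (hs j).trans (ordF_le_of_stable D ?_ (hNst _) k)⟩
      rw [Submodule.span_singleton_le_iff_mem]; exact heN _
    classical
    obtain ⟨t, ht, hmin⟩ : ∃ t, m ^ t • Submodule.span A {e j} ≤ N (j + 1) ∧
        ∀ t' < t, ¬ m ^ t' • Submodule.span A {e j} ≤ N (j + 1) :=
      ⟨Nat.find hex, Nat.find_spec hex, fun t' h => Nat.find_min hex h⟩
    have ht0 : t ≠ 0 := by
      rintro rfl
      apply hne j
      apply ht
      rw [pow_zero, Ideal.one_eq_top, Submodule.top_smul]
      exact Submodule.mem_span_singleton_self _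
    obtain ⟨t, rfl⟩ := Nat.exists_eq_succ_of_ne_zero ht0
    have h1 := hmin t (Nat.lt_succ_self t)
    rw [SetLike.not_le_iff_exists] at h1
    obtain ⟨w, hw1, hw2⟩ := h1
    refine ⟨w, Submodule.smul_le_right hw1, hw2, fun i => ht ?_⟩
    rw [pow_succ', Submodule.mul_smul]
    exact Submodule.smul_mem_smul (Ideal.subset_span ⟨i, rfl⟩) hw1
  choose w hw1 hw2 hw3 using hw
  let Z : Fin n → Module.End K X := fun i => Algebra.lsmul K K X (z i)
  have hDZ : ∀ i j, D i * Z j - Z j * D i = if i = j then 1 else 0 := by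
    intro i j
    ext x
    have := hL i (z j) x
    simp only [Z, LinearMap.sub_apply, Module.End.mul_apply, Algebra.lsmul_coe]
    rw [this, hz]
    split_ifs <;> simp
  -- order filtration in e_{-p}
  have hord : ∀ p : ℕ, ordF D (Submodule.span A {e 0}) p ≤ Submodule.span A {e (-(p : ℤ))} := by
    intro p
    induction p with
    | zero => simp [ordF]
    | succ p ih =>
      have h0 : Submodule.span A {e (-(p : ℤ))} ≤ Submodule.span A {e (-((p + 1 : ℕ) : ℤ))} := by
        have := hsanti (-((p + 1 : ℕ) : ℤ)) 1
        rwa [show -((p + 1 : ℕ) : ℤ) + ((1 : ℕ) : ℤ) = -(p : ℤ) by push_cast; ring] at this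
      refine sup_le (ih.trans h0) (Submodule.span_le.2 ?_)
      intro x hx
      obtain ⟨i, y, hy, rfl⟩ := Set.mem_iUnion.1 hx
      obtain ⟨a, rfl⟩ := Submodule.mem_span_singleton.1 (ih hy)
      rw [hL]
      refine Submodule.add_mem _ (Submodule.smul_mem _ _ ?_) (h0 (Submodule.smul_mem _ _
        (Submodule.mem_span_singleton_self _)))
      have := hDe i (-(p : ℤ))
      rwa [show -(p : ℤ) - 1 = -((p + 1 : ℕ) : ℤ) by push_cast; ring] at this
  -- main inequality
  have main : ∀ p : ℕ, p * p ^ n ≤ (((n * p) + p) * (s + k)) ^ n := by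
    intro p
    set Q := ((n * p) + p) * (s + k) with hQ
    -- the independent family
    let fam : Fin p × (Fin n → Fin p) → X := fun q => dmon D (fun i => (q.2 i : ℕ)) (w (q.1 : ℕ))
    have hind : ∀ c : Fin p × (Fin n → Fin p) → K, ∑ q, c q • fam q ∈ N p → ∀ q, c q = 0 := by
      intro c hc
      rw [Fintype.sum_prod_type] at hc
      have : ∀ j : ℕ, ∀ hj : j < p, ∀ α, c (⟨j, hj⟩, α) = 0 := by
        intro j
        induction j using Nat.strong_induction_on with
        | _ j ih =>
          intro hj
          have hmem : ∀ j' : Fin p, j' ≠ ⟨j, hj⟩ → ∑ α, c (j', α) • fam (j', α) ∈ N (j + 1) := by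
            intro j' hj'
            refine Submodule.sum_mem _ fun α _ => ?_
            rcases lt_or_gt_of_ne (fun h => hj' (Fin.ext h) : (j' : ℕ) ≠ j) with h | h
            · rw [ih j' h j'.2 α, zero_smul]; exact Submodule.zero_mem _
            · rw [← algebraMap_smul A]
              refine Submodule.smul_mem _ _ (dmon_mem_of_stable d D hL _ (hNst _) D
                (fun i => ⟨i, rfl⟩) _ ?_)
              have h1 : w (j' : ℕ) ∈ N (j' : ℕ) :=
                (Submodule.span_singleton_le_iff_mem _ _).2 (heN _) (hw1 _)
              have h2 := hNanti (j + 1) ((j' : ℕ) - (j + 1))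
              rw [show (j : ℤ) + 1 + (((j' : ℕ) - (j + 1) : ℕ) : ℤ) = ((j' : ℕ) : ℤ) by omega] at h2
              exact h2 h1
          have h3 : ∑ α, c (⟨j, hj⟩, α) • fam (⟨j, hj⟩, α) ∈ N (j + 1) := by
            have h4 := hNanti (j + 1) (p - (j + 1))
            rw [show (j : ℤ) + 1 + ((p - (j + 1) : ℕ) : ℤ) = (p : ℤ) by omega] at h4
            have h5 := h4 hc
            rw [← Finset.add_sum_erase _ _ (Finset.mem_univ (⟨j, hj⟩ : Fin p))] at h5
            refine (Submodule.add_mem_iff_left _ ?_).1 h5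
            exact Submodule.sum_mem _ fun j' hj' => hmem j' (Finset.ne_of_mem_erase hj')
          exact weyl_indep_multi ((N (j + 1)).restrictScalars K) D Z hDZ (hNst _)
            (fun i x hx => Submodule.smul_mem (N (j + 1)) (z i) hx) p (w j) (hw3 j) (hw2 j)
            (fun α => c (⟨j, hj⟩, α)) h3
      rintro ⟨⟨j, hj⟩, α⟩
      exact this j hj α
    -- in the quotient
    let NK : Submodule K X := (N p).restrictScalars K
    have hli : LinearIndependent K (fun q => NK.mkQ (fam q)) := by
      rw [Fintype.linearIndependent_iff]
      intro c hc
      apply hind c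
      have : NK.mkQ (∑ q, c q • fam q) = 0 := by
        rw [map_sum, ← hc]
        exact Finset.sum_congr rfl fun q _ => map_smul _ _ _
      exact (Submodule.Quotient.mk_eq_zero NK).1 this
    let G : (Fin n → Fin Q) → X ⧸ NK := fun β =>
      NK.mkQ ((∏ i, z i ^ (β i : ℕ)) • e (-((n * p : ℕ) : ℤ)))
    have hmQ : m ^ Q • Submodule.span A {e (-((n * p : ℕ) : ℤ))} ≤ N p := by
      have := chain_le d D hL m e s k hs (n * p + p) 0 (-((n * p : ℕ) : ℤ))
      rw [add_zero, ← hQ, pow_zero, Ideal.one_eq_top, Submodule.top_smul,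
        show -((n * p : ℕ) : ℤ) + ((n * p + p : ℕ) : ℤ) = p by push_cast; ring] at this
      refine this.trans (DSpan_le ?_ (hNst p))
      exact (Submodule.span_singleton_le_iff_mem _ _).2 (heN _)
    have hspan : ∀ q, NK.mkQ (fam q) ∈ Submodule.span K (Set.range G) := by
      rintro ⟨j, α⟩
      have h1 : fam (j, α) ∈ Submodule.span A {e (-((n * p : ℕ) : ℤ))} := by
        apply hord
        have h2 : w (j : ℕ) ∈ ordF D (Submodule.span A {e 0}) 0 := by
          have := hsanti 0 (j : ℕ)
          rw [zero_add] at this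
          exact this (hw1 _)
        have := dmon_mem_ordF d D hL (Submodule.span A {e 0}) D (fun i => ⟨i, rfl⟩)
          (fun i => (α i : ℕ)) p (fun i => (α i).2.le) 0 h2
        rwa [zero_add] at this
      obtain ⟨a, ha⟩ := Submodule.mem_span_singleton.1 h1
      obtain ⟨b, hb, hab⟩ := span_sup_pow_eq_top z hA Q a
      have h3 : NK.mkQ (fam (j, α)) = NK.mkQ (b • e (-((n * p : ℕ) : ℤ))) := by
        rw [← ha, ← sub_eq_zero, ← map_sub, ← sub_smul]
        simp only [Submodule.mkQ_apply, Submodule.Quotient.mk_eq_zero]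
        exact hmQ (Submodule.smul_mem_smul hab (Submodule.mem_span_singleton_self _))
      rw [h3]
      clear h3 hab
      induction hb using Submodule.span_induction with
      | mem x hx =>
        obtain ⟨β, rfl⟩ := hx
        exact Submodule.subset_span ⟨β, rfl⟩
      | zero => simp
      | add x y _ _ hx hy => rw [add_smul, map_add]; exact Submodule.add_mem _ hx hy
      | smul c x _ hx =>
        rw [smul_assoc, map_smul]; exact Submodule.smul_mem _ _ hx
    have hcard : Fintype.card (Fin p × (Fin n → Fin p)) ≤ Fintype.card (Fin n → Fin Q) := by
      have hli' : LinearIndependent K (fun q => (⟨NK.mkQ (fam q), hspan q⟩ :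
          Submodule.span K (Set.range G))) := by
        apply LinearIndependent.of_comp (Submodule.subtype _)
        exact hli
      have : Module.Finite K (Submodule.span K (Set.range G)) :=
        Module.Finite.span_of_finite K (Set.finite_range G)
      exact hli'.fintype_card_le_finrank.trans (finrank_range_le_card G)
    simpa using hcard
  -- numerical contradiction
  obtain ⟨c, hc⟩ : ∃ c, c = (n + 1) * (s + k) := ⟨_, rfl⟩
  have := main (c ^ n + 1)
  have h2 : ((n * (c ^ n + 1) + (c ^ n + 1)) * (s + k)) = c * (c ^ n + 1) := by rw [hc]; ring
  rw [h2, mul_pow] at this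
  have h3 : 0 < (c ^ n + 1) ^ n := by positivity
  have := Nat.le_of_mul_le_mul_right this h3
  omega
end count2
end BSLC

namespace BSLC

/-- derivations over the integers (with a fixed choice of the algebra structure) -/
abbrev Der (S : Type*) [CommRing S] := Derivation ℤ S S
open Polynomial

/-- Coefficientwise extension of a derivation to polynomials. -/
noncomputable def polyDer {A : Type*} [CommRing A] (d : Der A) :
    Der A[X] :=
  PolynomialModule.equivPolynomialSelf.compDer d.mapCoeffs

lemma coeff_polyDer {A : Type*} [CommRing A] (d : Der A) (p : A[X]) (n : ℕ) :
    (polyDer d p).coeff n = d (p.coeff n) := rfl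

@[simp] lemma polyDer_C {A : Type*} [CommRing A] (d : Der A) (a : A) :
    polyDer d (C a) = C (d a) := by
  ext n; rw [coeff_polyDer, coeff_C, coeff_C]; split_ifs <;> simp

@[simp] lemma polyDer_X {A : Type*} [CommRing A] (d : Der A) :
    polyDer d (X : A[X]) = 0 := by
  ext n; rw [coeff_polyDer, coeff_X]; split_ifs <;> simp

/-- derivation from a ring hom to dual numbers -/
lemma exists_der_of_dual {B : Type*} [CommRing B] (f : B →+* TrivSqZeroExt B B)
    (hf : ∀ b, (f b).fst = b) : ∃ d : Der B, ∀ b, d b = (f b).snd := by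
  refine ⟨Derivation.mk' (AddMonoidHom.toIntLinearMap
    { toFun := fun b => (f b).snd, map_zero' := by simp, map_add' := by simp }) ?_, fun b => rfl⟩
  intro a b
  simp only [AddMonoidHom.coe_toIntLinearMap, AddMonoidHom.coe_mk, ZeroHom.coe_mk, map_mul,
    TrivSqZeroExt.snd_mul, hf]
  rw [op_smul_eq_smul]

/-- dual number hom from a derivation -/
noncomputable def dualHom {B S : Type*} [CommRing B] [CommRing S] (φ : B →+* S) (d : B → S)
    (h0 : ∀ a b, d (a + b) = d a + d b)
    (h : ∀ a b, d (a * b) = φ a * d b + φ b * d a) : B →+* TrivSqZeroExt S S where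
  toFun b := TrivSqZeroExt.inl (φ b) + TrivSqZeroExt.inr (d b)
  map_one' := by
    have := h 1 1
    simp only [mul_one, map_one, one_mul] at this
    have h1 : d 1 = 0 := by simpa using this
    ext <;> simp [h1]
  map_mul' a b := by
    ext
    · simp
    · simp [h]; ring
  map_zero' := by
    have := h0 0 0
    have h1 : d 0 = 0 := by simpa using this
    ext <;> simp [h1]
  map_add' a b := by ext <;> simp [h0]

lemma exists_der_localization {B S : Type*} [CommRing B] [CommRing S] [Algebra B S]
    (M : Submonoid B) [IsLocalization M S] (d : Der B) :
    ∃ d' : Der S, ∀ b, d' (algebraMap B S b) = algebraMap B S (d b) := by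
  let φ := algebraMap B S
  let F : B →+* TrivSqZeroExt S S := dualHom φ (fun b => φ (d b)) (by simp) (by simp)
  have hF : ∀ b, F b = TrivSqZeroExt.inl (φ b) + TrivSqZeroExt.inr (φ (d b)) := fun b => rfl
  have hu : ∀ y : M, IsUnit (F y) := by
    intro y
    rw [TrivSqZeroExt.isUnit_iff_isUnit_fst, hF]
    simpa using IsLocalization.map_units S y
  let G : S →+* TrivSqZeroExt S S := IsLocalization.lift hu
  have hG : ∀ b, G (algebraMap B S b) = F b := IsLocalization.lift_eq hu
  have hfst : ∀ s, (G s).fst = s := by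
    have : (TrivSqZeroExt.fstHom S S S).toRingHom.comp G = RingHom.id S := by
      apply IsLocalization.ringHom_ext M
      ext b
      simp [hG, hF, φ]
    intro s
    exact RingHom.congr_fun this s
  obtain ⟨d', hd'⟩ := exists_der_of_dual G hfst
  refine ⟨d', fun b => ?_⟩
  rw [hd', hG, hF, TrivSqZeroExt.snd_add, TrivSqZeroExt.snd_inl, TrivSqZeroExt.snd_inr, zero_add]

lemma der_localization_unique {B S : Type*} [CommRing B] [CommRing S] [Algebra B S]
    (M : Submonoid B) [IsLocalization M S] (d d' : Der S)
    (h : ∀ b, d (algebraMap B S b) = d' (algebraMap B S b)) : d = d' := by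
  ext s
  obtain ⟨⟨b, m⟩, hb⟩ := IsLocalization.surj M s
  simp only at hb
  have h1 := congrArg d hb
  have h2 := congrArg d' hb
  rw [Derivation.leibniz, h] at h1
  rw [Derivation.leibniz, ← h b, ← h1] at h2
  have := add_left_cancel h2
  simp only [smul_eq_mul] at this
  exact ((IsLocalization.map_units S m).mul_left_cancel this).symm

/-- Over a field of char 0, a transcendental element is detected by a derivation. -/
lemma exists_der_ne_zero {κ : Type*} [Field κ] [CharZero κ] (c : κ) (hc : Transcendental ℚ c) :
    ∃ d : Der κ, d c ≠ 0 := by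
  have hinj : Function.Injective (aeval (R := ℚ) c) := transcendental_iff_injective.1 hc
  let φ : RatFunc ℚ →+* κ := IsFractionRing.lift (A := ℚ[X]) (g := (aeval c : ℚ[X] →ₐ[ℚ] κ).toRingHom) hinj
  let : Algebra (RatFunc ℚ) κ := φ.toAlgebra
  have hφ : ∀ p : ℚ[X], φ (algebraMap _ _ p) = aeval c p := fun p =>
    IsFractionRing.lift_algebraMap (A := ℚ[X]) (g := (aeval c : ℚ[X] →ₐ[ℚ] κ).toRingHom) hinj p
  have : CharZero (RatFunc ℚ) := charZero_of_injective_algebraMap (algebraMap ℚ _).injective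
  have hsm : Algebra.FormallySmooth (RatFunc ℚ) κ := by
    obtain ⟨s, hs⟩ := exists_isTranscendenceBasis (RatFunc ℚ) κ
    have h2 : Algebra.IsAlgebraic (IntermediateField.adjoin (RatFunc ℚ) (Set.range ((↑) : s → κ))) κ := by
      exact hs.isAlgebraic_field
    exact Algebra.FormallySmooth.of_algebraicIndependent_of_isSeparable hs.1
  let F : ℚ[X] →+* TrivSqZeroExt κ κ := dualHom (aeval c : ℚ[X] →ₐ[ℚ] κ).toRingHom
    (fun p => aeval c (derivative p)) (by simp) (by
      intro a b; simp [derivative_mul]; ring)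
  have hF : ∀ b, F b = TrivSqZeroExt.inl (aeval c b) + TrivSqZeroExt.inr (aeval c (derivative b)) :=
    fun b => rfl
  have hu : ∀ y : nonZeroDivisors ℚ[X], IsUnit (F y) := by
    intro y
    rw [TrivSqZeroExt.isUnit_iff_isUnit_fst, hF]
    have : aeval c (y : ℚ[X]) ≠ 0 := by
      rw [Ne, map_eq_zero_iff _ hinj]
      exact nonZeroDivisors.coe_ne_zero y
    simpa using this
  let G : RatFunc ℚ →+* TrivSqZeroExt κ κ := IsLocalization.lift hu
  have hG : ∀ b, G (algebraMap ℚ[X] _ b) = F b := IsLocalization.lift_eq hu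
  let : Algebra (RatFunc ℚ) (TrivSqZeroExt κ κ) := G.toAlgebra
  have hfst : ∀ s, (G s).fst = φ s := by
    have : (TrivSqZeroExt.fstHom κ κ κ).toRingHom.comp G = φ := by
      apply IsLocalization.ringHom_ext (nonZeroDivisors ℚ[X])
      ext b
      · simp
      · change (G (algebraMap ℚ[X] _ X)).fst = φ (algebraMap ℚ[X] _ X)
        rw [hG, hF, hφ]; simp
    intro s
    exact RingHom.congr_fun this s
  let π : TrivSqZeroExt κ κ →ₐ[RatFunc ℚ] κ :=
    { (TrivSqZeroExt.fstHom κ κ κ).toRingHom with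
      commutes' := fun r => hfst r }
  have hπ : ∀ x, π x = x.fst := fun _ => rfl
  have hsurj : Function.Surjective π := fun x => ⟨TrivSqZeroExt.inl x, by simp [hπ]⟩
  have hnil : IsNilpotent (RingHom.ker (π : TrivSqZeroExt κ κ →+* κ)) := by
    refine ⟨2, ?_⟩
    refine (pow_two (RingHom.ker (π : TrivSqZeroExt κ κ →+* κ))).trans ?_
    rw [Ideal.zero_eq_bot, eq_bot_iff, Ideal.mul_le]
    intro r hr s hs
    have hr' : r.fst = 0 := hr
    have hs' : s.fst = 0 := hs
    rw [Ideal.mem_bot]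
    ext <;> simp [hr', hs']
  let ψ : κ →ₐ[RatFunc ℚ] TrivSqZeroExt κ κ :=
    Algebra.FormallySmooth.liftOfSurjective (AlgHom.id _ κ) π hsurj hnil
  have hψ : ∀ x, π (ψ x) = x := fun x =>
    Algebra.FormallySmooth.liftOfSurjective_apply (AlgHom.id _ κ) π hsurj hnil x
  obtain ⟨d, hd⟩ := exists_der_of_dual ψ.toRingHom hψ
  refine ⟨d, ?_⟩
  have hc' : c = algebraMap (RatFunc ℚ) κ (algebraMap ℚ[X] _ X) := by
    change c = φ _
    rw [hφ]; simp
  rw [hd]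
  change (ψ c).snd ≠ 0
  have : ψ c = F X := by
    conv_lhs => rw [hc']
    rw [AlgHom.commutes]
    exact hG X
  rw [this, hF]; simp
end BSLC

namespace BSLC
open Polynomial

section EN
variable {S : Type*} [CommRing S] {ι : Type*} (d : ι → Der S) (g s : S)

/-- `y ∈ EN N` means `y g^(1-N) g^s` lies in the order `≤ N` part of `D g^(s+1)`. -/
def EN : ℕ → Ideal S
  | 0 => ⊤
  | N + 1 => Ideal.span ({x | ∃ y ∈ EN N, x = g * y} ∪
      {x | ∃ i, ∃ y ∈ EN N, x = g * d i y + (s + 1 - N) * d i g * y})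

lemma mul_mem_EN {N : ℕ} {y : S} (hy : y ∈ EN d g s N) : g * y ∈ EN d g s (N + 1) :=
  Ideal.subset_span (Or.inl ⟨y, hy, rfl⟩)

lemma T_mem_EN {N : ℕ} (i : ι) {y : S} (hy : y ∈ EN d g s N) :
    g * d i y + (s + 1 - N) * d i g * y ∈ EN d g s (N + 1) :=
  Ideal.subset_span (Or.inr ⟨i, y, hy, rfl⟩)

lemma EN_succ_le {N : ℕ} {J : Ideal S} (h1 : ∀ y ∈ EN d g s N, g * y ∈ J)
    (h2 : ∀ i, ∀ y ∈ EN d g s N, g * d i y + (s + 1 - N) * d i g * y ∈ J) :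
    EN d g s (N + 1) ≤ J := by
  rw [EN, Ideal.span_le]
  rintro x (⟨y, hy, rfl⟩ | ⟨i, y, hy, rfl⟩)
  · exact h1 y hy
  · exact h2 i y hy

lemma pow_mul_mem_EN {N : ℕ} {y : S} (hy : y ∈ EN d g s N) (k : ℕ) :
    g ^ k * y ∈ EN d g s (N + k) := by
  induction k with
  | zero => simpa using hy
  | succ k ih =>
    rw [pow_succ', mul_assoc]
    exact mul_mem_EN d g s ih

lemma EN_map {S' : Type*} [CommRing S'] (d' : ι → Der S') (φ : S →+* S')
    (hφ : ∀ i x, d' i (φ x) = φ (d i x)) (N : ℕ) :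
    EN d' (φ g) (φ s) N = (EN d g s N).map φ := by
  induction N with
  | zero => simp [EN, Ideal.map_top]
  | succ N ih =>
    apply le_antisymm
    · apply EN_succ_le
      · intro y hy
        rw [ih] at hy
        induction hy using Submodule.span_induction with
        | mem x hx =>
          obtain ⟨y, hy, rfl⟩ := hx
          rw [← map_mul]
          exact Ideal.mem_map_of_mem _ (mul_mem_EN d g s hy)
        | zero => simp
        | add x y _ _ hx hy => rw [mul_add]; exact Ideal.add_mem _ hx hy
        | smul a x _ hx => rw [smul_eq_mul, mul_left_comm]; exact Ideal.mul_mem_left _ _ hx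
      · intro i y hy
        rw [ih] at hy
        have key : ∀ y ∈ (EN d g s N).map φ, φ g * y ∈ (EN d g s (N + 1)).map φ ∧
            φ g * d' i y + (φ s + 1 - N) * d' i (φ g) * y ∈ (EN d g s (N + 1)).map φ := by
          intro y hy
          induction hy using Submodule.span_induction with
          | mem x hx =>
            obtain ⟨y, hy, rfl⟩ := hx
            constructor
            · rw [← map_mul]
              exact Ideal.mem_map_of_mem _ (mul_mem_EN d g s hy)
            · have := Ideal.mem_map_of_mem φ (T_mem_EN d g s i hy)
              simpa [hφ] using this
          | zero => simp
          | add x y _ _ hx hy =>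
            refine ⟨by rw [mul_add]; exact Ideal.add_mem _ hx.1 hy.1, ?_⟩
            have := Ideal.add_mem _ hx.2 hy.2
            convert this using 1
            rw [map_add]; ring
          | smul a x _ hx =>
            refine ⟨by rw [smul_eq_mul, mul_left_comm]; exact Ideal.mul_mem_left _ _ hx.1, ?_⟩
            have := Ideal.add_mem _ (Ideal.mul_mem_left _ a hx.2)
              (Ideal.mul_mem_left _ (d' i a) hx.1)
            convert this using 1
            simp only [smul_eq_mul, Derivation.leibniz]; ring
        exact (key y hy).2
    · rw [Ideal.map_le_iff_le_comap]
      apply EN_succ_le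
      · intro y hy
        rw [Ideal.mem_comap, map_mul]
        apply mul_mem_EN
        rw [ih]; exact Ideal.mem_map_of_mem _ hy
      · intro i y hy
        have := T_mem_EN d' (φ g) (φ s) i (N := N) (y := φ y)
          (by rw [ih]; exact Ideal.mem_map_of_mem _ hy)
        rw [Ideal.mem_comap]
        simpa [hφ] using this

lemma EN_le_of_span {ι' : Type*} (d' : ι' → Der S)
    (h : ∀ j, d' j ∈ Submodule.span S (Set.range d)) (N : ℕ) :
    EN d' g s N ≤ EN d g s N := by
  induction N with
  | zero => exact le_rfl
  | succ N ih =>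
    apply EN_succ_le
    · intro y hy; exact mul_mem_EN d g s (ih hy)
    · intro j y hy
      have hy' := ih hy
      have key : ∀ δ ∈ Submodule.span S (Set.range d),
          g * δ y + (s + 1 - N) * δ g * y ∈ EN d g s (N + 1) := by
        intro δ hδ
        induction hδ using Submodule.span_induction with
        | mem x hx =>
          obtain ⟨i, rfl⟩ := hx
          exact T_mem_EN d g s i hy'
        | zero => simp
        | add a b _ _ ha hb =>
          have := Ideal.add_mem _ ha hb
          convert this using 1
          simp only [Derivation.add_apply]; ring
        | smul c a _ ha =>
          have := Ideal.mul_mem_left _ c ha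
          convert this using 1
          simp only [Derivation.smul_apply, smul_eq_mul]; ring
      exact key _ (h j)
end EN

/-- Krull descent. -/
lemma krull_descent {R T : Type*} [CommRing R] [IsNoetherianRing R] [IsLocalRing R] [CommRing T]
    (τ : R →+* T) (𝔫 : Ideal T)
    (h1 : ∀ k r, τ r ∈ 𝔫 ^ k → r ∈ IsLocalRing.maximalIdeal R ^ k)
    (h2 : ∀ k t, ∃ r, t - τ r ∈ 𝔫 ^ k) (J : Ideal R[X]) (x : R[X])
    (hx : x.map τ ∈ J.map (mapRingHom τ)) : x ∈ J := by
  -- x is a finite combination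
  have step1 : ∃ (m : ℕ) (f : Fin m → T) (y : Fin m → R[X]), (∀ l, y l ∈ J) ∧
      x.map τ = ∑ l, C (f l) * (y l).map τ := by
    have key : ∀ z ∈ J.map (mapRingHom τ), ∃ (m : ℕ) (f : Fin m → T) (y : Fin m → R[X]),
        (∀ l, y l ∈ J) ∧ z = ∑ l, C (f l) * (y l).map τ := by
      intro z hz
      have hz' : z ∈ Submodule.span T[X] ((mapRingHom τ) '' (J : Set R[X])) := hz
      have hadd : ∀ z z' : T[X], (∃ (m : ℕ) (f : Fin m → T) (y : Fin m → R[X]),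
        (∀ l, y l ∈ J) ∧ z = ∑ l, C (f l) * (y l).map τ) → (∃ (m : ℕ) (f : Fin m → T)
          (y : Fin m → R[X]), (∀ l, y l ∈ J) ∧ z' = ∑ l, C (f l) * (y l).map τ) →
          (∃ (m : ℕ) (f : Fin m → T)
          (y : Fin m → R[X]), (∀ l, y l ∈ J) ∧ z + z' = ∑ l, C (f l) * (y l).map τ) := by
        rintro z z' ⟨m, f, y, hy, rfl⟩ ⟨m', f', y', hy', rfl⟩
        refine ⟨m + m', Fin.append f f', Fin.append y y', ?_, ?_⟩
        · intro l
          refine Fin.addCases (fun l => ?_) (fun l => ?_) l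
          · simpa using hy l
          · simpa using hy' l
        · rw [Fin.sum_univ_add]; simp
      clear hz
      induction hz' using Submodule.span_induction with
      | mem z hz =>
        obtain ⟨y, hy, rfl⟩ := hz
        exact ⟨1, fun _ => 1, fun _ => y, fun _ => hy, by simp⟩
      | zero => exact ⟨0, Fin.elim0, Fin.elim0, fun l => l.elim0, by simp⟩
      | add z z' _ _ h h' => exact hadd _ _ h h'
      | smul p z _ h =>
        obtain ⟨m, f, y, hy, rfl⟩ := h
        rw [smul_eq_mul]
        induction p using Polynomial.induction_on' with
        | add p q hp hq => rw [add_mul]; exact hadd _ _ hp hq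
        | monomial n a =>
          refine ⟨m, fun l => a * f l, fun l => X ^ n * y l, fun l => J.mul_mem_left _ (hy l), ?_⟩
          rw [Finset.mul_sum]
          refine Finset.sum_congr rfl fun l _ => ?_
          rw [← C_mul_X_pow_eq_monomial]
          simp only [map_mul, Polynomial.map_mul, Polynomial.map_pow, map_X]
          ring
    exact key _ hx
  obtain ⟨m, f, y, hy, hxy⟩ := step1
  obtain ⟨D, hxD, hyD⟩ : ∃ D, x ∈ degreeLT R D ∧ ∀ l, y l ∈ degreeLT R D := by
    refine ⟨x.natDegree + ∑ l, (y l).natDegree + 1, ?_, fun l => ?_⟩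
    · rw [mem_degreeLT]
      refine lt_of_le_of_lt degree_le_natDegree ?_
      exact_mod_cast (by omega)
    · rw [mem_degreeLT]
      refine lt_of_le_of_lt degree_le_natDegree ?_
      have := Finset.single_le_sum (f := fun l => (y l).natDegree) (fun _ _ => Nat.zero_le _)
        (Finset.mem_univ l)
      exact_mod_cast (by omega)
  let M := degreeLT R D
  let N : Submodule R M := Submodule.span R (Set.range fun l => (⟨y l, hyD l⟩ : M))
  have hfin : Module.Finite R M := Module.Finite.equiv (degreeLTEquiv R D).symm
  have hmem : ∀ k, (⟨x, hxD⟩ : M) ∈ N ⊔ IsLocalRing.maximalIdeal R ^ k • (⊤ : Submodule R M) := by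
    intro k
    choose r hr using fun l => h2 k (f l)
    have hxe : (⟨x, hxD⟩ : M) = (∑ l, r l • (⟨y l, hyD l⟩ : M)) +
        ((⟨x, hxD⟩ : M) - (∑ l, r l • (⟨y l, hyD l⟩ : M))) := by abel
    rw [hxe]
    refine Submodule.add_mem_sup ?_ ?_
    · exact Submodule.sum_mem _ fun l _ => Submodule.smul_mem _ _ (Submodule.subset_span ⟨l, rfl⟩)
    · set v := (⟨x, hxD⟩ : M) - (∑ l, r l • (⟨y l, hyD l⟩ : M)) with hv
      have hc : ∀ i, (v : R[X]).coeff i ∈ IsLocalRing.maximalIdeal R ^ k := by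
        intro i
        apply h1
        have h3 : (v : R[X]) = x - ∑ l, C (r l) * y l := by
          simp [hv, smul_eq_C_mul]
        have h4 : τ ((v : R[X]).coeff i) = ∑ l, (f l - τ (r l)) * τ ((y l).coeff i) := by
          rw [← coeff_map, h3, Polynomial.map_sub, hxy, Polynomial.map_sum]
          simp [finsetSum_coeff, sub_mul, Finset.sum_sub_distrib]
        rw [h4]
        exact Ideal.sum_mem _ fun l _ => Ideal.mul_mem_right _ _ (hr l)
      -- v as a combination of monomials
      have h5 : v = ∑ i : Fin D, ((v : R[X]).coeff i) • (⟨X ^ (i : ℕ), by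
          rw [mem_degreeLT]; exact lt_of_le_of_lt (degree_X_pow_le _) (by exact_mod_cast i.2)⟩ : M) := by
        apply Subtype.ext
        have hv2 := v.2
        rw [AddSubmonoidClass.coe_finsetSum]
        simp only [SetLike.val_smul]
        rw [Fin.sum_univ_eq_sum_range (fun i => (v : R[X]).coeff i • (X : R[X]) ^ i)]
        ext i
        simp only [finsetSum_coeff, coeff_smul, coeff_X_pow, smul_eq_mul]
        rw [mem_degreeLT] at hv2
        simp only [mul_ite, mul_one, mul_zero, Finset.sum_ite_eq, Finset.mem_range]
        split_ifs with h
        · rfl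
        · exact coeff_eq_zero_of_degree_lt (lt_of_lt_of_le hv2 (by exact_mod_cast not_lt.1 h))
      rw [h5]
      exact Submodule.sum_mem _ fun i _ => Submodule.smul_mem_smul (hc i) trivial
  have hN : (⟨x, hxD⟩ : M) ∈ N := by
    have hk := Ideal.iInf_pow_smul_eq_bot_of_isLocalRing (R := R) (M := M ⧸ N)
      (IsLocalRing.maximalIdeal R) (Ideal.IsPrime.ne_top inferInstance)
    rw [← Submodule.Quotient.mk_eq_zero, ← Submodule.mem_bot R, ← hk, Submodule.mem_iInf]
    intro k
    obtain ⟨a, ha, b, hb, hab⟩ := Submodule.mem_sup.1 (hmem k)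
    rw [← hab, Submodule.Quotient.mk_add, (Submodule.Quotient.mk_eq_zero N).2 ha, zero_add]
    have : N.mkQ b ∈ (IsLocalRing.maximalIdeal R ^ k • (⊤ : Submodule R M)).map N.mkQ :=
      Submodule.mem_map_of_mem hb
    rw [Submodule.map_smul''] at this
    exact Submodule.smul_mono le_rfl le_top this
  have : ∀ v ∈ N, (v : R[X]) ∈ J := by
    intro v hv
    induction hv using Submodule.span_induction with
    | mem v hv => obtain ⟨l, rfl⟩ := hv; exact hy l
    | zero => simp
    | add a b _ _ ha hb => exact J.add_mem ha hb
    | smul c a _ ha =>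
      rw [SetLike.val_smul, smul_eq_C_mul]; exact J.mul_mem_left _ ha
  exact this _ hN
end BSLC

namespace BSLC
open Polynomial

section BF
variable {κ A : Type*} [Field κ] [CharZero κ] [CommRing A] [IsDomain A] [Algebra κ A]
  {L : Type*} [Field L] [Algebra A[X] L] [IsFractionRing A[X] L]
  {n : ℕ} (d : Fin n → Der A) (g : A)

/-- extension of a derivation to the fraction field of `A[X]` -/
noncomputable def fracDer (L : Type*) [Field L] [Algebra A[X] L] [IsFractionRing A[X] L] (δ : Der A) :
    Der (L) :=
  (exists_der_localization (S := L) (nonZeroDivisors A[X]) (polyDer δ)).choose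

lemma fracDer_algebraMap (δ : Der A) (p : A[X]) :
    fracDer L δ (algebraMap A[X] (L) p) = algebraMap _ _ (polyDer δ p) :=
  (exists_der_localization (S := L) (nonZeroDivisors A[X])
    (polyDer δ)).choose_spec p

local notation "ν" => algebraMap A[X] L

/-- twisted derivation -/
noncomputable def twDer (δ : Der A) (x : L) : L :=
  fracDer L δ x + ν X * (ν (C (δ g)) / ν (C g)) * x

lemma twDer_add (δ : Der A) (x y : L) :
    twDer g δ (x + y) = twDer g δ x + twDer g δ y := by
  simp only [twDer, map_add]; ring

lemma twDer_mul (δ : Der A) (x y : L) :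
    twDer g δ (x * y) = x * twDer g δ y + fracDer L δ x * y := by
  simp only [twDer, Derivation.leibniz, smul_eq_mul]; ring

lemma twDer_zpow (hg : g ≠ 0) (δ : Der A) (y : A[X]) (e : ℤ) :
    twDer g δ (ν y * ν (C g) ^ e) =
      ν (C g * polyDer δ y + (X + C (e : A)) * polyDer δ (C g) * y) * ν (C g) ^ (e - 1) := by
  have hγ : ν (C g) ≠ 0 := by
    rw [Ne, FaithfulSMul.algebraMap_eq_zero_iff]; simpa using hg
  simp only [twDer, Derivation.leibniz, Derivation.leibniz_zpow, fracDer_algebraMap, smul_eq_mul,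
    map_add, map_mul, polyDer_C, zsmul_eq_mul, map_intCast]
  rw [zpow_sub_one₀ hγ]
  field_simp
  ring

/-- `W j` is `D[X] g^(j+1)`. -/
noncomputable def WW (hg : g ≠ 0) (j : ℤ) : Submodule A[X] L where
  carrier := {x | ∃ N : ℕ, ∃ y ∈ EN (fun i => polyDer (d i)) (C g) (X + C (j : A)) N,
    x = ν y * ν (C g) ^ (1 - N + j : ℤ)}
  zero_mem' := ⟨0, 0, Ideal.zero_mem _, by simp⟩
  add_mem' := by
    have hγ : ν (C g) ≠ 0 := by
      rw [Ne, FaithfulSMul.algebraMap_eq_zero_iff]; simpa using hg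
    rintro _ _ ⟨N, y, hy, rfl⟩ ⟨N', y', hy', rfl⟩
    refine ⟨N + N', (C g) ^ N' * y + (C g) ^ N * y', Ideal.add_mem _ (pow_mul_mem_EN _ _ _ hy _) ?_, ?_⟩
    · rw [add_comm N]; exact pow_mul_mem_EN _ _ _ hy' _
    · simp only [map_add, map_mul, map_pow]
      rw [add_mul]
      congr 1
      · rw [mul_comm (ν (C g) ^ N'), mul_assoc, ← zpow_natCast, ← zpow_add₀ hγ]
        congr 2; push_cast; ring
      · rw [mul_comm (ν (C g) ^ N), mul_assoc, ← zpow_natCast, ← zpow_add₀ hγ]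
        congr 2; push_cast; ring
  smul_mem' := by
    rintro p _ ⟨N, y, hy, rfl⟩
    refine ⟨N, p * y, Ideal.mul_mem_left _ _ hy, ?_⟩
    rw [Algebra.smul_def, map_mul, mul_assoc]

variable (hg : g ≠ 0)

omit [IsDomain A] in
lemma aux_poly (δ : Der A) (y : A[X]) (j : ℤ) (N : ℕ) :
    C g * polyDer δ y + (X + C (j : A) + 1 - (N : A[X])) * polyDer δ (C g) * y =
    C g * polyDer δ y + (X + C (((1 - N + j : ℤ)) : A)) * polyDer δ (C g) * y := by
  have : C (((1 - N + j : ℤ)) : A) = C (j : A) + 1 - (N : A[X]) := by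
    push_cast; simp only [map_add, map_sub, map_natCast, map_intCast, map_one]; ring
  rw [this]; ring

lemma twDer_zpow' (hg : g ≠ 0) (δ : Der A) (y : A[X]) (j : ℤ) (N : ℕ) :
    twDer g δ (ν y * ν (C g) ^ (1 - N + j : ℤ)) =
      ν (C g * polyDer δ y + (X + C (j : A) + 1 - (N : A[X])) * polyDer δ (C g) * y) *
        ν (C g) ^ (1 - (N + 1 : ℕ) + j : ℤ) := by
  rw [twDer_zpow g hg, aux_poly]
  have : (1 - N + j : ℤ) - 1 = (1 - (N + 1 : ℕ) + j : ℤ) := by push_cast; ring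
  rw [this]

lemma WW_twDer (j : ℤ) (i : Fin n) {x : L} (hx : x ∈ WW d g hg j) :
    twDer g (d i) x ∈ WW d g hg j := by
  obtain ⟨N, y, hy, rfl⟩ := hx
  exact ⟨N + 1, _, T_mem_EN _ _ _ i hy, twDer_zpow' g hg (d i) y j N⟩

lemma zpow_mem_WW (j : ℤ) : ν (C g) ^ (j + 1) ∈ WW d g hg j :=
  ⟨0, 1, trivial, by simp [add_comm]⟩

lemma WW_induction (hg : g ≠ 0) (j : ℤ) (Q : ℕ → AddSubgroup L) (hP : ∀ N (p : A[X]), ∀ x ∈ Q N, ν p * x ∈ Q N)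
    (hQ : ∀ N, Q N ≤ Q (N + 1)) (h0 : ν (C g) ^ (j + 1) ∈ Q 0)
    (hD : ∀ N i, ∀ x ∈ Q N, twDer g (d i) x ∈ Q (N + 1)) (N : ℕ) :
    ∀ y ∈ EN (fun i => polyDer (d i)) (C g) (X + C (j : A)) N,
      ν y * ν (C g) ^ (1 - N + j : ℤ) ∈ Q N := by
  have hγ : ν (C g) ≠ 0 := by
    rw [Ne, FaithfulSMul.algebraMap_eq_zero_iff]; simpa using hg
  induction N with
  | zero => intro y _; apply hP; simpa [add_comm] using h0
  | succ N ih =>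
    intro y hy
    simp only [EN] at hy
    induction hy using Submodule.span_induction with
    | mem x hx =>
      obtain ⟨y, hy, rfl⟩ | ⟨i, y, hy, rfl⟩ := hx
      · have := hQ _ (ih y hy)
        have e : (1 - N + j : ℤ) = (1 + (1 - (N + 1 : ℕ) + j : ℤ)) := by push_cast; ring
        rw [map_mul, mul_comm (ν (C g)), mul_assoc, ← zpow_one_add₀ hγ, ← e]
        exact this
      · have := hD N i _ (ih y hy)
        rw [twDer_zpow' g hg] at this
        exact this
    | zero => simpa using (Q (N + 1)).zero_mem
    | add x y _ _ hx hy => rw [map_add, add_mul]; exact (Q (N + 1)).add_mem hx hy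
    | smul p x _ hx => rw [smul_eq_mul, map_mul, mul_assoc]; exact hP _ _ _ hx

lemma WW_le (j : ℤ) (Q : Submodule A[X] L) (h0 : ν (C g) ^ (j + 1) ∈ Q)
    (hD : ∀ i, ∀ x ∈ Q, twDer g (d i) x ∈ Q) : WW d g hg j ≤ Q := by
  rintro _ ⟨N, y, hy, rfl⟩
  refine WW_induction d g hg j (fun _ => Q.toAddSubgroup) (fun N p x hx => ?_) (fun _ => le_rfl) h0
    (fun _ => hD) N y hy
  rw [← Algebra.smul_def]; exact Q.smul_mem p hx

/-- membership in `W` in terms of `EN`. -/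
lemma mem_WW_iff (j : ℤ) (x : A[X]) : ν x * ν (C g) ^ j ∈ WW d g hg j ↔
    ∃ N : ℕ, x * C g ^ N ∈ EN (fun i => polyDer (d i)) (C g) (X + C (j : A)) (N + 1) := by
  have hγ : ν (C g) ≠ 0 := by
    rw [Ne, FaithfulSMul.algebraMap_eq_zero_iff]; simpa using hg
  constructor
  · rintro ⟨N, y, hy, h⟩
    refine ⟨N, ?_⟩
    have : x * C g ^ N = C g * y := by
      apply IsFractionRing.injective A[X] L
      rw [map_mul, map_mul, map_pow]
      rw [show (1 - N + j : ℤ) = 1 - N + j from rfl, zpow_add₀ hγ, ← mul_assoc] at h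
      have h2 := mul_right_cancel₀ (zpow_ne_zero _ hγ) h
      rw [h2, zpow_sub₀ hγ, zpow_one, zpow_natCast]
      field_simp
    rw [this]
    exact mul_mem_EN _ _ _ hy
  · rintro ⟨N, hN⟩
    refine ⟨N + 1, _, hN, ?_⟩
    rw [map_mul, map_pow, mul_assoc, ← zpow_natCast, ← zpow_add₀ hγ]
    congr 2; push_cast; ring

/-- shift homomorphism -/
noncomputable def shiftHom (A : Type*) [CommRing A] (j : ℤ) : A[X] →+* A[X] :=
  (aeval (X + C (j : A)) : A[X] →ₐ[A] A[X]).toRingHom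

@[simp] lemma shiftHom_C (j : ℤ) (a : A) : shiftHom A j (C a) = C a := by simp [shiftHom]
@[simp] lemma shiftHom_X (j : ℤ) : shiftHom A j X = X + C (j : A) := by simp [shiftHom]

lemma shiftHom_polyDer (δ : Der A) (j : ℤ) (x : A[X]) :
    polyDer δ (shiftHom A j x) = shiftHom A j (polyDer δ x) := by
  induction x using Polynomial.induction_on' with
  | add p q hp hq => simp only [map_add, hp, hq]
  | monomial m a =>
    rw [← C_mul_X_pow_eq_monomial]
    simp only [map_mul, map_pow, Derivation.leibniz, Derivation.leibniz_pow, polyDer_C, polyDer_X,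
      shiftHom_C, shiftHom_X, map_add, smul_eq_mul]
    simp

lemma shiftHom_mem_EN (j l : ℤ) (N : ℕ) {x : A[X]}
    (hx : x ∈ EN (fun i => polyDer (d i)) (C g) (X + C (l : A)) N) :
    shiftHom A j x ∈ EN (fun i => polyDer (d i)) (C g) (X + C ((l + j : ℤ) : A)) N := by
  have := EN_map (fun i => polyDer (d i)) (C g) (X + C (l : A)) (fun i => polyDer (d i))
    (shiftHom A j) (fun i x => shiftHom_polyDer _ _ _) N
  simp only [map_add, shiftHom_C, shiftHom_X] at this
  have h2 : (X + C ((l + j : ℤ) : A)) = X + C (j : A) + C (l : A) := by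
    push_cast; rw [map_add]; ring
  rw [h2, this]
  exact Ideal.mem_map_of_mem _ hx

/-- constant polynomials -/
noncomputable def cst (A : Type*) {κ : Type*} [Field κ] [CommRing A] [Algebra κ A] : κ[X] →+* A[X] :=
  mapRingHom (algebraMap κ A)

lemma cst_injective : Function.Injective (cst A : κ[X] →+* A[X]) :=
  Polynomial.map_injective _ (algebraMap κ A).injective

lemma shiftHom_cst (j : ℤ) (b : κ[X]) : shiftHom A j (cst A b) = cst A (shiftHom κ j b) := by
  induction b using Polynomial.induction_on' with
  | add p q hp hq => simp only [map_add, hp, hq]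
  | monomial m a =>
    rw [← C_mul_X_pow_eq_monomial]
    simp [cst]

lemma shiftHom_ne_zero (j : ℤ) {b : κ[X]} (hb : b ≠ 0) : shiftHom κ j b ≠ 0 := by
  have : shiftHom κ j b = b.comp (X + C (j : κ)) := by
    simp [shiftHom, Polynomial.comp, aeval_def]
  rw [this]
  intro h
  rw [Polynomial.comp_eq_zero_iff] at h
  rcases h with h | h
  · exact hb h
  · have := congrArg (fun p => p.coeff 1) h.2
    simp [coeff_C] at this
end BF
end BSLC

namespace BSLC
open Polynomial

section BF
variable {κ A : Type*} [Field κ] [CharZero κ] [CommRing A] [IsDomain A] [Algebra κ A]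
  {L : Type*} [Field L] [Algebra A[X] L] [IsFractionRing A[X] L]
  {K : Type*} [Field K] [Algebra κ[X] K] [IsFractionRing κ[X] K] [Algebra K L]
  {n : ℕ} (d : Fin n → Der A) (g : A)

local notation "ν" => algebraMap A[X] L

lemma polyDer_cst (δ : Der A) (hδ : ∀ c : κ, δ (algebraMap κ A c) = 0) (b : κ[X]) :
    polyDer δ (cst A b) = 0 := by
  ext m
  rw [coeff_polyDer]
  simp [cst, hδ]

lemma exists_cst_sub_mem (z : Fin n → A)
    (hA : ∀ a : A, ∃ c : κ, a - algebraMap κ A c ∈ Ideal.span (Set.range z)) (p : A[X]) :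
    ∃ b : κ[X], p - cst A b ∈ Ideal.span (Set.range fun i => (C (z i) : A[X])) := by
  induction p using Polynomial.induction_on' with
  | add p q hp hq =>
    obtain ⟨b, hb⟩ := hp
    obtain ⟨b', hb'⟩ := hq
    refine ⟨b + b', ?_⟩
    have := Ideal.add_mem _ hb hb'
    rw [map_add]
    convert this using 1; ring
  | monomial m a =>
    obtain ⟨c, hc⟩ := hA a
    refine ⟨monomial m c, ?_⟩
    have : monomial m a - cst A (monomial m c) = X ^ m * C (a - algebraMap κ A c) := by
      rw [map_sub, mul_sub, cst]; simp [← C_mul_X_pow_eq_monomial]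
    rw [this]
    apply Ideal.mul_mem_left
    have := Ideal.mem_map_of_mem (C : A →+* A[X]) hc
    rw [Ideal.map_span, ← Set.range_comp] at this
    exact this

variable (hK : ∀ b : κ[X], (algebraMap K L) ((algebraMap κ[X] K) b) = (algebraMap A[X] L) (cst A b))

include hK in
lemma fracDer_K (δ : Der A) (hδ : ∀ c : κ, δ (algebraMap κ A c) = 0) (c : K) :
    fracDer L δ (algebraMap K L c) = 0 := by
  obtain ⟨a, b, hb, rfl⟩ := IsFractionRing.div_surjective (A := κ[X]) c
  rw [map_div₀, hK, hK, Derivation.leibniz_div]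
  simp only [fracDer_algebraMap, polyDer_cst δ hδ]
  simp

include hK in
lemma ν_cst_ne (b : κ[X]) (hb : b ≠ 0) : ν (cst A b) ≠ 0 := by
  rw [← hK]; simpa using hb

/-- the ring `A ⊗ κ(X)` inside `L`. -/
def AK : Subalgebra K L where
  carrier := {x | ∃ b : κ[X], b ≠ 0 ∧ ∃ p, ν (cst A b) * x = ν p}
  mul_mem' := by
    rintro x y ⟨b, hb, p, h⟩ ⟨b', hb', p', h'⟩
    refine ⟨b * b', mul_ne_zero hb hb', p * p', ?_⟩
    rw [map_mul, map_mul, map_mul, ← h, ← h']; ring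
  add_mem' := by
    rintro x y ⟨b, hb, p, h⟩ ⟨b', hb', p', h'⟩
    refine ⟨b * b', mul_ne_zero hb hb', cst A b' * p + cst A b * p', ?_⟩
    rw [map_mul, map_mul, map_add, map_mul, map_mul, ← h, ← h']; ring
  algebraMap_mem' := by
    intro c
    obtain ⟨a, b, hb, rfl⟩ := IsFractionRing.div_surjective (A := κ[X]) c
    have hb' := nonZeroDivisors.ne_zero hb
    refine ⟨b, hb', cst A a, ?_⟩
    rw [map_div₀, hK, hK]
    have := ν_cst_ne hK b hb'
    field_simp

/-- restriction of a derivation. -/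
noncomputable def derAK (δ : Der A) (hδ : ∀ c : κ, δ (algebraMap κ A c) = 0) :
    Derivation K (AK hK) (AK hK) where
  toFun x := ⟨fracDer L δ x, by
    obtain ⟨b, hb, p, h⟩ := x.2
    refine ⟨b, hb, polyDer δ p, ?_⟩
    have := congrArg (fracDer L δ) h
    simp only [Derivation.leibniz, fracDer_algebraMap, smul_eq_mul, polyDer_cst δ hδ] at this
    simpa using this⟩
  map_add' x y := by ext; simp
  map_smul' c x := by
    ext
    simp [Algebra.smul_def, fracDer_K hK δ hδ]
  map_one_eq_zero' := by ext; simp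
  leibniz' x y := by ext; simp

/-- the twisted derivation as a `K`-linear map. -/
noncomputable def twEnd (δ : Der A) (hδ : ∀ c : κ, δ (algebraMap κ A c) = 0) : Module.End K L where
  toFun := twDer g δ
  map_add' := twDer_add g δ
  map_smul' c x := by
    simp [Algebra.smul_def, twDer_mul, fracDer_K hK δ hδ]

lemma ν_mem_AK (p : A[X]) : ν p ∈ AK hK := ⟨1, one_ne_zero, p, by simp⟩

/-- the map `A[X] → AK`. -/
noncomputable def toAK : A[X] →+* AK hK := (ν).codRestrict _ (ν_mem_AK hK)

/-- elements which are in `W` up to constants. -/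
def VV (hg : g ≠ 0) (j : ℤ) : Submodule (AK hK) L where
  carrier := {x | ∃ b : κ[X], b ≠ 0 ∧ ν (cst A b) * x ∈ WW d g hg j}
  zero_mem' := ⟨1, one_ne_zero, by simp⟩
  add_mem' := by
    rintro x y ⟨b, hb, h⟩ ⟨b', hb', h'⟩
    refine ⟨b * b', mul_ne_zero hb hb', ?_⟩
    have := Submodule.add_mem _ (Submodule.smul_mem _ (cst A b') h) (Submodule.smul_mem _ (cst A b) h')
    convert this using 1
    rw [Algebra.smul_def, Algebra.smul_def, map_mul, map_mul]; ring
  smul_mem' := by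
    rintro ⟨r, b, hb, p, hp⟩ x ⟨b', hb', h⟩
    refine ⟨b * b', mul_ne_zero hb hb', ?_⟩
    have := Submodule.smul_mem _ p h
    convert this using 1
    change _ * (r * x) = _
    rw [Algebra.smul_def, map_mul, map_mul, ← hp]
    ring

variable [CharZero K] (hdκ : ∀ i, ∀ c : κ, d i (algebraMap κ A c) = 0)

lemma bf_hA (z : Fin n → A)
    (hA : ∀ a : A, ∃ c : κ, a - algebraMap κ A c ∈ Ideal.span (Set.range z)) (a : AK hK) :
    ∃ c : K, a - algebraMap K (AK hK) c ∈ Ideal.span (Set.range fun i => toAK hK (C (z i))) := by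
  obtain ⟨a, ha⟩ := a
  have ha' := ha
  obtain ⟨b, hb, p, hp⟩ := ha
  obtain ⟨b', hb'⟩ := exists_cst_sub_mem z hA p
  refine ⟨algebraMap κ[X] K b' / algebraMap κ[X] K b, ?_⟩
  have hm := Ideal.mem_map_of_mem (toAK hK) hb'
  rw [Ideal.map_span, ← Set.range_comp] at hm
  have hm2 := Ideal.mul_mem_left _ (algebraMap K (AK hK) (algebraMap κ[X] K b)⁻¹) hm
  refine (congrArg (· ∈ _) (Subtype.ext ?_)).mpr hm2
  change a - algebraMap K L (_ / _) = algebraMap K L _ * ν _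
  have := ν_cst_ne hK b hb
  rw [map_div₀, map_inv₀, hK, hK, map_sub, ← hp]
  field_simp

lemma bf_hs (z : Fin n → A) (hg : g ≠ 0)
    (B₀ : κ[X]) (hB₀ : B₀ ≠ 0) (s N : ℕ)
    (h : ∀ f ∈ Ideal.span (Set.range z) ^ s,
      C f * cst A B₀ * C g ^ N ∈ EN (fun i => polyDer (d i)) (C g) X (N + 1)) (j : ℤ) :
    Ideal.span (Set.range fun i => toAK hK (C (z i))) ^ s •
      Submodule.span (AK hK) {(algebraMap A[X] L) (C g) ^ j} ≤
      ordF (fun i => twEnd g hK (d i) (hdκ i))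
        (Submodule.span (AK hK) {(algebraMap A[X] L) (C g) ^ (j + 1)}) (N + 1) := by
  have hγ : (algebraMap A[X] L) (C g) ≠ 0 := by
    rw [Ne, FaithfulSMul.algebraMap_eq_zero_iff]; simpa using hg
  have hmap : Ideal.span (Set.range fun i => toAK hK (C (z i))) ^ s =
      (Ideal.span (Set.range z) ^ s).map ((toAK hK).comp C) := by
    rw [Ideal.map_pow, Ideal.map_span, ← Set.range_comp]; rfl
  rw [hmap, Submodule.smul_le]
  intro r hr x hx
  rw [Submodule.mem_span_singleton] at hx
  obtain ⟨a, rfl⟩ := hx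
  rw [smul_comm]
  apply Submodule.smul_mem
  induction hr using Submodule.span_induction with
  | zero => simp
  | add x y _ _ hx hy => rw [add_smul]; exact Submodule.add_mem _ hx hy
  | smul a x _ hx => rw [smul_assoc]; exact Submodule.smul_mem _ _ hx
  | mem r hr =>
    obtain ⟨f, hf, rfl⟩ := hr
    have h1 := shiftHom_mem_EN d g j 0 (N + 1) (by simpa using h f hf)
    have h2 := WW_induction (L := L) d g hg (0 + j)
      (fun N => (ordF (fun i => twEnd g hK (d i) (hdκ i))
        (Submodule.span (AK hK) {(algebraMap A[X] L) (C g) ^ (j + 1)}) N).toAddSubgroup)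
      (fun N p x hx => Submodule.smul_mem _ (toAK hK p) hx)
      (fun N => ordF_le_succ _ _ _) (by
        rw [zero_add]; exact Submodule.mem_span_singleton_self _)
      (fun N i x hx => D_mem_ordF (fun i => twEnd g hK (d i) (hdκ i)) _ _ i hx) (N + 1) _ h1
    simp only [map_mul, shiftHom_cst, map_pow, shiftHom_C] at h2
    have hb0 := ν_cst_ne hK _ (shiftHom_ne_zero j hB₀)
    have h3 := Submodule.smul_mem _ (algebraMap K (AK hK)
      (algebraMap κ[X] K (shiftHom κ j B₀))⁻¹) h2
    have e : (1 - (N + 1 : ℕ) + (0 + j) : ℤ) = j - N := by push_cast; ring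
    rw [e] at h3
    convert h3 using 1
    change ν (C f) * _ = algebraMap K L _ * _
    rw [map_inv₀, hK, zpow_sub₀ hγ, zpow_natCast]
    field_simp

include hK hdκ in
theorem bf_count (z : Fin n → A)
    (hz : ∀ i j, d i (z j) = if i = j then 1 else 0)
    (hA : ∀ a : A, ∃ c : κ, a - algebraMap κ A c ∈ Ideal.span (Set.range z)) (hg : g ≠ 0)
    (B₀ : κ[X]) (hB₀ : B₀ ≠ 0) (s N : ℕ)
    (h : ∀ f ∈ Ideal.span (Set.range z) ^ s,
      C f * cst A B₀ * C g ^ N ∈ EN (fun i => polyDer (d i)) (C g) X (N + 1)) :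
    ∃ b : κ[X], b ≠ 0 ∧ ∃ N, cst A b * C g ^ N ∈ EN (fun i => polyDer (d i)) (C g) X (N + 1) := by
  have hγ : (algebraMap A[X] L) (C g) ≠ 0 := by
    rw [Ne, FaithfulSMul.algebraMap_eq_zero_iff]; simpa using hg
  have h1 : ∀ i (a : AK hK) (x : L), twEnd g hK (d i) (hdκ i) (a • x) =
      a • twEnd g hK (d i) (hdκ i) x + derAK hK (d i) (hdκ i) a • x := fun i a x => by
    change twDer g (d i) (a * x) = a * twDer g (d i) x + fracDer L (d i) a * x
    exact twDer_mul _ _ _ _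
  have h2 : ∀ i j, derAK hK (d i) (hdκ i) (toAK hK (C (z j))) = if i = j then 1 else 0 := fun i j => by
    apply Subtype.ext
    change fracDer L (d i) (ν (C (z j))) = _
    rw [fracDer_algebraMap, polyDer_C, hz]
    split_ifs <;> simp
  have h4 : ∀ j : ℤ, ∃ a : AK hK, (algebraMap A[X] L) (C g) ^ (j + 1) = a • (algebraMap A[X] L) (C g) ^ j :=
    fun j => ⟨toAK hK (C g), by rw [zpow_add_one₀ hγ, mul_comm]; rfl⟩
  have h5 : ∀ i (j : ℤ), twEnd g hK (d i) (hdκ i) ((algebraMap A[X] L) (C g) ^ j) ∈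
      Submodule.span (AK hK) {(algebraMap A[X] L) (C g) ^ (j - 1)} := fun i j => by
    change twDer g (d i) _ ∈ _
    have := twDer_zpow (L := L) g hg (d i) 1 j
    rw [map_one, one_mul] at this
    rw [this]
    exact Submodule.smul_mem _ (toAK hK _) (Submodule.mem_span_singleton_self _)
  have key := count_lemma (K := K) (A := AK hK) (X := L) (fun i => derAK hK (d i) (hdκ i))
    (fun i => twEnd g hK (d i) (hdκ i)) h1 (fun i => toAK hK (C (z i))) h2 (bf_hA hK z hA)
    (fun j => (algebraMap A[X] L) (C g) ^ j) h4 h5 s (N + 1) (bf_hs d g hK hdκ z hg B₀ hB₀ s N h)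
  obtain ⟨j, hj⟩ := key
  have hle : DSpan (AK hK) (fun i x => twEnd g hK (d i) (hdκ i) x) {ν (C g) ^ (j + 1)} ≤ VV d g hK hg j := by
    apply DSpan_le
    · rintro _ rfl
      exact ⟨1, one_ne_zero, by simpa using zpow_mem_WW d g hg j⟩
    · rintro i x ⟨b, hb, hx⟩
      refine ⟨b, hb, ?_⟩
      have := WW_twDer d g hg j i hx
      rw [twDer_mul, fracDer_algebraMap, polyDer_cst _ (hdκ i), map_zero, zero_mul, add_zero] at this
      exact this
  obtain ⟨b, hb, hbj⟩ := hle hj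
  rw [mem_WW_iff] at hbj
  obtain ⟨N', hN'⟩ := hbj
  have := shiftHom_mem_EN d g (-j) j (N' + 1) hN'
  refine ⟨shiftHom κ (-j) b, shiftHom_ne_zero _ hb, N', ?_⟩
  simpa [shiftHom_cst] using this
end BF

theorem bf_count' {κ A : Type*} [Field κ] [CharZero κ] [CommRing A] [IsDomain A] [Algebra κ A]
    {n : ℕ} (d : Fin n → Der A) (g : A) (hdκ : ∀ i, ∀ c : κ, d i (algebraMap κ A c) = 0)
    (z : Fin n → A)
    (hz : ∀ i j, d i (z j) = if i = j then 1 else 0)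
    (hA : ∀ a : A, ∃ c : κ, a - algebraMap κ A c ∈ Ideal.span (Set.range z)) (hg : g ≠ 0)
    (B₀ : κ[X]) (hB₀ : B₀ ≠ 0) (s N : ℕ)
    (h : ∀ f ∈ Ideal.span (Set.range z) ^ s,
      C f * cst A B₀ * C g ^ N ∈ EN (fun i => polyDer (d i)) (C g) X (N + 1)) :
    ∃ b : κ[X], b ≠ 0 ∧ ∃ N, cst A b * C g ^ N ∈ EN (fun i => polyDer (d i)) (C g) X (N + 1) := by
  have hinj : Function.Injective ((algebraMap A[X] (FractionRing A[X])).comp (cst A : κ[X] →+* A[X])) :=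
    (IsFractionRing.injective A[X] (FractionRing A[X])).comp cst_injective
  letI : Algebra (FractionRing κ[X]) (FractionRing A[X]) :=
    (IsFractionRing.lift (K := FractionRing κ[X]) hinj).toAlgebra
  haveI : CharZero (FractionRing κ[X]) :=
    charZero_of_injective_algebraMap (IsFractionRing.injective κ[X] (FractionRing κ[X]))
  exact bf_count (K := FractionRing κ[X]) (L := FractionRing A[X]) d g
    (fun b => IsFractionRing.lift_algebraMap hinj b) hdκ z hz hA hg B₀ hB₀ s N h
end BSLC

namespace BSLC
open Polynomial

section BF
variable {κ A : Type*} [Field κ] [CharZero κ] [CommRing A] [IsDomain A] [Algebra κ A]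
  {L : Type*} [Field L] [Algebra A[X] L] [IsFractionRing A[X] L]
  {n : ℕ} (d : Fin n → Der A) (g : A) (hg : g ≠ 0)

lemma fracDer_comm (δ ε : Der A) (h : ∀ a, δ (ε a) = ε (δ a)) (x : L) :
    fracDer L δ (fracDer L ε x) = fracDer L ε (fracDer L δ x) := by
  have hp : ∀ p : A[X], polyDer δ (polyDer ε p) = polyDer ε (polyDer δ p) := by
    intro p; ext m; simp only [coeff_polyDer, h]
  have : ⁅fracDer L δ, fracDer L ε⁆ = (0 : Der L) := by
    apply der_localization_unique (nonZeroDivisors A[X])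
    intro p
    rw [Derivation.commutator_apply]
    simp only [fracDer_algebraMap, hp]
    simp
  have h2 := congrArg (fun D : Der L => D x) this
  simp only [Derivation.commutator_apply] at h2
  exact sub_eq_zero.mp h2

lemma twDer_comm (hg : g ≠ 0) (δ ε : Der A) (h : ∀ a, δ (ε a) = ε (δ a)) (x : L) :
    twDer g δ (twDer g ε x) = twDer g ε (twDer g δ x) := by
  have hγ : (algebraMap A[X] L) (C g) ≠ 0 := by
    rw [Ne, FaithfulSMul.algebraMap_eq_zero_iff]; simpa using hg
  simp only [twDer, map_add, Derivation.leibniz, Derivation.leibniz_div, fracDer_algebraMap, polyDer_C,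
    polyDer_X, smul_eq_mul, fracDer_comm δ ε h, map_zero, h]
  field_simp
  ring

lemma WW_succ_le (k : ℤ) : (WW d g hg k : Submodule A[X] L) ≤ WW d g hg (k - 1) := by
  have hγ : (algebraMap A[X] L) (C g) ≠ 0 := by
    rw [Ne, FaithfulSMul.algebraMap_eq_zero_iff]; simpa using hg
  apply WW_le
  · have := Submodule.smul_mem _ (C g) (zpow_mem_WW (L := L) d g hg (k - 1))
    rw [Algebra.smul_def, mul_comm, ← zpow_add_one₀ hγ] at this
    simpa using this
  · intro i x hx; exact WW_twDer d g hg _ i hx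

lemma WW_E (δ : Der A) (h : ∀ i a, δ (d i a) = d i (δ a)) (k : ℤ) {x : L}
    (hx : x ∈ WW d g hg k) : twDer g δ x ∈ WW d g hg (k - 1) := by
  let Q : Submodule A[X] L :=
    { carrier := {x | x ∈ WW d g hg k ∧ twDer g δ x ∈ WW d g hg (k - 1)}
      zero_mem' := ⟨Submodule.zero_mem _, by
        have : twDer g δ (0 : L) = 0 := by simp [twDer]
        rw [this]; exact Submodule.zero_mem _⟩
      add_mem' := by
        rintro x y ⟨h1, h2⟩ ⟨h3, h4⟩
        exact ⟨Submodule.add_mem _ h1 h3, by rw [twDer_add]; exact Submodule.add_mem _ h2 h4⟩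
      smul_mem' := by
        rintro p x ⟨h1, h2⟩
        refine ⟨Submodule.smul_mem _ _ h1, ?_⟩
        rw [Algebra.smul_def, twDer_mul, fracDer_algebraMap, ← Algebra.smul_def, ← Algebra.smul_def]
        exact Submodule.add_mem _ (Submodule.smul_mem _ _ h2)
          (Submodule.smul_mem _ _ (WW_succ_le d g hg k h1)) }
  have : WW d g hg k ≤ Q := by
    apply WW_le
    · refine ⟨zpow_mem_WW d g hg k, ?_⟩
      have := twDer_zpow (L := L) g hg δ 1 (k + 1)
      rw [map_one, one_mul] at this
      rw [this, ← Algebra.smul_def]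
      have h2 := zpow_mem_WW (L := L) d g hg (k - 1)
      have e : k + 1 - 1 = k - 1 + 1 := by ring
      rw [e]
      exact Submodule.smul_mem _ _ h2
    · rintro i x ⟨h1, h2⟩
      refine ⟨WW_twDer d g hg _ i h1, ?_⟩
      rw [twDer_comm g hg δ (d i) (h i)]
      exact WW_twDer d g hg _ i h2
  exact (this hx).2

variable (hdκ : ∀ i, ∀ c : κ, d i (algebraMap κ A c) = 0)

include hdκ in
lemma cst_WW (b : κ[X]) (k : ℤ)
    (h : algebraMap A[X] L (cst A b) * algebraMap A[X] L (C g) ^ k ∈ WW d g hg k) {x : L}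
    (hx : x ∈ WW d g hg (k - 1)) : algebraMap A[X] L (cst A b) * x ∈ WW d g hg k := by
  let Q : Submodule A[X] L := (WW d g hg k).comap (LinearMap.mul A[X] L (algebraMap A[X] L (cst A b)))
  have : WW d g hg (k - 1) ≤ Q := by
    apply WW_le
    · change algebraMap A[X] L (cst A b) * _ ∈ WW d g hg k
      simpa using h
    · intro i x hx
      change algebraMap A[X] L (cst A b) * _ ∈ WW d g hg k
      have := WW_twDer d g hg k i (show algebraMap A[X] L (cst A b) * x ∈ WW d g hg k from hx)
      rw [twDer_mul, fracDer_algebraMap, polyDer_cst _ (hdκ i), map_zero, zero_mul, add_zero] at this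
      exact this
  exact this hx

/-- The module `U k`. -/
def UU (q : κ[X]) (hq : Prime q) (k : ℤ) : Submodule A[X] L where
  carrier := {x | ∃ p : κ[X], ¬ q ∣ p ∧ algebraMap A[X] L (cst A p) * x ∈ WW d g hg k}
  zero_mem' := ⟨1, fun h => hq.not_isUnit (isUnit_of_dvd_one h), by simp⟩
  add_mem' := by
    rintro x y ⟨p, hp, h⟩ ⟨p', hp', h'⟩
    refine ⟨p * p', fun h => (hq.dvd_or_dvd h).elim hp hp', ?_⟩
    have := Submodule.add_mem _ (Submodule.smul_mem _ (cst A p') h) (Submodule.smul_mem _ (cst A p) h')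
    convert this using 1
    rw [Algebra.smul_def, Algebra.smul_def, map_mul, map_mul]; ring
  smul_mem' := by
    rintro r x ⟨p, hp, h⟩
    refine ⟨p, hp, ?_⟩
    rw [mul_smul_comm]
    exact Submodule.smul_mem _ _ h

variable (q : κ[X]) (hq : Prime q)

lemma UU_anti_one (k : ℤ) : (UU d g hg q hq k : Submodule A[X] L) ≤ UU d g hg q hq (k - 1) := by
  rintro x ⟨p, hp, h⟩
  exact ⟨p, hp, WW_succ_le d g hg k h⟩

lemma UU_anti {k l : ℤ} (h : k ≤ l) : (UU d g hg q hq l : Submodule A[X] L) ≤ UU d g hg q hq k := by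
  obtain ⟨m, rfl⟩ := Int.le.dest h
  induction m with
  | zero => simp
  | succ m ih =>
    refine (UU_anti_one d g hg q hq _).trans ?_
    have : k + ((m + 1 : ℕ) : ℤ) - 1 = k + m := by push_cast; ring
    rw [this]; exact ih (by omega)

lemma UU_sat (k : ℤ) (p : κ[X]) (hp : ¬ q ∣ p) (x : L)
    (h : algebraMap A[X] L (cst A p) * x ∈ UU d g hg q hq k) : x ∈ UU d g hg q hq k := by
  obtain ⟨p', hp', h'⟩ := h
  refine ⟨p' * p, fun h => (hq.dvd_or_dvd h).elim hp' hp, ?_⟩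
  rw [map_mul, map_mul, mul_assoc]; exact h'

lemma UU_E (δ : Der A)
    (h : ∀ i a, δ (d i a) = d i (δ a)) (k : ℤ) {x : L}
    (hx : x ∈ UU d g hg q hq k) : twDer g δ x ∈ UU d g hg q hq (k - 1) := by
  obtain ⟨p, hp, hx⟩ := hx
  refine ⟨p * p, fun h => (hq.dvd_or_dvd h).elim hp hp, ?_⟩
  have h1 := WW_E d g hg δ h k hx
  rw [twDer_mul] at h1
  have h2 := Submodule.sub_mem _ (Submodule.smul_mem _ (cst A p) h1)
    (Submodule.smul_mem _ (polyDer δ (cst A p)) (WW_succ_le d g hg k hx))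
  convert h2 using 1
  rw [Algebra.smul_def, Algebra.smul_def, map_mul, map_mul, fracDer_algebraMap]; ring

lemma polyDer_cst' (δ : Der A) (δ₀ : Der κ) (hδ₀ : ∀ c, δ (algebraMap κ A c) = algebraMap κ A (δ₀ c))
    (p : κ[X]) : polyDer δ (cst A p) = cst A (polyDer δ₀ p) := by
  ext m
  rw [coeff_polyDer]
  simp [cst, hδ₀, coeff_polyDer]

lemma finite_shift (q : κ[X]) (hq : Prime q) (b : κ[X]) (hb : b ≠ 0) : {k : ℤ | q ∣ shiftHom κ k b}.Finite := by
  let Ω := AlgebraicClosure κ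
  have hdeg : q.degree ≠ 0 := by
    intro h
    exact hq.not_isUnit (isUnit_iff_degree_eq_zero.2 h)
  obtain ⟨α, hα⟩ := IsAlgClosed.exists_aeval_eq_zero Ω q hdeg
  have : {k : ℤ | q ∣ shiftHom κ k b} ⊆ (fun k : ℤ => α + (k : Ω)) ⁻¹' (b.rootSet Ω) := by
    rintro k ⟨r, hr⟩
    have h1 := congrArg (aeval α) hr
    rw [map_mul, hα, zero_mul] at h1
    have h2 : aeval α (shiftHom κ k b) = aeval (α + (k : Ω)) b := by
      change aeval α (aeval (X + C (k : κ)) b) = _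
      rw [← aeval_algHom_apply]
      simp
    rw [h2] at h1
    simp only [Set.mem_preimage]
    rw [mem_rootSet]
    exact ⟨hb, h1⟩
  refine Set.Finite.subset (Set.Finite.preimage ?_ (rootSet_finite b Ω)) this
  intro a _ b _ h
  simpa using h


include hq hdκ in
lemma exists_not_dvd (δ : Der A) (δ₀ : Der κ)
    (hδ₀ : ∀ c, δ (algebraMap κ A c) = algebraMap κ A (δ₀ c))
    (h : ∀ i a, δ (d i a) = d i (δ a)) (b : κ[X]) (hb : b ≠ 0)
    (hbW : (algebraMap A[X] L) (cst A b) ∈ WW d g hg 0) (hqδ : ¬ q ∣ polyDer δ₀ q) :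
    ∃ p : κ[X], ¬ q ∣ p ∧ (algebraMap A[X] L) (cst A p) ∈ WW d g hg 0 := by
  have hsh : ∀ k : ℤ, ∀ x ∈ UU (L := L) d g hg q hq (k - 1),
      algebraMap A[X] L (cst A (shiftHom κ k b)) * x ∈ UU (L := L) d g hg q hq k := by
    rintro k x ⟨p, hp, hx⟩
    refine ⟨p, hp, ?_⟩
    have h0 : algebraMap A[X] L (cst A b) * algebraMap A[X] L (C g) ^ (0 : ℤ) ∈ WW d g hg 0 := by
      simpa using hbW
    obtain ⟨N, hN⟩ := (mem_WW_iff d g hg 0 _).1 h0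
    have h1 := shiftHom_mem_EN d g k 0 _ hN
    rw [map_mul, shiftHom_cst, map_pow, shiftHom_C, zero_add] at h1
    have h2 := (mem_WW_iff (L := L) d g hg k _).2 ⟨N, h1⟩
    have := cst_WW d g hg hdκ _ k h2 hx
    rwa [mul_left_comm] at this
  have hfin := finite_shift q hq b hb
  obtain ⟨M, hM⟩ : ∃ M : ℕ, ∀ k : ℤ, q ∣ shiftHom κ k b → |k| ≤ M := by
    obtain ⟨M, hM⟩ := (hfin.image (fun k : ℤ => k.natAbs)).bddAbove
    refine ⟨M, fun k hk => ?_⟩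
    have := hM ⟨k, hk, rfl⟩
    simp only at this
    rw [Int.abs_eq_natAbs]; exact_mod_cast this
  have hstep : ∀ k : ℤ, (M : ℤ) < |k| → UU (L := L) d g hg q hq (k - 1) ≤ UU d g hg q hq k := by
    intro k hk x hx
    refine UU_sat d g hg q hq k _ (fun hdiv => ?_) x (hsh k x hx)
    exact absurd (hM k hdiv) (not_le.2 hk)
  set Up := UU (L := L) d g hg q hq (M : ℤ) with hUp
  set Um := UU (L := L) d g hg q hq (-M - 1 : ℤ) with hUm
  have hUp' : Up ≤ UU d g hg q hq (M + 1 : ℤ) := by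
    have := hstep (M + 1) (by rw [abs_of_nonneg (by omega)]; omega)
    simpa using this
  have hUm' : UU d g hg q hq (-M - 1 - 1 : ℤ) ≤ Um :=
    hstep (-M - 1) (by rw [abs_of_neg (by omega)]; omega)
  let 𝔠 : Ideal κ[X] :=
    { carrier := {c | ∀ x ∈ Um, algebraMap A[X] L (cst A c) * x ∈ Up}
      zero_mem' := by intro x _; simp
      add_mem' := by
        intro a b ha hb x hx
        rw [map_add, map_add, add_mul]; exact Submodule.add_mem _ (ha x hx) (hb x hx)
      smul_mem' := by
        intro a c hc x hx
        rw [smul_eq_mul, map_mul, map_mul, mul_assoc, ← Algebra.smul_def]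
        exact Submodule.smul_mem _ _ (hc x hx) }
  have hsat : ∀ p c : κ[X], ¬ q ∣ p → p * c ∈ 𝔠 → c ∈ 𝔠 := by
    intro p c hp hpc x hx
    apply UU_sat d g hg q hq _ p hp
    have := hpc x hx
    rwa [map_mul, map_mul, mul_assoc] at this
  have hδ : ∀ c ∈ 𝔠, polyDer δ₀ c ∈ 𝔠 := by
    intro c hc x hx
    have h1 : twDer g δ (algebraMap A[X] L (cst A c) * x) ∈ Up := by
      have := UU_E d g hg q hq δ h _ (hUp' (hc x hx))
      simpa using this
    have h2 := hc _ (hUm' (UU_E d g hg q hq δ h _ hx))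
    rw [twDer_mul, fracDer_algebraMap, polyDer_cst' δ δ₀ hδ₀] at h1
    have h3 := Submodule.sub_mem _ h1 h2
    simpa using h3
  have hne : ∃ c ∈ 𝔠, c ≠ 0 := by
    have : ∀ m : ℕ, ∃ c : κ[X], c ≠ 0 ∧ ∀ x ∈ Um,
        algebraMap A[X] L (cst A c) * x ∈ UU d g hg q hq (-M - 1 + m : ℤ) := by
      intro m
      induction m with
      | zero => exact ⟨1, one_ne_zero, fun x hx => by simpa using hx⟩
      | succ m ih =>
        obtain ⟨c, hc, hcx⟩ := ih
        refine ⟨shiftHom κ (-M - 1 + (m + 1 : ℕ)) b * c,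
          mul_ne_zero (shiftHom_ne_zero _ hb) hc, fun x hx => ?_⟩
        rw [map_mul, map_mul, mul_assoc]
        apply hsh
        have := hcx x hx
        have e : (-M - 1 + (m + 1 : ℕ) - 1 : ℤ) = -M - 1 + m := by push_cast; ring
        rw [e]; exact this
    obtain ⟨c, hc, hcx⟩ := this (2 * M + 1)
    refine ⟨c, fun x hx => ?_, hc⟩
    have := hcx x hx
    have e : (-M - 1 + (2 * M + 1 : ℕ) : ℤ) = M := by push_cast; ring
    rw [e] at this; exact this
  have hpow : ∃ e, q ^ e ∈ 𝔠 := by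
    obtain ⟨c, hc, hc0⟩ := hne
    obtain ⟨e, p, hp, rfl⟩ := WfDvdMonoid.max_power_factor hc0 hq.irreducible
    exact ⟨e, hsat p _ hp (by rwa [mul_comm])⟩
  classical
  have hmin := Nat.find_spec hpow
  have h1 : (1 : κ[X]) ∈ 𝔠 := by
    rcases Nat.eq_zero_or_pos (Nat.find hpow) with h0 | h0
    · rw [h0, pow_zero] at hmin; exact hmin
    · exfalso
      obtain ⟨e, he⟩ : ∃ e, Nat.find hpow = e + 1 := ⟨_, (Nat.succ_pred_eq_of_pos h0).symm⟩
      rw [he] at hmin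
      have h2 := hδ _ hmin
      rw [Derivation.leibniz_pow] at h2
      have h3 : (C ((e : κ) + 1) * polyDer δ₀ q) * q ^ e ∈ 𝔠 := by
        convert h2 using 1
        simp; ring
      refine Nat.find_min hpow (m := e) (by omega) (hsat _ _ ?_ h3)
      intro hdiv
      rcases hq.dvd_or_dvd hdiv with h4 | h4
      · apply hq.not_isUnit
        refine isUnit_of_dvd_unit h4 ?_
        rw [isUnit_C]
        exact (Nat.cast_add_one_ne_zero e).isUnit
      · exact hqδ h4
  have h2 : (1 : L) ∈ Um := by
    refine UU_anti d g hg q hq (show (-M - 1 : ℤ) ≤ -1 by omega) ?_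
    refine ⟨1, fun h => hq.not_isUnit (isUnit_of_dvd_one h), ?_⟩
    have := zpow_mem_WW (L := L) d g hg (-1)
    simpa using this
  have h3 := h1 1 h2
  obtain ⟨p, hp, h4⟩ := UU_anti d g hg q hq (show (0 : ℤ) ≤ M by omega) h3
  exact ⟨p, hp, by simpa using h4⟩

/-- a polynomial whose irreducible factors have algebraic coefficients divides an integral one. -/
lemma dvd_int_of_irreducible (q : κ[X]) (hq : Irreducible q) (hm : q.Monic)
    (hc : ∀ i, IsAlgebraic ℚ (q.coeff i)) :
    ∃ B : ℤ[X], B ≠ 0 ∧ q ∣ B.map (Int.castRingHom κ) := by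
  let Ω := AlgebraicClosure κ
  have hdeg : q.degree ≠ 0 := by
    intro h
    exact hq.not_isUnit (isUnit_iff_degree_eq_zero.2 h)
  obtain ⟨α, hα⟩ := IsAlgClosed.exists_aeval_eq_zero Ω q hdeg
  have hintg : IsIntegral ℚ α := by
    refine IsIntegral.of_aeval_monic_of_isIntegral_coeff (p := q.map (algebraMap κ Ω)) (hm.map _) ?_ ?_ ?_
    · rw [hm.natDegree_map]
      intro h
      exact hdeg (by rw [degree_eq_natDegree hm.ne_zero, h]; rfl)
    · rw [eval_map_algebraMap, hα]; exact isIntegral_zero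
    · intro i
      rw [coeff_map]
      have := (hc i).isIntegral
      exact this.map (IsScalarTower.toAlgHom ℚ κ Ω)
  have halg : IsAlgebraic ℤ α := (IsFractionRing.isAlgebraic_iff ℤ ℚ Ω).2 hintg.isAlgebraic
  obtain ⟨B, hB, hBα⟩ := halg
  refine ⟨B, hB, ?_⟩
  have hq' : q = minpoly κ α := by
    exact minpoly.eq_of_irreducible_of_monic hq hα hm
  rw [hq']
  apply minpoly.dvd
  rw [show Int.castRingHom κ = algebraMap ℤ κ from rfl, aeval_map_algebraMap]
  exact hBα

lemma dvd_int (b : κ[X]) (hb : b ≠ 0)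
    (h : ∀ q : κ[X], Irreducible q → q.Monic → q ∣ b → ∀ i, IsAlgebraic ℚ (q.coeff i)) :
    ∃ B : ℤ[X], B ≠ 0 ∧ b ∣ B.map (Int.castRingHom κ) := by
  classical
  induction b using WfDvdMonoid.induction_on_irreducible with
  | zero => exact absurd rfl hb
  | unit u hu => exact ⟨1, one_ne_zero, by simpa using hu.dvd⟩
  | mul a i ha hi ih =>
    obtain ⟨B, hB, h1⟩ := ih ha (fun q hq hm hd => h q hq hm (hd.mul_left _))
    have hi0 := hi.ne_zero
    have hassoc : Associated i (normalize i) := (normalize_associated i).symm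
    obtain ⟨B', hB', h2⟩ := dvd_int_of_irreducible (normalize i) (hassoc.irreducible hi)
      (monic_normalize hi0) (h _ (hassoc.irreducible hi) (monic_normalize hi0)
        ((hassoc.symm.dvd).mul_right _))
    refine ⟨B' * B, mul_ne_zero hB' hB, ?_⟩
    rw [Polynomial.map_mul]
    exact mul_dvd_mul (hassoc.dvd.trans h2) h1

theorem bf_rat (hdκ : ∀ i, ∀ c : κ, d i (algebraMap κ A c) = 0)
    (hlift : ∀ δ₀ : Der κ, ∃ δ : Der A, (∀ c, δ (algebraMap κ A c) = algebraMap κ A (δ₀ c)) ∧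
      ∀ i a, δ (d i a) = d i (δ a)) (hg : g ≠ 0) (b : κ[X]) (hb : b ≠ 0) (N : ℕ)
    (hbN : cst A b * C g ^ N ∈ EN (fun i => polyDer (d i)) (C g) X (N + 1)) :
    ∃ B : ℤ[X], B ≠ 0 ∧ ∃ N, B.map (Int.castRingHom A) * C g ^ N ∈
      EN (fun i => polyDer (d i)) (C g) X (N + 1) := by
  let L := FractionRing A[X]
  have hiff : ∀ x : A[X], algebraMap A[X] L x ∈ WW d g hg 0 ↔ ∃ N : ℕ, x * C g ^ N ∈
      EN (fun i => polyDer (d i)) (C g) X (N + 1) := by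
    intro x
    have := mem_WW_iff (L := L) d g hg 0 x
    simpa using this
  let 𝔟 : Ideal κ[X] :=
    { carrier := {c | algebraMap A[X] L (cst A c) ∈ WW d g hg 0}
      zero_mem' := by simp
      add_mem' := by
        intro a b ha hb
        simp only [Set.mem_ofPred_eq, map_add]; exact Submodule.add_mem _ ha hb
      smul_mem' := by
        intro a c hc
        simp only [Set.mem_ofPred_eq, smul_eq_mul]
        rw [map_mul, map_mul, ← Algebra.smul_def]
        exact Submodule.smul_mem _ _ hc }
  have hb𝔟 : b ∈ 𝔟 := (hiff _).2 ⟨N, hbN⟩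
  obtain ⟨b', hb'⟩ := (IsPrincipalIdealRing.principal 𝔟).principal
  have hmem : ∀ c, c ∈ 𝔟 ↔ b' ∣ c := by
    intro c; rw [hb']; exact Ideal.mem_span_singleton
  have hb'0 : b' ≠ 0 := by
    rintro rfl
    exact hb (zero_dvd_iff.1 ((hmem b).1 hb𝔟))
  obtain ⟨B, hB, hd⟩ := dvd_int b' hb'0 (fun q hq hm hqb i => by
    by_contra hc
    obtain ⟨δ₀, hδ₀⟩ := exists_der_ne_zero _ hc
    obtain ⟨δ, hδ, hcomm⟩ := hlift δ₀
    have hndvd : ¬ q ∣ polyDer δ₀ q := by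
      intro hdiv
      have hz : polyDer δ₀ q = 0 := by
        by_contra hne
        have hlt : (polyDer δ₀ q).degree < q.degree := by
          rw [degree_eq_natDegree hm.ne_zero, degree_lt_iff_coeff_zero]
          intro m hm'
          rw [coeff_polyDer]
          rcases hm'.eq_or_lt with rfl | h'
          · rw [hm.coeff_natDegree]; simp
          · rw [coeff_eq_zero_of_natDegree_lt h']; simp
        exact hne (eq_zero_of_dvd_of_degree_lt hdiv hlt)
      have := congrArg (fun p => p.coeff i) hz
      simp only [coeff_polyDer, coeff_zero] at this
      exact hδ₀ this
    obtain ⟨p, hp, hpW⟩ := exists_not_dvd (L := L) d g hg hdκ q hq.prime δ δ₀ hδ hcomm b' hb'0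
      ((hmem b').2 dvd_rfl) hndvd
    exact hp (hqb.trans ((hmem p).1 hpW)))
  refine ⟨B, hB, (hiff _).1 ?_⟩
  have h1 := (hmem _).2 hd
  have h2 : cst A (B.map (Int.castRingHom κ)) = B.map (Int.castRingHom A) := by
    simp only [cst, coe_mapRingHom, map_map]
    congr 1
    exact RingHom.ext_int _ _
  rw [← h2]; exact h1
end BF
end BSLC

namespace BSLC

section gen
variable {S : Type*} [CommRing S]
/-- derivation from an additive map -/
def mkDer (F : S →+ S) (h : ∀ a b, F (a * b) = a * F b + b * F a) : Der S :=
  Derivation.mk' (AddMonoidHom.toIntLinearMap F) h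

lemma mkDer_apply (F : S →+ S) (h) (a : S) : mkDer F h a = F a := rfl
lemma der_mul (d : Der S) (a b : S) : d (a * b) = a * d b + b * d a := by simp
lemma der_one (d : Der S) : d 1 = 0 := by simp
lemma der_zero (d : Der S) : d 0 = 0 := by simp
lemma der_neg (d : Der S) (a : S) : d (-a) = - d a := by simp
lemma der_add (d : Der S) (a b : S) : d (a + b) = d a + d b := by simp
lemma der_sub (d : Der S) (a b : S) : d (a - b) = d a - d b := by simp
lemma der_natCast (d : Der S) (n : ℕ) : d (n : S) = 0 := by simp
lemma der_sum {ι : Type*} (d : Der S) (s : Finset ι) (f : ι → S) :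
    d (∑ i ∈ s, f i) = ∑ i ∈ s, d (f i) := by simp
lemma der_sum_apply {ι : Type*} (s : Finset ι) (f : ι → S) (d : ι → Der S) (a : S) :
    (∑ i ∈ s, f i • d i : Der S) a = ∑ i ∈ s, f i * d i a := by
  classical
  induction s using Finset.induction_on with
  | empty => simp
  | insert i s hi ih => rw [Finset.sum_insert hi, Finset.sum_insert hi, Derivation.add_apply, ih]; rfl
lemma der_pow_mem (d : Der S) (m : Ideal S) (k : ℕ) (b : S) (hb : b ∈ m ^ (k + 1)) :
    d b ∈ m ^ k := by
  induction k generalizing b with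
  | zero => simp
  | succ a ih =>
    rw [pow_succ] at hb
    induction hb using Submodule.mul_induction_on' with
    | mem_mul_mem x hx y hy =>
      rw [der_mul]
      refine add_mem (Ideal.mul_mem_right _ _ hx) ?_
      rw [pow_succ']
      exact Ideal.mul_mem_mul hy (ih x hx)
    | add x _ y _ h1 h2 => rw [der_add]; exact add_mem h1 h2
end gen

lemma mvps_mem_span_X {κ : Type*} [CommRing κ] (n : ℕ) (p : MvPowerSeries (Fin n) κ)
    (hp : MvPowerSeries.constantCoeff p = 0) :
    p ∈ Ideal.span (Set.range (MvPowerSeries.X : Fin n → MvPowerSeries (Fin n) κ)) := by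
  induction n with
  | zero =>
    have : p = 0 := by
      ext m
      have : m = 0 := Subsingleton.elim _ _
      subst this
      simpa using hp
    rw [this]; exact zero_mem _
  | succ n ih =>
    let e := MvPowerSeries.finSuccEquiv κ n
    obtain ⟨q, hq⟩ : ∃ q, e p = q := ⟨_, rfl⟩
    have h0 : MvPowerSeries.constantCoeff (PowerSeries.coeff 0 q) = 0 := by
      rw [← hp, ← hq, ← MvPowerSeries.coeff_zero_eq_constantCoeff_apply,
        MvPowerSeries.coeff_coeff_finSuccEquiv, ← MvPowerSeries.coeff_zero_eq_constantCoeff_apply]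
      congr
      ext i; refine Fin.cases ?_ ?_ i <;> simp
    have h1 := ih _ h0
    have h2 : p = e.symm q := by rw [← hq]; simp
    obtain ⟨r, hr⟩ : ∃ r, q = PowerSeries.C (PowerSeries.coeff 0 q) + PowerSeries.X * r := by
      have : PowerSeries.X ∣ q - PowerSeries.C (PowerSeries.coeff 0 q) := by
        rw [PowerSeries.X_dvd_iff]; simp
      obtain ⟨r, hr⟩ := this
      exact ⟨r, by rw [← hr]; ring⟩
    rw [h2, hr, map_add, map_mul]
    refine add_mem ?_ ?_
    · have h3 := Ideal.mem_map_of_mem (e.symm.toRingHom.comp (PowerSeries.C)) h1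
      rw [Ideal.map_span] at h3
      refine Ideal.span_le.mpr ?_ h3
      rintro _ ⟨_, ⟨j, rfl⟩, rfl⟩
      have : (e.symm.toRingHom.comp (PowerSeries.C)) (MvPowerSeries.X j)
          = (MvPowerSeries.X j.succ : MvPowerSeries (Fin (n+1)) κ) := by
        rw [RingHom.comp_apply]
        change e.symm _ = _
        rw [AlgEquiv.symm_apply_eq]
        exact (MvPowerSeries.finSuccEquiv_X_succ j).symm
      rw [this]
      exact Ideal.subset_span ⟨_, rfl⟩
    · apply Ideal.mul_mem_right
      have : e.symm PowerSeries.X = MvPowerSeries.X 0 := by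
        rw [AlgEquiv.symm_apply_eq]
        exact (MvPowerSeries.finSuccEquiv_X_zero).symm
      rw [this]
      exact Ideal.subset_span ⟨_, rfl⟩

/-- partial derivative as integral derivation -/
noncomputable def pder (κ : Type*) [CommRing κ] {c : ℕ} (i : Fin c) :
    Der (MvPowerSeries (Fin c) κ) :=
  mkDer (MvPowerSeries.pderiv κ i).toLinearMap.toAddMonoidHom (by
      intro a b; exact (MvPowerSeries.pderiv κ i).leibniz a b)

lemma pder_apply (κ : Type*) [CommRing κ] {c : ℕ} (i : Fin c) (f) :
    pder κ i f = MvPowerSeries.pderiv κ i f := rfl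

lemma coeff_pder {κ : Type*} [CommRing κ] {c : ℕ} (i : Fin c) (f) (α : Fin c →₀ ℕ) :
    MvPowerSeries.coeff α (pder κ i f) =
      MvPowerSeries.coeff (α + Finsupp.single i 1) f * (α i + 1) :=
  MvPowerSeries.coeff_pderiv ..

/-- coefficientwise derivation of power series -/
lemma exists_coeffDer {κ : Type*} [CommRing κ] {c : ℕ} (δ₀ : Der κ) :
    ∃ δ : Der (MvPowerSeries (Fin c) κ), ∀ α f,
      MvPowerSeries.coeff α (δ f) = δ₀ (MvPowerSeries.coeff α f) := by
  classical
  let F : MvPowerSeries (Fin c) κ →+ MvPowerSeries (Fin c) κ :=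
    { toFun := fun f α => δ₀ (MvPowerSeries.coeff α f)
      map_zero' := by ext α; change δ₀ _ = 0; simp
      map_add' := fun f g => by
        ext α; change δ₀ _ = δ₀ _ + δ₀ _; simp }
  have hF : ∀ α f, MvPowerSeries.coeff α (F f) = δ₀ (MvPowerSeries.coeff α f) := fun _ _ => rfl
  refine ⟨mkDer F ?_, hF⟩
  intro a b
  ext α
  rw [hF, MvPowerSeries.coeff_mul, map_sum, map_add, mul_comm b, MvPowerSeries.coeff_mul,
    MvPowerSeries.coeff_mul, ← Finset.sum_add_distrib]
  refine Finset.sum_congr rfl fun x _ => ?_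
  rw [der_mul, hF, hF, mul_comm (MvPowerSeries.coeff x.2 b)]

lemma pder_lift {κ : Type*} [CommRing κ] {c : ℕ} (δ₀ : Der κ) :
    ∃ δ : Der (MvPowerSeries (Fin c) κ), (∀ a, δ (algebraMap κ _ a) = algebraMap κ _ (δ₀ a)) ∧
      ∀ i f, δ (pder κ i f) = pder κ i (δ f) := by
  classical
  obtain ⟨δ, hδ⟩ := exists_coeffDer (c := c) δ₀
  refine ⟨δ, ?_, ?_⟩
  · intro a; ext α
    rw [MvPowerSeries.algebraMap_apply, MvPowerSeries.algebraMap_apply, hδ, MvPowerSeries.coeff_C, MvPowerSeries.coeff_C]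
    split_ifs <;> simp
  · intro i f; ext α
    rw [hδ, coeff_pder, coeff_pder, hδ, der_mul]
    have : δ₀ ((α i : κ) + 1) = 0 := by
      rw [der_add, der_natCast, der_one, add_zero]
    rw [this]; simp [mul_comm]

lemma pder_X (κ : Type*) [CommRing κ] {c : ℕ} (i j : Fin c) :
    pder κ i (MvPowerSeries.X j) = if i = j then 1 else 0 := by
  classical
  ext α
  rw [coeff_pder, MvPowerSeries.coeff_X]
  by_cases h : i = j
  · subst h
    simp only [if_true, MvPowerSeries.coeff_one, add_eq_right]
    split_ifs with h
    · subst h; simp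
    · simp
  · rw [if_neg h, if_neg]; simp
    intro h2
    have := DFunLike.congr_fun h2 i
    simp [Finsupp.single_apply, Ne.symm h] at this

section
variable {S : Type*} [CommRing S]
  {c : ℕ} (D : Fin c → Der S)
  (hD : ∀ i j a, D i (D j a) = D j (D i a))


/-- iterated derivative -/
noncomputable def Dpow (α : Fin c →₀ ℕ) : Module.End ℤ S :=
  Finset.univ.noncommProd (fun i => ((D i).toLinearMap : Module.End ℤ S) ^ α i) (by
    intro i _ j _ _
    apply Commute.pow_pow
    ext a; exact hD i j a)

lemma Dpow_zero : Dpow D hD 0 = 1 := by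
  unfold Dpow
  exact Finset.noncommProd_eq_pow_card _ _ _ 1 (by simp) |>.trans (by simp)

lemma Dpow_succ (α : Fin c →₀ ℕ) (i : Fin c) (a : S) :
    Dpow D hD (α + Finsupp.single i 1) a = Dpow D hD α (D i a) := by
  have hc : ∀ i j, Commute ((D i).toLinearMap : Module.End ℤ S) (D j).toLinearMap := by
    intro i j; ext a; exact hD i j a
  have : Dpow D hD (α + Finsupp.single i 1) = Dpow D hD α * (D i).toLinearMap := by
    have h2 : ((D i).toLinearMap : Module.End ℤ S) = Dpow D hD (Finsupp.single i 1) := by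
      unfold Dpow
      refine Eq.trans ?_ (Finset.noncommProd_congr (Finset.insert_erase (Finset.mem_univ i)) (fun x _ => rfl) ?_)
      swap
      · intro x _ y _ _
        exact (hc x y).pow_pow _ _
      refine Eq.trans ?_ (Finset.noncommProd_insert_of_notMem _ _ _ _ (Finset.notMem_erase i _)).symm
      refine Eq.trans ?_ (congrArg _ (Finset.noncommProd_eq_pow_card _ _ _ 1 ?_)).symm
      · simp
      · intro x hx
        rw [Finsupp.single_apply, if_neg]; simp
        rintro rfl; simp at hx
    rw [h2]
    unfold Dpow
    refine Eq.trans ?_ (Finset.noncommProd_mul_distrib _ _ _ _ ?_)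
    · apply Finset.noncommProd_congr rfl
      intro x _
      simp [pow_add]
    · intro x _ y _ _
      exact (hc x y).pow_pow _ _
  rw [this]; rfl

variable {κ : Type*} [Field κ] [CharZero κ] (ρ : S →+* κ)

/-- Taylor map -/
noncomputable def taylorFun (a : S) : MvPowerSeries (Fin c) κ :=
  fun α => ρ (Dpow D hD α a) / ∏ i, ((α i).factorial : κ)

lemma coeff_taylorFun (a : S) (α) : MvPowerSeries.coeff α (taylorFun D hD ρ a) =
    ρ (Dpow D hD α a) / ∏ i, ((α i).factorial : κ) := rfl

lemma constantCoeff_taylorFun (a : S) : MvPowerSeries.constantCoeff (taylorFun D hD ρ a) =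
    ρ a := by
  rw [← MvPowerSeries.coeff_zero_eq_constantCoeff_apply, coeff_taylorFun, Dpow_zero]; simp

lemma taylorFun_add (a b : S) : taylorFun D hD ρ (a + b) = taylorFun D hD ρ a + taylorFun D hD ρ b := by
  ext α
  rw [map_add, coeff_taylorFun, coeff_taylorFun, coeff_taylorFun, map_add, map_add, add_div]

lemma pder_taylorFun (i) (a : S) : pder κ i (taylorFun D hD ρ a) = taylorFun D hD ρ (D i a) := by
  ext α
  rw [coeff_pder, coeff_taylorFun, coeff_taylorFun, Dpow_succ]
  have h1 : ∏ j, (((α + Finsupp.single i 1 : Fin c →₀ ℕ) j).factorial : κ) =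
      (∏ j, ((α j).factorial : κ)) * ((α i : κ) + 1) := by
    have : ∀ j, (((α + Finsupp.single i 1 : Fin c →₀ ℕ) j).factorial : κ) =
      ((α j).factorial : κ) * (if j = i then (α i : κ) + 1 else 1) := by
      intro j
      by_cases h : j = i
      · subst h; simp [Nat.factorial_succ, mul_comm]
      · simp [Finsupp.single_apply, h, Ne.symm h]
    rw [Finset.prod_congr rfl (fun j _ => this j), Finset.prod_mul_distrib]
    simp
  rw [h1]
  have h2 : (α i : κ) + 1 ≠ 0 := Nat.cast_add_one_ne_zero _
  have h3 : ∏ j, ((α j).factorial : κ) ≠ 0 :=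
    Finset.prod_ne_zero_iff.mpr fun j _ => Nat.cast_ne_zero.mpr (Nat.factorial_ne_zero _)
  field_simp

lemma pder_eq_of_coeff {κ : Type*} [Field κ] [CharZero κ] {c : ℕ} (N : ℕ)
    (f g : MvPowerSeries (Fin c) κ) (h0 : MvPowerSeries.constantCoeff f = MvPowerSeries.constantCoeff g)
    (h : ∀ i (α : Fin c →₀ ℕ), α.degree < N → MvPowerSeries.coeff α (pder κ i f) =
      MvPowerSeries.coeff α (pder κ i g)) (α : Fin c →₀ ℕ) (hα : α.degree < N + 1) :
    MvPowerSeries.coeff α f = MvPowerSeries.coeff α g := by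
  by_cases hz : α = 0
  · subst hz; simpa using h0
  obtain ⟨i, hi⟩ := Finsupp.ne_iff.mp hz
  obtain ⟨β, rfl⟩ : ∃ β, α = β + Finsupp.single i 1 := by
    refine ⟨α - Finsupp.single i 1, ?_⟩
    rw [tsub_add_cancel_of_le]
    rw [Finsupp.single_le_iff]
    simp at hi; omega
  have := h i β (by rw [map_add, Finsupp.degree_single] at hα; omega)
  rw [coeff_pder, coeff_pder] at this
  exact mul_right_cancel₀ (Nat.cast_add_one_ne_zero _) this

lemma taylorFun_mul_aux (N : ℕ) : ∀ (a b : S) (α : Fin c →₀ ℕ), α.degree < N →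
    MvPowerSeries.coeff α (taylorFun D hD ρ (a * b)) =
    MvPowerSeries.coeff α (taylorFun D hD ρ a * taylorFun D hD ρ b) := by
  induction N with
  | zero => intro _ _ _ h; omega
  | succ N ih =>
    intro a b
    apply pder_eq_of_coeff
    · rw [map_mul, constantCoeff_taylorFun, constantCoeff_taylorFun, constantCoeff_taylorFun, map_mul]
    · intro i α hα
      rw [pder_taylorFun, der_mul, der_mul, taylorFun_add, map_add, map_add, ih _ _ _ hα, ih _ _ _ hα,
        pder_taylorFun, pder_taylorFun]

/-- Taylor homomorphism -/
noncomputable def taylorG : S →+* MvPowerSeries (Fin c) κ where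
  toFun := taylorFun D hD ρ
  map_zero' := by
    have := taylorFun_add D hD ρ 0 0
    simpa using this
  map_add' := taylorFun_add D hD ρ
  map_mul' a b := by
    ext α
    exact taylorFun_mul_aux D hD ρ (α.degree + 1) a b α (by omega)
  map_one' := by
    ext α
    apply pder_eq_of_coeff (α.degree) _ _ _ _ _ (by omega)
    · rw [constantCoeff_taylorFun]; simp
    · intro i α _
      rw [pder_taylorFun]
      have h0 : taylorFun D hD ρ 0 = 0 := by simpa using taylorFun_add D hD ρ 0 0
      rw [der_one, der_one, h0]

lemma pder_taylorG (i) (a : S) : pder κ i (taylorG D hD ρ a) = taylorG D hD ρ (D i a) :=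
  pder_taylorFun D hD ρ i a

lemma constantCoeff_taylorG (a : S) : MvPowerSeries.constantCoeff (taylorG D hD ρ a) =
    ρ a := constantCoeff_taylorFun D hD ρ a

end
section
variable {S : Type*} [CommRing S] [IsLocalRing S]
  {c : ℕ} (D : Fin c → Der S)
  (hD : ∀ i j a, D i (D j a) = D j (D i a)) [CharZero (IsLocalRing.ResidueField S)]

local notation "κS" => IsLocalRing.ResidueField S
local notation "TS" => MvPowerSeries (Fin c) (IsLocalRing.ResidueField S)

/-- Taylor homomorphism into power series over the residue field -/
noncomputable def taylor : S →+* TS := taylorG D hD (IsLocalRing.residue S)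

lemma pder_taylor (i) (a : S) : pder κS i (taylor D hD a) = taylor D hD (D i a) :=
  pder_taylorFun D hD _ i a

lemma constantCoeff_taylor (a : S) : MvPowerSeries.constantCoeff (taylor D hD a) =
    IsLocalRing.residue S a := constantCoeff_taylorFun D hD _ a

lemma isUnit_natCast (j : ℕ) : IsUnit ((j + 1 : ℕ) : S) := by
  by_contra h
  have h2 : ((j + 1 : ℕ) : S) ∈ IsLocalRing.maximalIdeal S := h
  rw [← IsLocalRing.residue_eq_zero_iff, map_natCast] at h2
  exact Nat.cast_ne_zero.mpr (Nat.succ_ne_zero j) h2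

variable (u : Fin c → S) (hu : ∀ i j, D i (u j) = if i = j then 1 else 0)
  (hm : IsLocalRing.maximalIdeal S = Ideal.span (Set.range u))
include hu hm

lemma taylor_u (j) : taylor D hD (u j) = MvPowerSeries.X j := by
  have hX : ∀ (b : S), b = 1 ∨ b = 0 → ∀ i, D i b = 0 := by
    rintro b (rfl | rfl) i <;> simp
  ext α
  apply pder_eq_of_coeff (α.degree) _ _ _ _ _ (by omega)
  · rw [constantCoeff_taylor, MvPowerSeries.constantCoeff_X, IsLocalRing.residue_eq_zero_iff, hm]
    exact Ideal.subset_span ⟨_, rfl⟩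
  · intro i α _
    rw [pder_taylor, hu, pder_X]
    split_ifs <;> simp

lemma euler_mem (j : ℕ) : ∀ r ∈ IsLocalRing.maximalIdeal S ^ j,
    ∑ i, u i * D i r - j * r ∈ IsLocalRing.maximalIdeal S ^ (j + 1) := by
  have hum : ∀ i, u i ∈ IsLocalRing.maximalIdeal S := fun i => by
    rw [hm]; exact Ideal.subset_span ⟨_, rfl⟩
  let θ : Der S := ∑ i, u i • D i
  have hθ : ∀ r, ∑ i, u i * D i r = θ r := by
    intro r
    rw [der_sum_apply]
  have hθm : ∀ r, θ r ∈ IsLocalRing.maximalIdeal S := by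
    intro r; rw [← hθ]
    exact sum_mem fun i _ => Ideal.mul_mem_right _ _ (hum i)
  simp_rw [hθ]
  have h1 : ∀ r ∈ IsLocalRing.maximalIdeal S, θ r - r ∈ IsLocalRing.maximalIdeal S ^ 2 := by
    intro r hr
    rw [hm] at hr
    induction hr using Submodule.span_induction with
    | mem x hx =>
      obtain ⟨j, rfl⟩ := hx
      rw [← hθ]; simp [hu]
    | zero => simp
    | add x y _ _ h1 h2 =>
      rw [map_add]
      have := add_mem h1 h2
      convert this using 1; ring
    | smul a x hx h =>
      rw [smul_eq_mul, Derivation.leibniz, smul_eq_mul, smul_eq_mul]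
      have e : a * θ x + x * θ a - a * x = a * (θ x - x) + x * θ a := by ring
      rw [e]
      refine add_mem (Ideal.mul_mem_left _ _ h) ?_
      rw [pow_two]
      exact Ideal.mul_mem_mul (by rw [hm]; exact hx) (hθm _)
  induction j with
  | zero => intro r _; simpa using hθm r
  | succ j ih =>
    intro r hr
    rw [pow_succ] at hr
    induction hr using Submodule.mul_induction_on' with
    | mem_mul_mem a ha b hb =>
      rw [Derivation.leibniz, smul_eq_mul, smul_eq_mul]
      have e : a * θ b + b * θ a - ((j + 1 : ℕ) : S) * (a * b) = a * (θ b - b) + (θ a - j * a) * b := by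
        push_cast; ring
      rw [e]
      refine add_mem ?_ ?_
      · rw [show j + 1 + 1 = j + 2 by ring, pow_add]
        exact Ideal.mul_mem_mul ha (h1 b hb)
      · rw [pow_succ _ (j + 1)]
        exact Ideal.mul_mem_mul (ih a ha) hb
    | add x _ y _ h1 h2 =>
      rw [map_add]
      have := add_mem h1 h2
      convert this using 1; ring

lemma taylor_h1 (k : ℕ) : ∀ r, taylor D hD r ∈
    Ideal.span (Set.range (MvPowerSeries.X : Fin c → TS)) ^ k →
    r ∈ IsLocalRing.maximalIdeal S ^ k := by
  induction k with
  | zero => simp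
  | succ k ih =>
    intro r hr
    have hum : ∀ i, u i ∈ IsLocalRing.maximalIdeal S := fun i => by
      rw [hm]; exact Ideal.subset_span ⟨_, rfl⟩
    have h0 : r ∈ IsLocalRing.maximalIdeal S := by
      rw [← IsLocalRing.residue_eq_zero_iff, ← constantCoeff_taylor D hD, ← RingHom.mem_ker]
      refine (Ideal.span_le.mpr ?_) (Ideal.pow_le_self (Nat.succ_ne_zero k) hr)
      rintro _ ⟨j, rfl⟩
      simp [RingHom.mem_ker]
    have h1 : ∀ i, D i r ∈ IsLocalRing.maximalIdeal S ^ k := by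
      intro i
      apply ih
      rw [← pder_taylor]
      exact der_pow_mem (pder κS i) _ k _ hr
    have h2 : ∑ i, u i * D i r ∈ IsLocalRing.maximalIdeal S ^ (k + 1) := by
      refine sum_mem fun i _ => ?_
      rw [pow_succ']
      exact Ideal.mul_mem_mul (hum i) (h1 i)
    have h3 : ∀ j ≤ k, r ∈ IsLocalRing.maximalIdeal S ^ (j + 1) := by
      intro j
      induction j with
      | zero => intro _; simpa using h0
      | succ j ihj =>
        intro hj
        have h4 := ihj (by omega)
        have h5 := euler_mem D u hu hm (j + 1) r h4
        have h6 : ∑ i, u i * D i r ∈ IsLocalRing.maximalIdeal S ^ (j + 1 + 1) :=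
          Ideal.pow_le_pow_right (by omega) h2
        have h7 : ((j + 1 : ℕ) : S) * r ∈ IsLocalRing.maximalIdeal S ^ (j + 1 + 1) := by
          have := sub_mem h6 h5
          simpa using this
        exact (Ideal.unit_mul_mem_iff_mem _ (isUnit_natCast j)).mp h7
    exact h3 k le_rfl

lemma taylor_h2 (k : ℕ) (t : TS) : ∃ r, t - taylor D hD r ∈
    Ideal.span (Set.range (MvPowerSeries.X : Fin c → TS)) ^ k := by
  set 𝔫 := Ideal.span (Set.range (MvPowerSeries.X : Fin c → TS)) with h𝔫
  have Q : ∀ (x : TS), ∃ r, x - taylor D hD r ∈ 𝔫 := by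
    intro x
    obtain ⟨r, hr⟩ := IsLocalRing.residue_surjective (R := S) (MvPowerSeries.constantCoeff x)
    refine ⟨r, mvps_mem_span_X _ _ ?_⟩
    rw [map_sub, constantCoeff_taylor, hr, sub_self]
  have Q1 : ∀ x ∈ 𝔫, ∃ r, x - taylor D hD r ∈ 𝔫 ^ 2 := by
    intro x hx
    rw [h𝔫] at hx
    induction hx using Submodule.span_induction with
    | mem x hx =>
      obtain ⟨j, rfl⟩ := hx
      exact ⟨u j, by rw [taylor_u D hD u hu hm]; simp⟩
    | zero => exact ⟨0, by simp⟩
    | add x y _ _ h1 h2 =>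
      obtain ⟨r, hr⟩ := h1
      obtain ⟨s, hs⟩ := h2
      refine ⟨r + s, ?_⟩
      rw [map_add]
      have := add_mem hr hs
      convert this using 1; ring
    | smul a x hx h =>
      obtain ⟨r, hr⟩ := h
      obtain ⟨s, hs⟩ := Q a
      refine ⟨s * r, ?_⟩
      rw [map_mul, smul_eq_mul]
      have e : a * x - taylor D hD s * taylor D hD r =
        (a - taylor D hD s) * x + taylor D hD s * (x - taylor D hD r) := by ring
      rw [e]
      refine add_mem ?_ (Ideal.mul_mem_left _ _ hr)
      rw [pow_two]; exact Ideal.mul_mem_mul hs hx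
  have Qk : ∀ k, ∀ x ∈ 𝔫 ^ k, ∃ r, x - taylor D hD r ∈ 𝔫 ^ (k + 1) := by
    intro k
    induction k with
    | zero => intro x _; simpa using Q x
    | succ k ih =>
      intro x hx
      rw [pow_succ] at hx
      induction hx using Submodule.mul_induction_on' with
      | mem_mul_mem a ha b hb =>
        obtain ⟨r, hr⟩ := ih a ha
        obtain ⟨s, hs⟩ := Q1 b hb
        refine ⟨r * s, ?_⟩
        have hs' : taylor D hD s ∈ 𝔫 := by
          have := sub_mem hb (Ideal.pow_le_self two_ne_zero hs)
          simpa using this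
        rw [map_mul]
        have e : a * b - taylor D hD r * taylor D hD s =
          a * (b - taylor D hD s) + (a - taylor D hD r) * taylor D hD s := by ring
        rw [e]
        refine add_mem ?_ ?_
        · rw [show k + 1 + 1 = k + 2 by ring, pow_add]
          exact Ideal.mul_mem_mul ha hs
        · rw [pow_succ _ (k + 1)]
          exact Ideal.mul_mem_mul hr hs'
      | add x _ y _ h1 h2 =>
        obtain ⟨r, hr⟩ := h1
        obtain ⟨s, hs⟩ := h2
        refine ⟨r + s, ?_⟩
        rw [map_add]
        have := add_mem hr hs
        convert this using 1; ring
  induction k with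
  | zero => exact ⟨0, by simp⟩
  | succ k ih =>
    obtain ⟨r, hr⟩ := ih
    obtain ⟨s, hs⟩ := Qk k _ hr
    exact ⟨r + s, by rw [map_add]; convert hs using 1; ring⟩

lemma taylor_injective [IsNoetherianRing S] : Function.Injective (taylor D hD) := by
  rw [injective_iff_map_eq_zero]
  intro r hr
  have : r ∈ ⨅ k : ℕ, IsLocalRing.maximalIdeal S ^ k := by
    rw [Ideal.mem_iInf]
    intro k
    exact taylor_h1 D hD u hu hm k r (by rw [hr]; exact zero_mem _)
  rw [Ideal.iInf_pow_eq_bot_of_isLocalRing _ (IsLocalRing.maximalIdeal.isMaximal S).ne_top] at this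
  simpa using this

end
end BSLC

namespace BSLC
open Polynomial

section BG
variable {R : Type*} [CommRing R] {ι : Type*} (d : ι → Der R) (g : R)

lemma bf_combine {a : R} {B : ℤ[X]} {N : ℕ}
    (h : C a * B.map (Int.castRingHom R) * C g ^ N ∈ EN (fun i => polyDer (d i)) (C g) X (N + 1))
    (B' : ℤ[X]) (k : ℕ) :
    C a * (B * B').map (Int.castRingHom R) * C g ^ (N + k) ∈
      EN (fun i => polyDer (d i)) (C g) X (N + k + 1) := by
  have h2 := pow_mul_mem_EN _ _ _ h k
  rw [show N + 1 + k = N + k + 1 by ring] at h2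
  have := Ideal.mul_mem_left _ (B'.map (Int.castRingHom R)) h2
  convert this using 1
  rw [Polynomial.map_mul]; ring

/-- the ideal of local solutions of the functional equation -/
def bfIdeal : Ideal R where
  carrier := {a | ∃ B : ℤ[X], B ≠ 0 ∧ ∃ N, C a * B.map (Int.castRingHom R) * C g ^ N ∈
    EN (fun i => polyDer (d i)) (C g) X (N + 1)}
  zero_mem' := ⟨1, one_ne_zero, 0, by simp⟩
  add_mem' := by
    rintro a b ⟨B, hB, N, h⟩ ⟨B', hB', N', h'⟩
    refine ⟨B * B', mul_ne_zero hB hB', N + N', ?_⟩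
    have h1 := bf_combine d g h B' N'
    have h2 := bf_combine d g h' B N
    rw [mul_comm B', add_comm N'] at h2
    rw [C_add, add_mul, add_mul]
    exact add_mem h1 h2
  smul_mem' := by
    rintro c a ⟨B, hB, N, h⟩
    refine ⟨B, hB, N, ?_⟩
    rw [smul_eq_mul, C_mul, mul_assoc (C c), mul_assoc (C c)]
    exact Ideal.mul_mem_left _ _ h

lemma mem_bfIdeal {a : R} : a ∈ bfIdeal d g ↔ ∃ B : ℤ[X], B ≠ 0 ∧ ∃ N,
    C a * B.map (Int.castRingHom R) * C g ^ N ∈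
    EN (fun i => polyDer (d i)) (C g) X (N + 1) := Iff.rfl

lemma bf_uniform [IsNoetherianRing R] (𝔟 : Ideal R) (h𝔟 : 𝔟 ≤ bfIdeal d g) :
    ∃ B : ℤ[X], B ≠ 0 ∧ ∃ N, ∀ a ∈ 𝔟, C a * B.map (Int.castRingHom R) * C g ^ N ∈
    EN (fun i => polyDer (d i)) (C g) X (N + 1) := by
  classical
  obtain ⟨t, rfl⟩ := (isNoetherianRing_iff_ideal_fg R).mp ‹_› 𝔟
  have : ∃ B : ℤ[X], B ≠ 0 ∧ ∃ N, ∀ a ∈ t, C a * B.map (Int.castRingHom R) * C g ^ N ∈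
      EN (fun i => polyDer (d i)) (C g) X (N + 1) := by
    have ht : ∀ a ∈ t, a ∈ bfIdeal d g := fun a ha => h𝔟 (Ideal.subset_span ha)
    clear h𝔟
    induction t using Finset.induction_on with
    | empty => exact ⟨1, one_ne_zero, 0, by simp⟩
    | insert x t hx ih =>
      obtain ⟨B, hB, N, h⟩ := ih (fun a ha => ht a (Finset.mem_insert_of_mem ha))
      obtain ⟨B', hB', N', h'⟩ := ht x (Finset.mem_insert_self _ _)
      refine ⟨B * B', mul_ne_zero hB hB', N + N', fun a ha => ?_⟩
      rcases Finset.mem_insert.mp ha with rfl | ha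
      · have h2 := bf_combine d g h' B N
        rwa [mul_comm B', add_comm N'] at h2
      · exact bf_combine d g (h a ha) B' N'
  obtain ⟨B, hB, N, h⟩ := this
  refine ⟨B, hB, N, fun a ha => ?_⟩
  induction ha using Submodule.span_induction with
  | mem x hx => exact h x hx
  | zero => simp
  | add x y _ _ h1 h2 => rw [C_add, add_mul, add_mul]; exact add_mem h1 h2
  | smul c x _ h =>
    rw [smul_eq_mul, C_mul, mul_assoc (C c), mul_assoc (C c)]
    exact Ideal.mul_mem_left _ _ h

/-- power series rings have b-functions -/
def PSb (κ : Type*) [Field κ] (c : ℕ) : Prop :=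
  ∀ g : MvPowerSeries (Fin c) κ, ∃ B : ℤ[X], B ≠ 0 ∧ ∃ N,
    B.map (Int.castRingHom _) * C g ^ N ∈ EN (fun i => polyDer (pder κ i)) (C g) X (N + 1)

/-- local coordinates at a prime -/
structure LocData {R : Type*} [CommRing R] {ι : Type*} (d : ι → Der R) (q : Ideal R) [q.IsPrime]
    (c : ℕ) where
  u : Fin c → Localization.AtPrime q
  D : Fin c → Der (Localization.AtPrime q)
  comm : ∀ i j a, D i (D j a) = D j (D i a)
  dual : ∀ i j, D i (u j) = if i = j then 1 else 0
  max : IsLocalRing.maximalIdeal (Localization.AtPrime q) = Ideal.span (Set.range u)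
  d' : ι → Der (Localization.AtPrime q)
  hd' : ∀ i b, d' i (algebraMap _ _ b) = algebraMap _ _ (d i b)
  span : ∀ i, D i ∈ Submodule.span (Localization.AtPrime q) (Set.range d')

lemma polyDer_map {S : Type*} [CommRing S] (φ : R →+* S) (e : Der R) (e' : Der S)
    (h : ∀ a, e' (φ a) = φ (e a)) (p : R[X]) :
    polyDer e' (mapRingHom φ p) = mapRingHom φ (polyDer e p) := by
  ext n
  simp only [coe_mapRingHom, coeff_polyDer, coeff_map, h]

lemma polyDer_mem_span {ι' : Type*} (e : ι' → Der R) (x : Der R)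
    (hx : x ∈ Submodule.span R (Set.range e)) :
    polyDer x ∈ Submodule.span R[X] (Set.range fun i => polyDer (e i)) := by
  induction hx using Submodule.span_induction with
  | mem x hx => obtain ⟨i, rfl⟩ := hx; exact Submodule.subset_span ⟨i, rfl⟩
  | zero =>
    have : polyDer (0 : Der R) = 0 := by ext p n; simp [coeff_polyDer]
    rw [this]; exact zero_mem _
  | add x y _ _ h1 h2 =>
    have : polyDer (x + y) = polyDer x + polyDer y := by
      ext p n; simp [coeff_polyDer]
    rw [this]; exact add_mem h1 h2
  | smul c x _ h =>
    have : polyDer (c • x) = (C c : R[X]) • polyDer x := by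
      ext p n; simp [coeff_polyDer]
    rw [this]; exact Submodule.smul_mem _ _ h

lemma bf_local [IsNoetherianRing R] (q : Ideal R) [q.IsPrime]
    [CharZero (IsLocalRing.ResidueField (Localization.AtPrime q))] {c : ℕ}
    (H : LocData d q c) (hP : PSb (IsLocalRing.ResidueField (Localization.AtPrime q)) c) :
    ¬ bfIdeal d g ≤ q := by
  set S := Localization.AtPrime q
  let φ := algebraMap R S
  let τ := taylor H.D H.comm
  obtain ⟨B, hB, N, h⟩ := hP (τ (φ g))
  haveI : IsNoetherianRing S := IsLocalization.isNoetherianRing q.primeCompl S inferInstance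
  have h1 : (B.map (Int.castRingHom S) * C (φ g) ^ N) ∈
      EN (fun i => polyDer (H.D i)) (C (φ g)) X (N + 1) := by
    apply krull_descent τ _ (taylor_h1 H.D H.comm H.u H.dual H.max)
      (taylor_h2 H.D H.comm H.u H.dual H.max)
    rw [← EN_map (fun i => polyDer (H.D i)) (C (φ g)) X (fun i => polyDer (pder _ i)) (mapRingHom τ)]
    · have e : τ.comp (Int.castRingHom S) = Int.castRingHom _ := RingHom.ext_int _ _
      simpa [Polynomial.map_map, e] using h
    · intro i x
      apply polyDer_map
      intro a; exact pder_taylor H.D H.comm i a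
  have h2 := EN_le_of_span (fun i => polyDer (H.d' i)) (C (φ g)) X (fun i => polyDer (H.D i))
    (fun j => polyDer_mem_span _ _ (H.span j)) _ h1
  have h3 := EN_map (fun i => polyDer (d i)) (C g) X (fun i => polyDer (H.d' i)) (mapRingHom φ)
    (fun i x => polyDer_map φ _ _ (H.hd' i) x) (N + 1)
  simp only [coe_mapRingHom, Polynomial.map_C, Polynomial.map_X] at h3
  rw [h3] at h2
  letI : Algebra R[X] S[X] := Polynomial.algebra R S
  haveI := Polynomial.isLocalization q.primeCompl S
  have h4 : (algebraMap R[X] S[X]) (B.map (Int.castRingHom R) * C g ^ N) ∈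
      (EN (fun i => polyDer (d i)) (C g) X (N + 1)).map (algebraMap R[X] S[X]) := by
    have e : algebraMap R[X] S[X] = mapRingHom φ := rfl
    rw [e]
    have e : φ.comp (Int.castRingHom R) = Int.castRingHom _ := RingHom.ext_int _ _
    simpa [Polynomial.map_map, e] using h2
  rw [IsLocalization.algebraMap_mem_map_algebraMap_iff (q.primeCompl.map (C : R →+* R[X]))] at h4
  obtain ⟨_, ⟨a, ha, rfl⟩, h4⟩ := h4
  intro hle
  apply ha
  apply hle
  refine ⟨B, hB, N, ?_⟩
  rw [mul_assoc]; exact h4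

lemma bf_global [IsNoetherianRing R]
    (H : ∀ (q : Ideal R) [q.IsPrime], ¬ bfIdeal d g ≤ q) :
    ∃ B : ℤ[X], B ≠ 0 ∧ ∃ N, B.map (Int.castRingHom R) * C g ^ N ∈
    EN (fun i => polyDer (d i)) (C g) X (N + 1) := by
  have : bfIdeal d g = ⊤ := by
    by_contra h
    obtain ⟨m, hm, hle⟩ := Ideal.exists_le_maximal _ h
    haveI := hm.isPrime
    exact H m hle
  have h1 : (1 : R) ∈ bfIdeal d g := by rw [this]; trivial
  obtain ⟨B, hB, N, h⟩ := h1
  exact ⟨B, hB, N, by simpa using h⟩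

end BG

section PS
variable {κ : Type*} [Field κ] [CharZero κ] {c : ℕ}

local notation "T" => MvPowerSeries (Fin c) κ

lemma psb_step (H : ∀ (g : MvPowerSeries (Fin c) κ) (q : Ideal (MvPowerSeries (Fin c) κ)) [q.IsPrime],
    q ≠ IsLocalRing.maximalIdeal _ → ¬ bfIdeal (fun i => pder κ i) g ≤ q) : PSb κ c := by
  intro g
  by_cases hg : g = 0
  · subst hg
    exact ⟨1, one_ne_zero, 1, by simp⟩
  haveI : IsDomain T := NoZeroDivisors.to_isDomain _
  have hrad : Ideal.span (Set.range (MvPowerSeries.X : Fin c → T)) ≤ (bfIdeal (fun i => pder κ i) g).radical := by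
    rw [Ideal.radical_eq_sInf]
    refine le_sInf ?_
    rintro q ⟨hle, hq⟩
    by_cases hqm : q = IsLocalRing.maximalIdeal T
    · rw [hqm, Ideal.span_le]
      rintro _ ⟨j, rfl⟩
      change _ ∈ nonunits T
      rw [mem_nonunits_iff, MvPowerSeries.isUnit_iff_constantCoeff]
      simp
    · exact absurd hle (H g q hqm)
  obtain ⟨s, hs⟩ := Ideal.exists_pow_le_of_le_radical_of_fg hrad
    (IsNoetherian.noetherian _)
  obtain ⟨B, hB, N, h⟩ := bf_uniform _ _ _ hs
  have hdκ : ∀ i, ∀ a : κ, pder κ i (algebraMap κ T a) = 0 := by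
    intro i a
    exact (MvPowerSeries.pderiv κ i).map_algebraMap a
  obtain ⟨b, hb, N', h'⟩ := bf_count' (κ := κ) (fun i => pder κ i) g hdκ MvPowerSeries.X
    (fun i j => pder_X κ i j) (fun a => ⟨MvPowerSeries.constantCoeff a, mvps_mem_span_X _ _ (by
      rw [map_sub, MvPowerSeries.algebraMap_apply]; simp)⟩) hg (B.map (Int.castRingHom κ))
      (by rwa [Ne, Polynomial.map_eq_zero_iff (RingHom.injective_int _)]) s N (fun f hf => by
        have := h f hf
        have e : (algebraMap κ T).comp (Int.castRingHom κ) = Int.castRingHom _ := RingHom.ext_int _ _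
        have e2 : cst T (B.map (Int.castRingHom κ)) = B.map (Int.castRingHom T) := by
          rw [cst, coe_mapRingHom, Polynomial.map_map, e]
        rw [e2]; exact this)
  exact bf_rat (fun i => pder κ i) g hdκ (fun δ₀ => pder_lift δ₀) hg b hb N' h'
end PS
end BSLC

namespace BSLC
open Polynomial

/-- weak Jacobian property at a prime -/
def JP {A ι : Type*} [CommRing A] (d : ι → Der A) (Q : Ideal A) : Prop :=
  ∀ f ∈ Q, (∀ i, d i f ∈ Q) → ∃ s, s ∉ Q ∧ s * f ∈ Q ^ 2

lemma pseudo_div {B : Type*} [CommRing B] (G : B[X]) (m : ℕ) : ∀ f : B[X], f.degree < m →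
    ∃ (N : ℕ) (q r : B[X]), C (G.leadingCoeff) ^ N * f = q * G + r ∧ r.degree < G.degree ∨ G = 0 := by
  by_cases hG : G = 0
  · intro _ _; exact ⟨0, 0, 0, Or.inr hG⟩
  set n := G.natDegree with hn
  have hdeg : G.degree = n := degree_eq_natDegree hG
  induction m with
  | zero =>
    intro f hf
    have : f = 0 := by
      rw [← degree_eq_bot]
      by_contra h
      have := degree_eq_natDegree (p := f) (by rwa [Ne, ← degree_eq_bot])
      rw [this] at hf
      simp at hf
    exact ⟨0, 0, 0, Or.inl ⟨by simp [this], by simpa [bot_lt_iff_ne_bot] using hG⟩⟩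
  | succ m ih =>
    intro f hf
    by_cases hmn : m < n
    · refine ⟨0, 0, f, Or.inl ⟨by simp, lt_of_lt_of_le hf ?_⟩⟩
      rw [hdeg]; exact_mod_cast hmn
    push Not at hmn
    set f1 := C G.leadingCoeff * f - C (f.coeff m) * X ^ (m - n) * G with hf1
    have h1 : f1.degree < m := by
      rw [degree_lt_iff_coeff_zero]
      intro k hk
      rw [hf1, coeff_sub, coeff_C_mul, mul_assoc, coeff_C_mul, coeff_X_pow_mul',
        if_pos (by omega)]
      rcases hk.eq_or_lt with rfl | hk
      · have : m - (m - n) = n := by omega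
        rw [this, hn, coeff_natDegree]; ring
      · rw [coeff_eq_zero_of_degree_lt (lt_of_lt_of_le hf (by exact_mod_cast hk)),
          coeff_eq_zero_of_natDegree_lt (p := G) (by omega)]
        simp
    obtain ⟨N, q, r, h | h⟩ := ih f1 h1
    · refine ⟨N + 1, q + C G.leadingCoeff ^ N * (C (f.coeff m) * X ^ (m - n)), r, Or.inl ⟨?_, h.2⟩⟩
      have := h.1
      rw [hf1] at this
      rw [pow_succ]
      linear_combination this
    · exact absurd h hG

section
variable {B : Type*} [CommRing B] {ι : Type*} (d : ι → Der B)

lemma mem_of_coeffs {Q : Ideal B[X]} {f : B[X]} (h : ∀ n, f.coeff n ∈ Q.comap C) : f ∈ Q := by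
  have := (Ideal.mem_map_C_iff (I := Q.comap C) (f := f)).mpr h
  exact Ideal.map_comap_le this

lemma jp_coeffs (Q : Ideal B[X]) [Q.IsPrime] (h : JP d (Q.comap C)) (r : B[X])
    (h1 : ∀ n, r.coeff n ∈ Q.comap C) (h2 : ∀ i n, d i (r.coeff n) ∈ Q.comap C) :
    ∃ s : B, C s ∉ Q ∧ C s * r ∈ Q ^ 2 := by
  choose s hs hs2 using fun n => h (r.coeff n) (h1 n) (fun i => h2 i n)
  refine ⟨∏ n ∈ r.support, s n, ?_, ?_⟩
  · change ¬ (∏ n ∈ r.support, s n ∈ Q.comap C)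
    haveI : (Q.comap C).IsPrime := inferInstance
    rw [Ideal.IsPrime.prod_mem_iff]
    push Not
    intro n _; exact hs n
  · have : ∀ n, (C (∏ n ∈ r.support, s n) * r).coeff n ∈ (Q.comap C) ^ 2 := by
      intro n
      rw [coeff_C_mul]
      by_cases hn : n ∈ r.support
      · rw [← Finset.prod_erase_mul _ _ hn, mul_assoc]
        exact Ideal.mul_mem_left _ _ (hs2 n)
      · rw [notMem_support_iff.mp hn, mul_zero]; exact zero_mem _
    have h3 := (Ideal.mem_map_C_iff (I := (Q.comap C) ^ 2)).mpr this
    rw [Ideal.map_pow] at h3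
    exact Ideal.pow_right_mono Ideal.map_comap_le 2 h3

lemma jp_poly (hunit : ∀ n : ℕ, n ≠ 0 → IsUnit (n : B)) (Q : Ideal B[X]) [hQ : Q.IsPrime]
    (h : JP d (Q.comap C)) (f : B[X]) (hf : f ∈ Q) (hd : ∀ i, polyDer (d i) f ∈ Q)
    (hX : derivative f ∈ Q) : ∃ s, s ∉ Q ∧ s * f ∈ Q ^ 2 := by
  haveI hp : (Q.comap C).IsPrime := inferInstance
  by_cases hcase : ∀ F ∈ Q, F.leadingCoeff ∈ Q.comap C
  · -- all coefficients in p
    have key : ∀ (m : ℕ) (F : B[X]), F.natDegree ≤ m → F ∈ Q → ∀ n, F.coeff n ∈ Q.comap C := by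
      intro m
      induction m with
      | zero =>
        intro F hF hFQ n
        by_cases hn : n = 0
        · subst hn
          have := hcase F hFQ
          rwa [leadingCoeff, Nat.le_zero.mp hF] at this
        · rw [coeff_eq_zero_of_natDegree_lt (by omega)]; exact zero_mem _
      | succ m ih =>
        intro F hF hFQ n
        have hl := hcase F hFQ
        have h1 : F.eraseLead ∈ Q := by
          have e : F.eraseLead = F - C F.leadingCoeff * X ^ F.natDegree := by
            rw [← self_sub_monomial_natDegree_leadingCoeff, C_mul_X_pow_eq_monomial]
          rw [e]
          exact sub_mem hFQ (Ideal.mul_mem_right _ _ hl)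
        have h2 := ih F.eraseLead (by have := eraseLead_natDegree_le F; omega) h1 n
        rw [eraseLead_coeff] at h2
        split_ifs at h2 with h3
        · rw [h3]; exact hl
        · exact h2
    have k2 : ∀ F ∈ Q, ∀ n, F.coeff n ∈ Q.comap C := fun F hF => key _ F le_rfl hF
    obtain ⟨s, hs, hs2⟩ := jp_coeffs d Q h f (k2 f hf) (fun i n => by
      rw [← coeff_polyDer]; exact k2 _ (hd i) n)
    exact ⟨C s, hs, hs2⟩
  · push Not at hcase
    classical
    have hex : ∃ n, ∃ F ∈ Q, F.leadingCoeff ∉ Q.comap C ∧ F.natDegree = n := by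
      obtain ⟨F, h1, h2⟩ := hcase
      exact ⟨_, F, h1, h2, rfl⟩
    obtain ⟨G, hGQ, hGl, hGn⟩ := Nat.find_spec hex
    have hmin : ∀ F ∈ Q, F.natDegree < G.natDegree → F.leadingCoeff ∈ Q.comap C := by
      intro F hF hlt
      by_contra hc
      rw [hGn] at hlt
      exact Nat.find_min hex hlt ⟨F, hF, hc, rfl⟩
    have hG0 : G ≠ 0 := by
      rintro rfl; apply hGl; simp
    have hGpos : 0 < G.natDegree := by
      rw [Nat.pos_iff_ne_zero]
      intro h0
      apply hGl
      have : G = C (G.coeff 0) := eq_C_of_natDegree_eq_zero h0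
      rw [leadingCoeff, h0]
      change C (G.coeff 0) ∈ Q
      rwa [← this]
    have key : ∀ (m : ℕ) (F : B[X]), F.natDegree ≤ m → F.natDegree < G.natDegree → F ∈ Q →
        ∀ n, F.coeff n ∈ Q.comap C := by
      intro m
      induction m with
      | zero =>
        intro F hF hlt hFQ n
        by_cases hn : n = 0
        · subst hn
          have := hmin F hFQ hlt
          rwa [leadingCoeff, Nat.le_zero.mp hF] at this
        · rw [coeff_eq_zero_of_natDegree_lt (by omega)]; exact zero_mem _
      | succ m ih =>
        intro F hF hlt hFQ n
        have hl := hmin F hFQ hlt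
        have h1 : F.eraseLead ∈ Q := by
          have e : F.eraseLead = F - C F.leadingCoeff * X ^ F.natDegree := by
            rw [← self_sub_monomial_natDegree_leadingCoeff, C_mul_X_pow_eq_monomial]
          rw [e]
          exact sub_mem hFQ (Ideal.mul_mem_right _ _ hl)
        have hle := eraseLead_natDegree_le F
        have h2 := ih F.eraseLead (by omega) (by omega) h1 n
        rw [eraseLead_coeff] at h2
        split_ifs at h2 with h3
        · rw [h3]; exact hl
        · exact h2
    have k2 : ∀ F ∈ Q, F.natDegree < G.natDegree → ∀ n, F.coeff n ∈ Q.comap C :=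
      fun F hF hlt => key _ F le_rfl hlt hF
    have hG' : derivative G ∉ Q := by
      intro hc
      have h1 := k2 _ hc (natDegree_derivative_lt hGpos.ne') (G.natDegree - 1)
      rw [coeff_derivative, Nat.sub_add_cancel hGpos] at h1
      have e : ((G.natDegree - 1 : ℕ) : B) + 1 = (G.natDegree : B) := by
        rw [← Nat.cast_succ]; congr 1; omega
      rw [e] at h1
      rcases hp.mem_or_mem h1 with h1 | h1
      · exact hGl h1
      · exact hp.ne_top (Ideal.eq_top_of_isUnit_mem _ h1 (hunit _ hGpos.ne'))
    obtain ⟨N, q, r, hqr | h0⟩ := pseudo_div G (f.natDegree + 1) f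
      (lt_of_le_of_lt degree_le_natDegree (by exact_mod_cast Nat.lt_succ_self _))
    swap
    · exact absurd h0 hG0
    obtain ⟨hqr, hr⟩ := hqr
    have hrlt : r.natDegree < G.natDegree := by
      by_cases hr0 : r = 0
      · simpa [hr0] using hGpos
      · exact natDegree_lt_natDegree hr0 hr
    have hreq : r = C G.leadingCoeff ^ N * f - q * G := by rw [hqr]; ring
    have hrQ : r ∈ Q := by
      rw [hreq]
      exact sub_mem (Ideal.mul_mem_left _ _ hf) (Ideal.mul_mem_left _ _ hGQ)
    have hrc := k2 r hrQ hrlt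
    have hr'Q : derivative r ∈ Q := by
      apply mem_of_coeffs
      intro n
      rw [coeff_derivative]
      exact Ideal.mul_mem_right _ _ (hrc _)
    have hq : q ∈ Q := by
      have e : q * derivative G = derivative (C G.leadingCoeff ^ N * f) - derivative q * G - derivative r := by
        rw [hqr]; simp only [derivative_add, derivative_mul]; ring
      have : q * derivative G ∈ Q := by
        rw [e]
        refine sub_mem (sub_mem ?_ (Ideal.mul_mem_left _ _ hGQ)) hr'Q
        rw [derivative_mul]
        exact add_mem (Ideal.mul_mem_left _ _ hf) (Ideal.mul_mem_left _ _ hX)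
      exact (hQ.mem_or_mem this).resolve_right hG'
    have hdr : ∀ i n, d i (r.coeff n) ∈ Q.comap C := by
      intro i n
      rw [← coeff_polyDer]
      apply k2
      · rw [hreq, der_sub, der_mul, der_mul]
        refine sub_mem (add_mem (Ideal.mul_mem_left _ _ (hd i)) (Ideal.mul_mem_right _ _ hf))
          (add_mem (Ideal.mul_mem_right _ _ hq) (Ideal.mul_mem_right _ _ hGQ))
      · refine lt_of_le_of_lt ?_ hrlt
        rw [natDegree_le_iff_coeff_eq_zero]
        intro m hm
        rw [coeff_polyDer, coeff_eq_zero_of_natDegree_lt hm]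
        exact der_zero _
    obtain ⟨s, hs, hs2⟩ := jp_coeffs d Q h r hrc hdr
    refine ⟨C s * C G.leadingCoeff ^ N, ?_, ?_⟩
    · intro hc
      rcases hQ.mem_or_mem hc with hc | hc
      · exact hs hc
      · exact hGl (hQ.mem_of_pow_mem _ hc)
    · rw [mul_assoc, hqr, mul_add]
      refine add_mem (Ideal.mul_mem_left _ _ ?_) hs2
      rw [pow_two]; exact Ideal.mul_mem_mul hq hGQ
end
end BSLC

namespace BSLC
open Polynomial

section
variable (k : Type*) [Field k] [CharZero k] (n : ℕ)

lemma mvps_isUnit_natCast (c : ℕ) (hc : c ≠ 0) : IsUnit ((c : ℕ) : MvPowerSeries (Fin n) k) := by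
  rw [MvPowerSeries.isUnit_iff_constantCoeff]
  simp [hc]

lemma mvps_maximalIdeal : IsLocalRing.maximalIdeal (MvPowerSeries (Fin n) k) =
    Ideal.span (Set.range (MvPowerSeries.X)) := by
  apply le_antisymm
  · intro p hp
    apply mvps_mem_span_X
    rw [IsLocalRing.mem_maximalIdeal, mem_nonunits_iff, MvPowerSeries.isUnit_iff_constantCoeff] at hp
    simpa using hp
  · rw [Ideal.span_le]
    rintro _ ⟨i, rfl⟩
    rw [SetLike.mem_coe, IsLocalRing.mem_maximalIdeal, mem_nonunits_iff, MvPowerSeries.isUnit_iff_constantCoeff]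
    simp

instance mvps_complete : IsAdicComplete (IsLocalRing.maximalIdeal (MvPowerSeries (Fin n) k)) (MvPowerSeries (Fin n) k) := by
  rw [mvps_maximalIdeal]
  infer_instance

lemma mvps_residue_ne (a : MvPowerSeries (Fin n) k) (ha : MvPowerSeries.constantCoeff a ≠ 0) :
    IsLocalRing.residue _ a ≠ 0 := by
  rw [Ne, IsLocalRing.residue_eq_zero_iff, IsLocalRing.mem_maximalIdeal, mem_nonunits_iff, not_not,
    MvPowerSeries.isUnit_iff_constantCoeff]
  simpa using ha

/-- polynomials inside power series -/
noncomputable def psi : (MvPowerSeries (Fin n) k)[X] →+* MvPowerSeries (Fin (n+1)) k :=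
  ((MvPowerSeries.finSuccEquiv k n).symm : _ →+* MvPowerSeries (Fin (n+1)) k).comp
    Polynomial.coeToPowerSeries.ringHom

lemma finSucc_psi (r) : MvPowerSeries.finSuccEquiv k n (psi k n r) = (r : PowerSeries _) := by
  simp [psi]

lemma coeff_psi (r) (α : Fin (n+1) →₀ ℕ) : MvPowerSeries.coeff α (psi k n r) =
    MvPowerSeries.coeff α.tail (r.coeff (α 0)) := by
  have := MvPowerSeries.coeff_coeff_finSuccEquiv (psi k n r) (k := α 0) (x := α.tail)
  rw [Finsupp.cons_tail, finSucc_psi, Polynomial.coeff_coe] at this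
  exact this.symm

lemma pder_psi_zero (r) : pder k 0 (psi k n r) = psi k n (derivative r) := by
  ext α
  rw [coeff_pder, coeff_psi, coeff_psi, coeff_derivative]
  have h1 : (α + Finsupp.single 0 1).tail = α.tail := by
    ext i; simp [Finsupp.tail_apply]
  rw [h1]
  have : ((α 0 : MvPowerSeries (Fin n) k) + 1) = MvPowerSeries.C ((α 0 : k) + 1) := by simp
  rw [this, MvPowerSeries.coeff_mul_C]
  simp

lemma pder_psi_succ (r) (j : Fin n) : pder k j.succ (psi k n r) = psi k n (polyDer (pder k j) r) := by
  ext α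
  rw [coeff_pder, coeff_psi, coeff_psi, coeff_polyDer, coeff_pder]
  have h1 : (α + Finsupp.single j.succ 1).tail = α.tail + Finsupp.single j 1 := by
    ext i; simp [Finsupp.tail_apply, Finsupp.single_apply]
  have h2 : (α + Finsupp.single j.succ 1 : Fin (n+1) →₀ ℕ) 0 = α 0 := by simp [Finsupp.single_apply]
  rw [h1, h2]
  simp [Finsupp.tail_apply]

lemma jps_reg (IH : ∀ Q : Ideal (MvPowerSeries (Fin n) k), Q.IsPrime → JP (fun i => pder k i) Q)
    (Q : Ideal (MvPowerSeries (Fin (n+1)) k)) [hQ : Q.IsPrime] (F) (hF : F ∈ Q) (m : ℕ)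
    (hm : MvPowerSeries.coeff (Finsupp.single 0 m) F ≠ 0) : JP (fun i => pder k i) Q := by
  intro f hf hd
  set e := MvPowerSeries.finSuccEquiv k n with he
  have h1 : (e F).map (IsLocalRing.residue (MvPowerSeries (Fin n) k)) ≠ 0 := by
    intro h
    have h2 := congrArg (PowerSeries.coeff m) h
    rw [PowerSeries.coeff_map, map_zero] at h2
    refine mvps_residue_ne k n _ ?_ h2
    have := MvPowerSeries.coeff_coeff_finSuccEquiv F (k := m) (x := 0)
    rw [← MvPowerSeries.coeff_zero_eq_constantCoeff_apply, this]
    have hcons : (Finsupp.cons m 0 : Fin (n+1) →₀ ℕ) = Finsupp.single 0 m := by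
      ext i
      refine Fin.cases ?_ (fun j => ?_) i
      · simp
      · simp [Finsupp.single_apply]
    rw [hcons]; exact hm
  have h2 : ((e F)^2).map (IsLocalRing.residue (MvPowerSeries (Fin n) k)) ≠ 0 := by
    rw [map_pow]; exact pow_ne_zero _ h1
  obtain ⟨q, r, hqr⟩ := PowerSeries.exists_isWeierstrassDivision (e f) h2
  have h3 := hqr.eq_mul_add
  have h4 : f = F * F * e.symm q + psi k n r := by
    apply e.injective
    rw [h3, map_add, map_mul, finSucc_psi, pow_two, map_mul]; simp
  have h5 : F * F * e.symm q ∈ Q ^ 2 := by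
    rw [pow_two]; exact Ideal.mul_mem_right _ _ (Ideal.mul_mem_mul hF hF)
  have h5' : F * F * e.symm q ∈ Q := Ideal.pow_le_self two_ne_zero h5
  have h6 : psi k n r ∈ Q := by
    rw [h4] at hf; exact (Q.add_mem_iff_right h5').mp hf
  have h7 : ∀ i, pder k i (psi k n r) ∈ Q := by
    intro i
    have := hd i
    simp only at this
    rw [h4, der_add] at this
    refine (Q.add_mem_iff_right ?_).mp this
    have := der_pow_mem (pder k i) Q 1 _ h5
    simpa using this
  haveI : (Q.comap (psi k n)).IsPrime := inferInstance
  obtain ⟨s, hs, hsr⟩ := jp_poly (fun i => pder k i) (mvps_isUnit_natCast k n) (Q.comap (psi k n))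
    (IH _ inferInstance) r h6
    (fun i => by have := h7 i.succ; rw [pder_psi_succ] at this; exact this)
    (by have := h7 0; rw [pder_psi_zero] at this; exact this)
  refine ⟨psi k n s, hs, ?_⟩
  rw [h4, mul_add]
  refine add_mem (Ideal.mul_mem_left _ _ h5) ?_
  rw [← map_mul]
  have := Ideal.mem_map_of_mem (psi k n) hsr
  rw [Ideal.map_pow] at this
  exact Ideal.pow_right_mono Ideal.map_comap_le _ this

end

section lin
variable {k : Type*} [Field k] [CharZero k] {n : ℕ}

lemma pder_comm (i j : Fin n) (a) : pder k i (pder k j a) = pder k j (pder k i a) := by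
  ext α
  simp only [coeff_pder]
  rw [add_right_comm]
  by_cases h : i = j
  · subst h; rfl
  · simp [Finsupp.single_apply, h, Ne.symm h]; ring

/-- linear combos of the partials -/
noncomputable def ldir (v : Fin n → k) : Der (MvPowerSeries (Fin n) k) :=
  ∑ i, (MvPowerSeries.C (v i) : MvPowerSeries (Fin n) k) • pder k i

lemma ldir_apply (v : Fin n → k) (f) : ldir v f = ∑ i, MvPowerSeries.C (v i) * pder k i f :=
  der_sum_apply _ _ _ _

lemma pder_C (i : Fin n) (a : k) : pder k i (MvPowerSeries.C a) = 0 := by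
  classical
  ext α
  rw [coeff_pder, MvPowerSeries.coeff_C, if_neg]; simp
  intro h
  have := DFunLike.congr_fun h i
  simp at this

lemma ldir_C (v : Fin n → k) (a : k) : ldir v (MvPowerSeries.C a) = 0 := by
  rw [ldir_apply]
  exact Finset.sum_eq_zero fun i _ => by rw [pder_C, mul_zero]

lemma ldir_comm (v w : Fin n → k) (f) : ldir v (ldir w f) = ldir w (ldir v f) := by
  rw [ldir_apply, ldir_apply, ldir_apply w, ldir_apply v]
  simp only [der_sum, der_mul, pder_C, mul_zero, add_zero, Finset.mul_sum]
  rw [Finset.sum_comm]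
  refine Finset.sum_congr rfl fun i _ => Finset.sum_congr rfl fun j _ => ?_
  rw [pder_comm]; ring

/-- linear change of variables -/
noncomputable def lch (M : Fin n → Fin n → k) : MvPowerSeries (Fin n) k →+* MvPowerSeries (Fin n) k :=
  taylorG (fun i => ldir (M i)) (fun i j a => ldir_comm _ _ a) MvPowerSeries.constantCoeff

lemma pder_lch (M : Fin n → Fin n → k) (i f) : pder k i (lch M f) = lch M (ldir (M i) f) :=
  pder_taylorG _ _ _ _ _

lemma cc_lch (M : Fin n → Fin n → k) (f) : MvPowerSeries.constantCoeff (lch M f) = MvPowerSeries.constantCoeff f :=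
  constantCoeff_taylorG _ _ _ _

lemma lch_C (M : Fin n → Fin n → k) (a) : lch M (MvPowerSeries.C a) = MvPowerSeries.C a := by
  ext α
  apply pder_eq_of_coeff (α.degree) _ _ _ _ _ (by omega)
  · rw [cc_lch]
  · intro i α _
    rw [pder_lch, ldir_C, pder_C, map_zero]

lemma lch_lch (M N : Fin n → Fin n → k) (h : ∀ i j, ∑ l, N i l * M l j = if i = j then 1 else 0) (f) :
    lch N (lch M f) = f := by
  have aux : ∀ (d : ℕ) f (α : Fin n →₀ ℕ), α.degree < d →
      MvPowerSeries.coeff α (lch N (lch M f)) = MvPowerSeries.coeff α f := by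
    intro d
    induction d with
    | zero => intro _ _ h; omega
    | succ d ih =>
      intro f
      apply pder_eq_of_coeff
      · rw [cc_lch, cc_lch]
      · intro i α hα
        have : pder k i (lch N (lch M f)) = lch N (lch M (pder k i f)) := by
          rw [pder_lch, ldir_apply]
          simp only [pder_lch]
          congr 1
          have : ∀ l, MvPowerSeries.C (N i l) * lch M (ldir (M l) f) =
            lch M (∑ j, MvPowerSeries.C (N i l * M l j) * pder k j f) := by
            intro l
            rw [← lch_C M, ← map_mul, ldir_apply, Finset.mul_sum]
            simp only [map_mul, mul_assoc]
          simp only [this]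
          rw [← map_sum, Finset.sum_comm]
          congr 1
          simp only [← Finset.sum_mul, ← map_sum, h]
          simp [Finset.sum_ite_eq]
        rw [this, ih _ _ hα]
  ext α
  exact aux (α.degree + 1) f α (by omega)

/-- value of the degree m part -/
noncomputable def Ev (v : Fin n → k) (m : ℕ) (f : MvPowerSeries (Fin n) k) : k :=
  ∑ α ∈ Finset.finsuppAntidiag (Finset.univ : Finset (Fin n)) m, (∏ j, v j ^ α j) * MvPowerSeries.coeff α f

lemma Ev_ldir (v : Fin n → k) (m : ℕ) (f) : Ev v m (ldir v f) = (m + 1) * Ev v (m+1) f := by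
  classical
  unfold Ev
  have h1 : ∀ β ∈ Finset.finsuppAntidiag (Finset.univ : Finset (Fin n)) (m+1),
      (m + 1 : k) * ((∏ j, v j ^ β j) * MvPowerSeries.coeff β f) =
        ∑ i, (β i : k) * ((∏ j, v j ^ β j) * MvPowerSeries.coeff β f) := by
    intro β hβ
    rw [← Finset.sum_mul]
    congr 1
    rw [Finset.mem_finsuppAntidiag] at hβ
    have := hβ.1
    rw [← Nat.cast_sum, this]; simp
  rw [Finset.mul_sum, Finset.sum_congr rfl h1, Finset.sum_comm]
  simp only [ldir_apply, map_sum, Finset.mul_sum]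
  rw [Finset.sum_comm]
  refine Finset.sum_congr rfl fun i _ => ?_
  rw [← Finset.sum_filter_of_ne (s := Finset.finsuppAntidiag Finset.univ (m+1)) (p := fun β => β i ≠ 0)]
  swap
  · intro β _ h h2; rw [h2] at h; simp at h
  refine Finset.sum_bij (fun α _ => α + Finsupp.single i 1) ?_ ?_ ?_ ?_
  · intro α hα
    rw [Finset.mem_finsuppAntidiag] at hα
    rw [Finset.mem_filter, Finset.mem_finsuppAntidiag]
    refine ⟨⟨?_, by simp⟩, by simp⟩
    simp [Finset.sum_add_distrib, Finsupp.single_apply, hα.1]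
  · intro a _ b _ h
    exact add_right_cancel h
  · intro β hβ
    rw [Finset.mem_filter, Finset.mem_finsuppAntidiag] at hβ
    have hc : β - Finsupp.single i 1 + Finsupp.single i 1 = β := by
      rw [tsub_add_cancel_of_le]
      rw [Finsupp.single_le_iff]; omega
    refine ⟨β - Finsupp.single i 1, ?_, hc⟩
    rw [Finset.mem_finsuppAntidiag]
    refine ⟨?_, by simp⟩
    have e1 : ∑ j, (Finsupp.single i 1 : Fin n →₀ ℕ) j = 1 := by simp [Finsupp.single_apply]
    have e2 : ∑ j, (β - Finsupp.single i 1 + Finsupp.single i 1 : Fin n →₀ ℕ) j =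
      ∑ j, (β - Finsupp.single i 1 : Fin n →₀ ℕ) j + 1 := by
      refine Eq.trans ?_ (congrArg (_ + ·) e1)
      rw [← Finset.sum_add_distrib]; rfl
    rw [hc] at e2
    have e3 : ∑ j, β j = m + 1 := hβ.1.1
    change ∑ j, (β - Finsupp.single i 1 : Fin n →₀ ℕ) j = m
    omega
  · intro α _
    rw [MvPowerSeries.coeff_C_mul, coeff_pder]
    have : ∏ j, v j ^ (α + Finsupp.single i 1 : Fin n →₀ ℕ) j = (∏ j, v j ^ α j) * v i := by
      simp only [Finsupp.add_apply, pow_add, Finset.prod_mul_distrib]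
      congr 1
      simp [Finsupp.single_apply]
    rw [this]
    simp
    ring

lemma Ev_zero (v : Fin n → k) (f) : Ev v 0 f = MvPowerSeries.constantCoeff f := by
  simp [Ev]

lemma coeff_lch {n : ℕ} (M : Fin (n+1) → Fin (n+1) → k) (m : ℕ) : ∀ f,
    MvPowerSeries.coeff (Finsupp.single 0 m) (lch M f) = Ev (M 0) m f := by
  induction m with
  | zero => intro f; simp [Ev_zero, cc_lch]
  | succ m ih =>
    intro f
    have h1 := ih (ldir (M 0) f)
    rw [← pder_lch, coeff_pder, Ev_ldir, ← Finsupp.single_add] at h1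
    have : (m + 1 : k) ≠ 0 := Nat.cast_add_one_ne_zero m
    apply mul_left_cancel₀ this
    rw [← h1, mul_comm]; simp

lemma exists_Ev_ne {n : ℕ} (F : MvPowerSeries (Fin (n+1)) k) (hF : F ≠ 0) :
    ∃ v : Fin (n+1) → k, v 0 ≠ 0 ∧ ∃ m, Ev v m F ≠ 0 := by
  classical
  obtain ⟨α, hα⟩ : ∃ α, MvPowerSeries.coeff α F ≠ 0 := by
    by_contra! h; exact hF (MvPowerSeries.ext h)
  set m := α.degree
  let p : MvPolynomial (Fin (n+1)) k :=
    ∑ β ∈ Finset.finsuppAntidiag Finset.univ m, MvPolynomial.monomial β (MvPowerSeries.coeff β F)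
  have hp : p ≠ 0 := by
    intro h
    have h2 := congrArg (MvPolynomial.coeff α) h
    rw [MvPolynomial.coeff_sum, Finset.sum_eq_single α] at h2
    · simp at h2; exact hα h2
    · intro b _ hb; rw [MvPolynomial.coeff_monomial, if_neg hb]
    · intro h3; exfalso; apply h3; rw [Finset.mem_finsuppAntidiag]
      exact ⟨(Finsupp.degree_eq_sum α).symm, by simp⟩
  have h2 : p * MvPolynomial.X 0 ≠ 0 := mul_ne_zero hp (MvPolynomial.X_ne_zero _)
  obtain ⟨v, hv⟩ : ∃ v, MvPolynomial.eval v (p * MvPolynomial.X 0) ≠ 0 := by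
    by_contra! h
    exact h2 (MvPolynomial.funext (fun v => by rw [h v, map_zero]))
  rw [map_mul, MvPolynomial.eval_X] at hv
  refine ⟨v, right_ne_zero_of_mul hv, m, ?_⟩
  have h3 := left_ne_zero_of_mul hv
  have : MvPolynomial.eval v p = Ev v m F := by
    simp only [p, map_sum, Ev]
    refine Finset.sum_congr rfl fun β _ => ?_
    rw [MvPolynomial.eval_monomial, mul_comm, Finsupp.prod_fintype]
    simp
  rwa [← this]

/-- The weak Jacobian criterion for power series rings. -/
lemma jps (n : ℕ) : ∀ Q : Ideal (MvPowerSeries (Fin n) k), Q.IsPrime → JP (fun i => pder k i) Q := by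
  classical
  induction n with
  | zero =>
    intro Q hQ f hf _
    have : f = 0 := by
      have h0 : MvPowerSeries.constantCoeff f = 0 := by
        by_contra h
        apply hQ.ne_top
        apply Ideal.eq_top_of_isUnit_mem _ hf
        rw [MvPowerSeries.isUnit_iff_constantCoeff]
        simpa using h
      ext α
      rw [Subsingleton.elim α 0]; simpa using h0
    exact ⟨1, fun h => hQ.ne_top ((Ideal.eq_top_iff_one _).mpr h), by rw [this]; simp⟩
  | succ n IH =>
    intro Q hQ f hf hd
    by_cases hz : f = 0
    · exact ⟨1, fun h => hQ.ne_top ((Ideal.eq_top_iff_one _).mpr h), by rw [hz]; simp⟩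
    obtain ⟨v, hv, m, hm⟩ := exists_Ev_ne f hz
    let M : Fin (n+1) → Fin (n+1) → k := Fin.cons v (fun j l => if j.succ = l then 1 else 0)
    let N : Fin (n+1) → Fin (n+1) → k := Fin.cons (Fin.cons (v 0)⁻¹ (fun j => - (v 0)⁻¹ * v j.succ))
      (fun j l => if j.succ = l then 1 else 0)
    have hNM : ∀ i j, ∑ l, N i l * M l j = if i = j then 1 else 0 := by
      intro i j
      rw [Fin.sum_univ_succ]
      refine Fin.cases ?_ (fun i => ?_) i
      · refine Fin.cases ?_ (fun j => ?_) j
        · simp [N, M, hv]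
        · simp only [N, M, Fin.cons_zero, Fin.cons_succ]
          rw [if_neg (Fin.succ_ne_zero _).symm]
          simp [Fin.succ_inj]
      · simp only [N, M, Fin.cons_zero, Fin.cons_succ]
        rw [if_neg (Fin.succ_ne_zero _), zero_mul, zero_add, Finset.sum_eq_single i]
        · simp
        · intro b _ hb
          rw [if_neg (fun h => hb (Fin.succ_injective _ h).symm), zero_mul]
        · simp
    have hid := lch_lch M N hNM
    have hr := jps_reg k n IH (Q.comap (lch N)) (lch M f) (by rw [Ideal.mem_comap, hid]; exact hf) m
      (by rw [coeff_lch]; exact hm)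
    obtain ⟨s, hs, hs2⟩ := hr (lch M f) (by rw [Ideal.mem_comap, hid]; exact hf) (by
      intro i
      simp only
      rw [pder_lch, Ideal.mem_comap, hid, ldir_apply]
      exact sum_mem fun j _ => Ideal.mul_mem_left _ _ (hd j))
    refine ⟨lch N s, hs, ?_⟩
    have := Ideal.mem_map_of_mem (lch N) hs2
    rw [Ideal.map_pow, map_mul, hid] at this
    exact Ideal.pow_right_mono Ideal.map_comap_le _ this
end lin
end BSLC

namespace BSLC
open Polynomial

section localalg
variable {S : Type*} [CommRing S] [IsLocalRing S]
local notation "𝔪" => IsLocalRing.maximalIdeal S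
local notation "κS" => IsLocalRing.ResidueField S

lemma drop_gen (L : Ideal S) (s : Finset S) [DecidableEq S] (c : S → S) (x : S) (hx : x ∈ s) (hc : c x ∉ 𝔪)
    (h : ∑ y ∈ s, c y * y ∈ Ideal.span (↑(s.erase x) : Set S) ⊔ L) :
    Ideal.span (↑s : Set S) ≤ Ideal.span (↑(s.erase x) : Set S) ⊔ L := by
  rw [Ideal.span_le]
  intro y hy
  by_cases hyx : y = x
  · subst hyx
    have hu : IsUnit (c y) := by simpa using hc
    rw [← Finset.add_sum_erase _ _ hx] at h
    have h2 : ∑ z ∈ s.erase y, c z * z ∈ Ideal.span (↑(s.erase y) : Set S) ⊔ L :=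
      Ideal.mem_sup_left (sum_mem fun z hz => Ideal.mul_mem_left _ _ (Ideal.subset_span hz))
    have h3 := (Ideal.add_mem_iff_left _ h2).mp h
    exact (Ideal.unit_mul_mem_iff_mem _ hu).mp h3
  · exact Ideal.mem_sup_left (Ideal.subset_span (by simp [hyx]; exact hy))

lemma exists_min_gens [IsNoetherianRing S] (K : Ideal S) (hK : K ≤ 𝔪) (t : Finset S)
    (ht : Ideal.span (t : Set S) ⊔ K = 𝔪) :
    ∃ s t' : Finset S, (s : Set S) ⊆ K ∧ t' ⊆ t ∧ K ≤ Ideal.span (s : Set S) ⊔ 𝔪 ^ 2 ∧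
      Ideal.span (s : Set S) ⊔ Ideal.span (t' : Set S) = 𝔪 ∧
      ∀ c e : S → S, ∑ x ∈ s, c x * x + ∑ y ∈ t', e y * y ∈ 𝔪 ^ 2 →
        (∀ x ∈ s, c x ∈ 𝔪) ∧ ∀ y ∈ t', e y ∈ 𝔪 := by
  classical
  have wf : WellFounded ((· < ·) : Finset S → Finset S → Prop) := wellFounded_lt
  obtain ⟨s, ⟨hs1, hs2⟩, hsm⟩ := wf.has_min {s : Finset S | (s : Set S) ⊆ K ∧ K ≤ Ideal.span (s : Set S) ⊔ 𝔪 ^ 2} (by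
    obtain ⟨s, hs⟩ := (isNoetherianRing_iff_ideal_fg S).mp inferInstance K
    exact ⟨s, by rw [← hs]; exact Ideal.subset_span, by rw [← hs]; exact le_sup_left⟩)
  obtain ⟨t', ⟨ht1, ht2⟩, htm⟩ := wf.has_min {t' : Finset S | t' ⊆ t ∧ 𝔪 ≤ Ideal.span (t' : Set S) ⊔ (Ideal.span (s : Set S) ⊔ 𝔪 ^ 2)} (by
    refine ⟨t, subset_rfl, ?_⟩
    change 𝔪 ≤ _
    conv_lhs => rw [← ht]
    exact sup_le_sup_left hs2 _)
  have hsK : Ideal.span (s : Set S) ≤ 𝔪 := (Ideal.span_le.mpr hs1).trans hK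
  have htK : Ideal.span (t' : Set S) ≤ 𝔪 := by
    rw [← ht]
    exact (Ideal.span_mono (by exact_mod_cast ht1)).trans le_sup_left
  refine ⟨s, t', hs1, ht1, hs2, le_antisymm (sup_le hsK htK) ?_, ?_⟩
  · apply Submodule.le_of_le_smul_of_le_jacobson_bot (I := 𝔪) (IsNoetherian.noetherian _)
    · exact (IsLocalRing.jacobson_eq_maximalIdeal ⊥ bot_ne_top).ge
    · rw [smul_eq_mul, ← pow_two]
      refine ht2.trans ?_
      rw [← sup_assoc, sup_comm (Ideal.span (t' : Set S))]
  · intro c e h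
    have he : ∀ y ∈ t', e y ∈ 𝔪 := by
      intro y hy
      by_contra hc
      refine htm (t'.erase y) ⟨(Finset.erase_subset _ _).trans ht1, ?_⟩ (Finset.erase_ssubset hy)
      change 𝔪 ≤ _
      refine ht2.trans (sup_le ?_ le_sup_right)
      apply drop_gen _ t' e y hy hc
      have h1 : ∑ x ∈ s, c x * x ∈ (Ideal.span (↑(t'.erase y) : Set S) ⊔ (Ideal.span (s : Set S) ⊔ 𝔪 ^ 2)) :=
        Ideal.mem_sup_right (Ideal.mem_sup_left (sum_mem fun z hz => Ideal.mul_mem_left _ _ (Ideal.subset_span hz)))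
      exact (Ideal.add_mem_iff_right _ h1).mp (Ideal.mem_sup_right (Ideal.mem_sup_right h))
    refine ⟨?_, he⟩
    have h2 : ∑ y ∈ t', e y * y ∈ 𝔪 ^ 2 := by
      rw [pow_two]
      exact sum_mem fun y hy => Ideal.mul_mem_mul (he y hy) (htK (Ideal.subset_span hy))
    have h3 := (Ideal.add_mem_iff_left _ h2).mp h
    intro x hx
    by_contra hc
    refine hsm (s.erase x) ⟨fun z hz => hs1 (Finset.erase_subset _ _ hz), ?_⟩ (Finset.erase_ssubset hx)
    exact hs2.trans (sup_le (drop_gen _ s c x hx hc (Ideal.mem_sup_right h3)) le_sup_right)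

lemma dual_ders {N : ℕ} (d : Fin N → Der S) (hcomm : ∀ i j a, d i (d j a) = d j (d i a)) (x : Fin N → S)
    (hx : ∀ i j, d i (x j) = if i = j then 1 else 0) {ι : Type*} [Finite ι] [DecidableEq ι] (u : ι → S)
    (hli : LinearIndependent κS (fun j => (fun i => IsLocalRing.residue S (d i (u j)) : Fin N → κS))) :
    ∃ D : ι → Der S, (∀ i j a, D i (D j a) = D j (D i a)) ∧
      (∀ i j, D i (u j) = if i = j then 1 else 0) ∧
      ∀ i, D i ∈ Submodule.span S (Set.range d) := by
  classical
  set a : ι → (Fin N → κS) := fun j i => IsLocalRing.residue S (d i (u j)) with ha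
  set st : Fin N → (Fin N → κS) := fun j => Pi.single j 1 with hst
  have hres : ∀ j, (fun i => IsLocalRing.residue S (d i (x j))) = st j := by
    intro j; funext i
    rw [hx, hst]
    simp [Pi.single_apply, apply_ite]
  obtain ⟨b, hbt, hsb, htb, hb⟩ : ∃ b : Set (Fin N → κS), b ⊆ Set.range a ∪ Set.range st ∧ Set.range a ⊆ b ∧
      Set.range a ∪ Set.range st ⊆ Submodule.span κS b ∧ LinearIndepOn κS id b := by
    have h0 := hli.linearIndepOn_id
    have h1 : Set.range a ⊆ Set.range a ∪ Set.range st := Set.subset_union_left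
    exact ⟨h0.extend h1, h0.extend_subset h1, h0.subset_extend h1, by simpa using h0.subset_span_extend h1,
      h0.linearIndepOn_extend h1⟩
  have hspan : ⊤ ≤ Submodule.span κS (Set.range ((↑) : b → (Fin N → κS))) := by
    rw [Subtype.range_coe]
    have h1 : Submodule.span κS (Set.range st) = ⊤ := by
      have := (Pi.basisFun κS (Fin N)).span_eq
      rw [← this]; congr 2; funext j; simp [st]
    rw [← h1, Submodule.span_le]
    exact Set.subset_union_right.trans htb
  let β : Module.Basis b κS (Fin N → κS) := Module.Basis.mk hb hspan
  haveI : Finite b := β.linearIndependent.finite_of_isNoetherian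
  haveI : Fintype b := Fintype.ofFinite b
  have hcard : Fintype.card b = N := by
    rw [← Module.finrank_eq_card_basis β]; simp
  let ε : b ≃ Fin N := Fintype.equivFinOfCardEq hcard
  have hU : ∀ β : b, ∃ s : S, (∀ i, IsLocalRing.residue S (d i s) = β.1 i) ∧ ∀ j, a j = β.1 → s = u j := by
    rintro ⟨β, hβ⟩
    by_cases h : ∃ j, a j = β
    · obtain ⟨j, rfl⟩ := h
      refine ⟨u j, fun i => rfl, ?_⟩
      intro j' hj'
      rw [hli.injective hj']
    · rcases hbt hβ with h' | ⟨j, rfl⟩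
      · exact absurd h' h
      · exact ⟨x j, fun i => congrFun (hres j) i, fun j' hj' => absurd ⟨j', hj'⟩ h⟩
  choose U hU1 hU2 using hU
  let M : Matrix (Fin N) (Fin N) S := Matrix.of fun i j => d i (U (ε.symm j))
  have hdet : IsUnit M.det := by
    have h1 : IsUnit (M.map (IsLocalRing.residue S)) := by
      rw [← Matrix.linearIndependent_cols_iff_isUnit]
      have : (M.map (IsLocalRing.residue S)).col = (fun β : b => (β : Fin N → κS)) ∘ ε.symm := by
        funext j i
        exact hU1 _ _
      rw [this]
      exact hb.comp _ ε.symm.injective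
    rw [Matrix.isUnit_iff_isUnit_det] at h1
    have h2 : (M.map (IsLocalRing.residue S)).det = IsLocalRing.residue S M.det := by
      exact (RingHom.map_det (IsLocalRing.residue S) M).symm
    rw [h2] at h1
    exact (isUnit_map_iff (IsLocalRing.residue S) _).mp h1
  let E : Fin N → Der S := fun l => ∑ i, M⁻¹ l i • d i
  have hE : ∀ l s, E l s = ∑ i, M⁻¹ l i * d i s := fun l s => der_sum_apply _ _ _ _
  have hEU : ∀ l j, E l (U (ε.symm j)) = if l = j then 1 else 0 := by
    intro l j
    have := congrFun (congrFun (Matrix.nonsing_inv_mul M hdet) l) j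
    rw [Matrix.mul_apply, Matrix.one_apply] at this
    rw [hE, ← this]; rfl
  have hEE : ∀ l m s, E l (E m s) = E m (E l s) := by
    intro l m s
    let e : Fin N → S := fun i => E l (M⁻¹ m i) - E m (M⁻¹ l i)
    have h1 : ∀ s, E l (E m s) - E m (E l s) = ∑ i, e i * d i s := by
      intro s
      have h2 : ∀ l m, E l (E m s) = ∑ i, E l (M⁻¹ m i) * d i s + ∑ i, ∑ j, M⁻¹ l j * M⁻¹ m i * d j (d i s) := by
        intro l m
        rw [hE m, der_sum, ← Finset.sum_add_distrib]
        refine Finset.sum_congr rfl fun i _ => ?_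
        rw [der_mul, hE l (d i s), Finset.mul_sum, add_comm, mul_comm (d i s)]
        congr 1
        exact Finset.sum_congr rfl fun j _ => by ring
      have h3 : ∑ i, ∑ j, M⁻¹ l j * M⁻¹ m i * d j (d i s) = ∑ i, ∑ j, M⁻¹ m j * M⁻¹ l i * d j (d i s) := by
        rw [Finset.sum_comm]
        refine Finset.sum_congr rfl fun i _ => Finset.sum_congr rfl fun j _ => ?_
        rw [hcomm]; ring
      rw [h2 l m, h2 m l, h3]
      simp only [e, sub_mul, Finset.sum_sub_distrib]
      ring
    have h4 : e = 0 := by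
      have h5 : Matrix.vecMul e M = 0 := by
        funext j
        have := h1 (U (ε.symm j))
        rw [hEU, hEU] at this
        have h0 : ∀ l (p : Prop) [Decidable p], E l (if p then 1 else 0) = 0 := by
          intro l p _; split_ifs
          · exact der_one _
          · exact der_zero _
        rw [h0, h0, sub_zero] at this
        exact this.symm
      have h6 := congrArg (fun v => Matrix.vecMul v M⁻¹) h5
      simpa [Matrix.vecMul_vecMul, Matrix.mul_nonsing_inv M hdet] using h6
    have := h1 s
    rw [h4] at this
    simpa [sub_eq_zero] using this
  have haj : ∀ j, a j ∈ b := fun j => hsb ⟨j, rfl⟩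
  refine ⟨fun i => E (ε ⟨a i, haj i⟩), fun i j s => hEE _ _ _, ?_, ?_⟩
  · intro i j
    have h1 : u j = U (ε.symm (ε ⟨a j, haj j⟩)) := by
      rw [ε.symm_apply_apply]
      exact (hU2 _ j rfl).symm
    change E _ (u j) = _
    rw [h1, hEU]
    have : ε ⟨a i, haj i⟩ = ε ⟨a j, haj j⟩ ↔ i = j := by
      rw [ε.apply_eq_iff_eq, Subtype.mk.injEq]
      exact hli.injective.eq_iff
    simp only [this]
  · intro i
    exact sum_mem fun j _ => Submodule.smul_mem _ _ (Submodule.subset_span ⟨j, rfl⟩)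

/-- local coordinates adapted to an ideal -/
lemma local_coords [IsNoetherianRing S] {N : ℕ} (d : Fin N → Der S)
    (hcomm : ∀ i j a, d i (d j a) = d j (d i a)) (x : Fin N → S)
    (hx : ∀ i j, d i (x j) = if i = j then 1 else 0)
    (hJP : ∀ f ∈ 𝔪, (∀ i, d i f ∈ 𝔪) → f ∈ 𝔪 ^ 2)
    (K : Ideal S) (hK : K ≤ 𝔪) (t : Finset S)
    (ht : Ideal.span (t : Set S) ⊔ K = 𝔪) :
    ∃ (a b : ℕ) (w : Fin a → S) (z : Fin b → S) (D : Fin a ⊕ Fin b → Der S),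
      (∀ i, w i ∈ K) ∧ b ≤ t.card ∧ K ≤ Ideal.span (Set.range w) ⊔ 𝔪 ^ 2 ∧
      Ideal.span (Set.range w) ⊔ Ideal.span (Set.range z) = 𝔪 ∧
      (∀ i j a, D i (D j a) = D j (D i a)) ∧
      (∀ i j, D i (Sum.elim w z j) = if i = j then 1 else 0) ∧
      ∀ i, D i ∈ Submodule.span S (Set.range d) := by
  classical
  obtain ⟨s, t', hs, htt, hKs, hst, hind⟩ := exists_min_gens K hK t ht
  let w : Fin s.card → S := fun i => (s.equivFin.symm i : S)
  let z : Fin t'.card → S := fun i => (t'.equivFin.symm i : S)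
  have hw : Set.range w = (s : Set S) := by
    ext y; constructor
    · rintro ⟨i, rfl⟩; exact (s.equivFin.symm i).2
    · intro hy; exact ⟨s.equivFin ⟨y, hy⟩, by simp [w]⟩
  have hz : Set.range z = (t' : Set S) := by
    ext y; constructor
    · rintro ⟨i, rfl⟩; exact (t'.equivFin.symm i).2
    · intro hy; exact ⟨t'.equivFin ⟨y, hy⟩, by simp [z]⟩
  have hwsum : ∀ c : Fin s.card → S, ∃ c' : S → S, (∀ i, c' (w i) = c i) ∧ ∑ i, c i * w i = ∑ y ∈ s, c' y * y := by
    intro c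
    refine ⟨fun y => if h : y ∈ s then c (s.equivFin ⟨y, h⟩) else 0, ?_, ?_⟩
    · intro i; simp [w]
    · rw [← Finset.sum_coe_sort s, ← Equiv.sum_comp s.equivFin.symm]
      refine Finset.sum_congr rfl fun i _ => ?_
      simp [w]
  have hzsum : ∀ c : Fin t'.card → S, ∃ c' : S → S, (∀ i, c' (z i) = c i) ∧ ∑ i, c i * z i = ∑ y ∈ t', c' y * y := by
    intro c
    refine ⟨fun y => if h : y ∈ t' then c (t'.equivFin ⟨y, h⟩) else 0, ?_, ?_⟩
    · intro i; simp [z]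
    · rw [← Finset.sum_coe_sort t', ← Equiv.sum_comp t'.equivFin.symm]
      refine Finset.sum_congr rfl fun i _ => ?_
      simp [z]
  have hum : ∀ j, Sum.elim w z j ∈ 𝔪 := by
    rintro (j | j)
    · exact hK (hs (s.equivFin.symm j).2)
    · rw [← hst]; exact Ideal.mem_sup_right (Ideal.subset_span (t'.equivFin.symm j).2)
  obtain ⟨D, hD1, hD2, hD3⟩ := dual_ders d hcomm x hx (Sum.elim w z) (by
    rw [Fintype.linearIndependent_iff]
    intro g hg
    choose c hc using fun j => IsLocalRing.residue_surjective (R := S) (g j)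
    have hf : ∑ j, c j * Sum.elim w z j ∈ 𝔪 ^ 2 := by
      apply hJP
      · exact sum_mem fun j _ => Ideal.mul_mem_left _ _ (hum j)
      · intro i
        have h1 := congrFun hg i
        simp only [Finset.sum_apply, Pi.smul_apply, smul_eq_mul, Pi.zero_apply] at h1
        have h2 : ∑ j, c j * d i (Sum.elim w z j) ∈ 𝔪 := by
          rw [← IsLocalRing.residue_eq_zero_iff, map_sum, ← h1]
          exact Finset.sum_congr rfl fun j _ => by rw [map_mul, hc]
        rw [der_sum]
        have : ∀ j, d i (c j * Sum.elim w z j) = c j * d i (Sum.elim w z j) + Sum.elim w z j * d i (c j) :=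
          fun j => der_mul _ _ _
        simp only [this, Finset.sum_add_distrib]
        exact add_mem h2 (sum_mem fun j _ => Ideal.mul_mem_right _ _ (hum j))
    rw [Fintype.sum_sum_type] at hf
    simp only [Sum.elim_inl, Sum.elim_inr] at hf
    obtain ⟨c1, h1, h1'⟩ := hwsum (fun i => c (Sum.inl i))
    obtain ⟨c2, h2, h2'⟩ := hzsum (fun i => c (Sum.inr i))
    rw [h1', h2'] at hf
    obtain ⟨k1, k2⟩ := hind _ _ hf
    rintro (j | j)
    · rw [← hc, IsLocalRing.residue_eq_zero_iff, ← h1]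
      exact k1 _ (s.equivFin.symm j).2
    · rw [← hc, IsLocalRing.residue_eq_zero_iff, ← h2]
      exact k2 _ (t'.equivFin.symm j).2)
  refine ⟨s.card, t'.card, w, z, D, fun i => hs (s.equivFin.symm i).2, Finset.card_le_card htt,
    by rw [hw]; exact hKs, by rw [hw, hz]; exact hst, hD1, hD2, hD3⟩

end localalg
end BSLC

namespace BSLC
open Polynomial

lemma exists_der_quot {S S' : Type*} [CommRing S] [CommRing S'] (φ : S →+* S') (hφ : Function.Surjective φ)
    (d : Der S) (h : ∀ a, φ a = 0 → φ (d a) = 0) : ∃ d' : Der S', ∀ a, d' (φ a) = φ (d a) := by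
  choose r hr using hφ
  have key : ∀ a b, φ a = φ b → φ (d a) = φ (d b) := by
    intro a b hab
    have := h (a - b) (by rw [map_sub, hab, sub_self])
    rwa [der_sub, map_sub, sub_eq_zero] at this
  let F : S' →+ S' :=
    { toFun := fun y => φ (d (r y))
      map_zero' := by rw [key (r 0) 0 (by rw [hr, map_zero]), der_zero, map_zero]
      map_add' := fun x y => by
        rw [key (r (x + y)) (r x + r y) (by rw [hr, map_add, hr, hr]), der_add, map_add] }
  refine ⟨mkDer F ?_, ?_⟩
  · intro x y
    change φ (d (r (x * y))) = x * φ (d (r y)) + y * φ (d (r x))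
    rw [key (r (x * y)) (r x * r y) (by rw [hr, map_mul, hr, hr]), der_mul, map_add, map_mul, map_mul, hr, hr]
  · intro a
    exact key _ _ (hr _)

lemma charZero_residue {S : Type*} [CommRing S] [IsLocalRing S] (h : ∀ n : ℕ, n ≠ 0 → IsUnit (n : S)) :
    CharZero (IsLocalRing.ResidueField S) := by
  apply charZero_of_inj_zero
  intro n hn
  by_contra h0
  have := (h n h0).map (IsLocalRing.residue S)
  rw [map_natCast, hn] at this
  exact not_isUnit_zero this

lemma coords_domain {S : Type*} [CommRing S] [IsLocalRing S] [IsNoetherianRing S]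
    (hunit : ∀ n : ℕ, n ≠ 0 → IsUnit (n : S)) {c : ℕ} (D : Fin c → Der S)
    (hD : ∀ i j a, D i (D j a) = D j (D i a)) (u : Fin c → S)
    (hu : ∀ i j, D i (u j) = if i = j then 1 else 0)
    (hm : IsLocalRing.maximalIdeal S = Ideal.span (Set.range u)) : IsDomain S := by
  haveI := charZero_residue hunit
  haveI : IsDomain (MvPowerSeries (Fin c) (IsLocalRing.ResidueField S)) := NoZeroDivisors.to_isDomain _
  exact (taylor_injective D hD u hu hm).isDomain (taylor D hD)

lemma coords_dim_le {S : Type*} [CommRing S] [IsLocalRing S] [IsNoetherianRing S]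
    {c : ℕ} (u : Fin c → S)
    (hm : IsLocalRing.maximalIdeal S = Ideal.span (Set.range u)) : ringKrullDim S ≤ c := by
  refine (ringKrullDim_le_spanFinrank_maximalIdeal S).trans ?_
  rw [hm]
  have h1 : (Ideal.span (Set.range u)).spanFinrank ≤ (Set.range u).ncard :=
    Submodule.spanFinrank_span_le_ncard_of_finite (Set.finite_range u)
  have h2 : (Set.range u).ncard ≤ c := by
    rw [← Set.image_univ]
    refine (Set.ncard_image_le (Set.finite_univ)).trans ?_
    simp [Set.ncard_univ]
  exact_mod_cast h1.trans h2

/-- quotient by a subset of the coordinates killed by the remaining derivations -/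
lemma coords_quot {S : Type*} [CommRing S] [IsLocalRing S]
    {a c : ℕ} (w : Fin a → S) (u : Fin c → S) (D : Fin c → Der S)
    (hD : ∀ i j a, D i (D j a) = D j (D i a))
    (hu : ∀ i j, D i (u j) = if i = j then 1 else 0) (hw : ∀ i j, D i (w j) = 0)
    (hm : Ideal.span (Set.range w) ⊔ Ideal.span (Set.range u) = IsLocalRing.maximalIdeal S)
    {S' : Type*} [CommRing S'] [IsLocalRing S'] (φ : S →+* S') (hφ : Function.Surjective φ)
    (hker : RingHom.ker φ = Ideal.span (Set.range w)) :
    ∃ D' : Fin c → Der S', (∀ i a, D' i (φ a) = φ (D i a)) ∧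
    (∀ i j a, D' i (D' j a) = D' j (D' i a)) ∧ (∀ i j, D' i (φ (u j)) = if i = j then 1 else 0) ∧
    IsLocalRing.maximalIdeal S' = Ideal.span (Set.range (φ ∘ u)) := by
  have hpres : ∀ i (s : S), φ s = 0 → φ (D i s) = 0 := by
    intro i s hs
    rw [← RingHom.mem_ker, hker] at hs ⊢
    induction hs using Submodule.span_induction with
    | mem x hx => obtain ⟨j, rfl⟩ := hx; rw [hw]; exact zero_mem _
    | zero => rw [der_zero]; exact zero_mem _
    | add x y _ _ h1 h2 => rw [der_add]; exact add_mem h1 h2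
    | smul r x hx h =>
      rw [smul_eq_mul, der_mul]
      exact add_mem (Ideal.mul_mem_left _ _ h) (Ideal.mul_mem_right _ _ hx)
  choose D' hD' using fun i => exists_der_quot φ hφ (D i) (hpres i)
  refine ⟨D', hD', ?_, ?_, ?_⟩
  · intro i j a
    obtain ⟨a, rfl⟩ := hφ a
    rw [hD', hD', hD', hD', hD]
  · intro i j
    rw [hD', hu]; split_ifs <;> simp
  · have h1 : IsLocalRing.maximalIdeal S' = (IsLocalRing.maximalIdeal S).map φ := by
      have := IsLocalRing.map_maximalIdeal_of_surjective φ hφ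
      exact this.symm
    rw [h1, ← hm, Ideal.map_sup, Ideal.map_span, Ideal.map_span, Set.range_comp]
    apply le_antisymm
    · refine sup_le ?_ le_rfl
      rw [Ideal.span_le]
      rintro _ ⟨_, ⟨j, rfl⟩, rfl⟩
      have : φ (w j) = 0 := by
        rw [← RingHom.mem_ker, hker]; exact Ideal.subset_span ⟨j, rfl⟩
      rw [this]; exact zero_mem _
    · exact le_sup_right

lemma coords_le_dim (c : ℕ) : ∀ {S : Type u} [CommRing S] [IsLocalRing S] [IsNoetherianRing S]
    (hunit : ∀ n : ℕ, n ≠ 0 → IsUnit (n : S)) (D : Fin c → Der S)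
    (hD : ∀ i j a, D i (D j a) = D j (D i a)) (u : Fin c → S)
    (hu : ∀ i j, D i (u j) = if i = j then 1 else 0)
    (hm : IsLocalRing.maximalIdeal S = Ideal.span (Set.range u)), (c : WithBot ℕ∞) ≤ ringKrullDim S := by
  induction c with
  | zero => intros; simpa using ringKrullDim_nonneg_of_nontrivial
  | succ c ih =>
    intro S _ _ _ hunit D hD u hu hm
    haveI := coords_domain hunit D hD u hu hm
    let φ := Ideal.Quotient.mk (Ideal.span {u 0})
    have hu0 : u 0 ∈ IsLocalRing.maximalIdeal S := by rw [hm]; exact Ideal.subset_span ⟨0, rfl⟩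
    haveI : Nontrivial (S ⧸ Ideal.span {u 0}) := by
      apply Ideal.Quotient.nontrivial_iff.mpr
      rw [Ne, Ideal.span_singleton_eq_top]
      simpa using hu0
    haveI : IsLocalRing (S ⧸ Ideal.span {u 0}) := IsLocalRing.of_surjective' φ Ideal.Quotient.mk_surjective
    obtain ⟨D', -, h2, h3, h4⟩ := coords_quot (fun _ : Fin 1 => u 0) (fun i : Fin c => u i.succ) (fun i => D i.succ)
      (fun _ _ _ => hD _ _ _) (fun i j => by rw [hu]; simp) (fun i j => by rw [hu]; simp)
      (by
        rw [hm, ← Ideal.span_union]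
        congr 1
        ext y; constructor
        · rintro (⟨i, rfl⟩ | ⟨i, rfl⟩)
          exacts [⟨0, rfl⟩, ⟨_, rfl⟩]
        · rintro ⟨i, rfl⟩
          refine Fin.cases ?_ (fun j => ?_) i
          · exact Or.inl ⟨0, rfl⟩
          · exact Or.inr ⟨j, rfl⟩) φ Ideal.Quotient.mk_surjective
      (by rw [Ideal.mk_ker]; congr 1; ext; simp [eq_comm])
    have h5 := ih (fun n hn => by simpa using (hunit n hn).map φ) D' h2 (fun i => φ (u i.succ)) h3 h4
    have h6 : u 0 ≠ 0 := by
      intro h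
      have := hu 0 0
      rw [h, der_zero] at this; simp at this
    have h7 := ringKrullDim_quotient_succ_le_of_nonZeroDivisor (mem_nonZeroDivisors_of_ne_zero h6)
    refine le_trans ?_ h7
    push_cast
    gcongr

lemma loc_ext {A S : Type*} [CommRing A] [CommRing S] [Algebra A S] {N : ℕ} (d : Fin N → Der A)
    (hcomm : ∀ i j a, d i (d j a) = d j (d i a)) (x : Fin N → A)
    (hx : ∀ i j, d i (x j) = if i = j then 1 else 0) (Q : Ideal A) [Q.IsPrime] (hJP : JP d Q)
    [IsLocalization.AtPrime S Q] [IsLocalRing S] :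
    ∃ d' : Fin N → Der S, (∀ i b, d' i (algebraMap _ _ b) = algebraMap _ _ (d i b)) ∧
     (∀ i j a, d' i (d' j a) = d' j (d' i a)) ∧
     (∀ i j, d' i (algebraMap _ _ (x j)) = if i = j then 1 else 0) ∧
     (∀ f ∈ IsLocalRing.maximalIdeal S, (∀ i, d' i f ∈ IsLocalRing.maximalIdeal S) →
       f ∈ IsLocalRing.maximalIdeal S ^ 2) := by
  choose d' hd' using fun i => exists_der_localization (S := S) Q.primeCompl (d i)
  have hmem : ∀ a : A, algebraMap A S a ∈ IsLocalRing.maximalIdeal S ↔ a ∈ Q := fun a =>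
    IsLocalization.AtPrime.to_map_mem_maximal_iff S Q a
  refine ⟨d', hd', ?_, ?_, ?_⟩
  · intro i j a
    have : ⁅d' i, d' j⁆ = 0 := by
      apply der_localization_unique Q.primeCompl
      intro b
      rw [Derivation.commutator_apply, hd', hd', hd', hd', hcomm, sub_self]; rfl
    have h2 := congrArg (fun e : Der S => e a) this
    simp only [Derivation.commutator_apply] at h2
    exact sub_eq_zero.mp h2
  · intro i j
    rw [hd', hx]; split_ifs <;> simp
  · intro f hf hdf
    obtain ⟨⟨a, s⟩, hs⟩ := IsLocalization.surj Q.primeCompl f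
    simp only at hs
    have hsu : IsUnit (algebraMap A S s) := IsLocalization.map_units S s
    have ha : a ∈ Q := by
      rw [← hmem, ← hs]; exact Ideal.mul_mem_right _ _ hf
    obtain ⟨t, ht, ht2⟩ := hJP a ha (fun i => by
      rw [← hmem, ← hd', ← hs, der_mul]
      exact add_mem (Ideal.mul_mem_right _ _ hf) (Ideal.mul_mem_left _ _ (hdf i)))
    have h1 : algebraMap A S (t * a) ∈ IsLocalRing.maximalIdeal S ^ 2 := by
      have := Ideal.mem_map_of_mem (algebraMap A S) ht2
      rw [Ideal.map_pow] at this
      refine Ideal.pow_right_mono ?_ 2 this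
      rw [Ideal.map_le_iff_le_comap]
      intro b hb; exact (hmem b).mpr hb
    have htu : IsUnit (algebraMap A S t) := IsLocalization.map_units S (⟨t, ht⟩ : Q.primeCompl)
    rw [map_mul, ← hs] at h1
    rw [Ideal.unit_mul_mem_iff_mem _ htu, Ideal.mul_unit_mem_iff_mem _ hsu] at h1
    exact h1

lemma psb_all (c : ℕ) : ∀ (κ : Type u) [Field κ] [CharZero κ], PSb κ c := by
  induction c using Nat.strong_induction_on with
  | _ c IH =>
  intro κ _ _
  refine psb_step ?_
  intro g P hP hPm
  have hnoeth : IsNoetherianRing (MvPowerSeries (Fin c) κ) := inferInstance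
  let T := MvPowerSeries (Fin c) κ
  let S := Localization.AtPrime P
  obtain ⟨d', h1, h2, h3, h4⟩ := loc_ext (fun i => pder κ i) (fun i j a => pder_comm i j a)
    (fun i => (MvPowerSeries.X i : T)) (fun i j => pder_X κ i j) P (jps c P hP) (S := S)
  haveI : IsNoetherianRing S := IsLocalization.isNoetherianRing P.primeCompl S inferInstance
  have hunit : ∀ n : ℕ, n ≠ 0 → IsUnit (n : S) := fun n hn => by
    simpa using (mvps_isUnit_natCast κ c n hn).map (algebraMap T S)
  haveI := charZero_residue hunit
  obtain ⟨t, ht⟩ := (isNoetherianRing_iff_ideal_fg S).mp inferInstance (IsLocalRing.maximalIdeal S)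
  obtain ⟨a, b, w, z, D, k1, -, -, k4, k5, k6, k7⟩ := local_coords d' h2 _ h3 h4 ⊥ bot_le t
    (by rw [sup_bot_eq]; exact ht)
  have ha : IsEmpty (Fin a) := ⟨fun i => by
    have := k6 (Sum.inl i) (Sum.inl i)
    have h0 : w i = 0 := k1 i
    rw [Sum.elim_inl, h0, der_zero] at this
    simp at this⟩
  have k4' : IsLocalRing.maximalIdeal S = Ideal.span (Set.range z) := by
    rw [← k4, Set.range_eq_empty, Ideal.span_empty, bot_sup_eq]
  let L : LocData (fun i => pder κ i) P b :=
    { u := z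
      D := fun i => D (Sum.inr i)
      comm := fun i j a => k5 _ _ _
      dual := fun i j => by
        have := k6 (Sum.inr i) (Sum.inr j)
        simpa using this
      max := k4'
      d' := d'
      hd' := h1
      span := fun i => k7 _ }
  have hb : (b : WithBot ℕ∞) ≤ ringKrullDim S := coords_le_dim b hunit L.D L.comm L.u L.dual L.max
  rw [IsLocalization.AtPrime.ringKrullDim_eq_height P S] at hb
  have hPlt : P < IsLocalRing.maximalIdeal T := lt_of_le_of_ne (IsLocalRing.le_maximalIdeal hP.ne_top) hPm
  have hT : ringKrullDim T ≤ c := coords_dim_le (MvPowerSeries.X : Fin c → T) (mvps_maximalIdeal κ c)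
  rw [← IsLocalRing.maximalIdeal_height_eq_ringKrullDim] at hT
  have hlt := Ideal.height_strict_mono_of_isPrime_of_isPrime hPlt
  have hb' : (b : ℕ∞) ≤ P.height := by exact_mod_cast hb
  have hT' : (IsLocalRing.maximalIdeal T).height ≤ (c : ℕ∞) := by exact_mod_cast hT
  have hbc : b < c := by
    have := (hb'.trans_lt hlt).trans_le hT'
    exact_mod_cast this
  have hfin : PSb (IsLocalRing.ResidueField (Localization.AtPrime P)) b :=
    IH b hbc (IsLocalRing.ResidueField (Localization.AtPrime P))
  exact bf_local (fun i => pder κ i) g P L hfin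

end BSLC

namespace BSLC
open Polynomial

/-- rings with enough commuting derivations -/
def Good (A : Type*) [CommRing A] : Prop :=
  IsNoetherianRing A ∧ (∀ n : ℕ, n ≠ 0 → IsUnit (n : A)) ∧
    ∃ (N : ℕ) (d : Fin N → Der A) (x : Fin N → A), (∀ i j a, d i (d j a) = d j (d i a)) ∧
      (∀ i j, d i (x j) = if i = j then 1 else 0) ∧ ∀ Q : Ideal A, Q.IsPrime → JP d Q

lemma good_mvps (k : Type*) [Field k] [CharZero k] (n : ℕ) : Good (MvPowerSeries (Fin n) k) :=
  ⟨inferInstance, mvps_isUnit_natCast k n, n, fun i => pder k i, fun i => MvPowerSeries.X i,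
    fun i j a => pder_comm i j a, fun i j => pder_X k i j, jps n⟩

/-- formal derivative as a Der -/
noncomputable def derX (B : Type*) [CommRing B] : Der B[X] :=
  mkDer (derivative : B[X] →ₗ[B] B[X]).toAddMonoidHom (by
    intro a b
    change derivative (a * b) = a * derivative b + b * derivative a
    rw [derivative_mul]; ring)

lemma derX_apply (B : Type*) [CommRing B] (p : B[X]) : derX B p = derivative p := rfl

lemma good_poly {B : Type*} [CommRing B] (h : Good B) : Good B[X] := by
  obtain ⟨h1, h2, N, d, x, h3, h4, h5⟩ := h
  refine ⟨inferInstance, fun n hn => by simpa using (h2 n hn).map (C : B →+* B[X]), N + 1,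
    Fin.cons (derX B) (fun i => polyDer (d i)), Fin.cons X (fun i => C (x i)), ?_, ?_, ?_⟩
  · have hc : ∀ i a, derX B (polyDer (d i) a) = polyDer (d i) (derX B a) := by
      intro i a
      ext n
      rw [derX_apply, derX_apply, coeff_derivative, coeff_polyDer, coeff_polyDer, coeff_derivative, der_mul]
      have : d i ((n : B) + 1) = 0 := by rw [der_add, der_natCast, der_one, add_zero]
      rw [this]; ring
    intro i j a
    refine Fin.cases ?_ (fun i => ?_) i <;> refine Fin.cases ?_ (fun j => ?_) j
    · rfl
    · simp only [Fin.cons_zero, Fin.cons_succ]; exact hc _ _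
    · simp only [Fin.cons_zero, Fin.cons_succ]; exact (hc _ _).symm
    · simp only [Fin.cons_succ]
      ext n
      simp only [coeff_polyDer, h3]
  · intro i j
    refine Fin.cases ?_ (fun i => ?_) i <;> refine Fin.cases ?_ (fun j => ?_) j
    · simp [derX_apply]
    · simp [derX_apply, (Fin.succ_ne_zero _).symm]
    · simp
    · simp only [Fin.cons_succ, polyDer_C, h4, Fin.succ_inj]; split_ifs <;> simp
  · intro Q hQ f hf hd
    exact jp_poly d h2 Q (h5 _ inferInstance) f hf (fun i => by simpa using hd i.succ)
      (by simpa [derX_apply] using hd 0)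

lemma good_cover {B : Type u} [CommRing B] (h : Good B) (m : ℕ) :
    ∃ (A : Type u) (_ : CommRing A), Good A ∧ Nonempty (A ≃+* MvPolynomial (Fin m) B) := by
  induction m with
  | zero => exact ⟨B, inferInstance, h, ⟨(MvPolynomial.isEmptyRingEquiv B (Fin 0)).symm⟩⟩
  | succ m ih =>
    obtain ⟨A, _, hA, ⟨e⟩⟩ := ih
    refine ⟨A[X], inferInstance, good_poly hA, ⟨(Polynomial.mapEquiv e).trans
      (MvPolynomial.finSuccEquiv B m).symm.toRingEquiv⟩⟩

section
variable {A R S L : Type u} [CommRing A] [CommRing R] [CommRing S] [CommRing L] [Algebra A S] [Algebra R L]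
  (π : A →+* R) (hπ : Function.Surjective π)
  {N : ℕ} (d : Fin N → Der A)

/-- coefficient vectors of derivations preserving the kernel -/
def gmod : Submodule A (Fin N → A) where
  carrier := {a | ∀ f, π f = 0 → π (∑ i, a i * d i f) = 0}
  zero_mem' := by intro f _; simp
  add_mem' := by
    intro a b ha hb f hf
    simp only [Pi.add_apply, add_mul, Finset.sum_add_distrib]
    rw [map_add, ha f hf, hb f hf, add_zero]
  smul_mem' := by
    intro c a ha f hf
    simp only [Pi.smul_apply, smul_eq_mul, mul_assoc, ← Finset.mul_sum]
    rw [map_mul, ha f hf, mul_zero]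

lemma mem_gmod (a : Fin N → A) : a ∈ gmod π d ↔ ∀ f, π f = 0 → π (∑ i, a i * d i f) = 0 := Iff.rfl

include hπ in
lemma exists_delta [IsNoetherianRing A] (hcomm : ∀ i j a, d i (d j a) = d j (d i a)) :
    ∃ (r : ℕ) (v : Fin r → (Fin N → A)) (δ : Fin r → Der R),
      Submodule.span A (Set.range v) = gmod π d ∧
      (∀ l f, δ l (π f) = π (∑ i, v l i * d i f)) ∧
      ∃ c : Fin r → Fin r → Fin r → R, ∀ i j a, δ i (δ j a) - δ j (δ i a) = ∑ l, c i j l * δ l a := by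
  classical
  obtain ⟨s, hs⟩ := IsNoetherian.noetherian (gmod π d)
  let v : Fin s.card → (Fin N → A) := fun l => (s.equivFin.symm l).1
  have hv : Set.range v = (s : Set _) := by
    ext y; constructor
    · rintro ⟨i, rfl⟩; exact (s.equivFin.symm i).2
    · intro hy; exact ⟨s.equivFin ⟨y, hy⟩, by simp [v]⟩
  have hvs : Submodule.span A (Set.range v) = gmod π d := by rw [hv]; exact hs
  have hvm : ∀ l, v l ∈ gmod π d := fun l => by rw [← hvs]; exact Submodule.subset_span ⟨l, rfl⟩
  let E : (Fin N → A) → Der A := fun a => ∑ i, a i • d i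
  have hE : ∀ a f, E a f = ∑ i, a i * d i f := fun a f => der_sum_apply _ _ _ _
  choose δ hδ using fun l => exists_der_quot π hπ (E (v l)) (by
    intro f hf; rw [hE]; exact hvm l f hf)
  have hbr : ∀ a b f, E a (E b f) - E b (E a f) = E (fun i => E a (b i) - E b (a i)) f := by
    intro a b f
    have h2 : ∀ a b, E a (E b f) = ∑ i, E a (b i) * d i f + ∑ i, ∑ j, a j * b i * d j (d i f) := by
      intro a b
      rw [hE b, der_sum, ← Finset.sum_add_distrib]
      refine Finset.sum_congr rfl fun i _ => ?_
      rw [der_mul, hE a (d i f), Finset.mul_sum, add_comm, mul_comm (d i f)]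
      congr 1
      exact Finset.sum_congr rfl fun j _ => by ring
    have h3 : ∑ i, ∑ j, a j * b i * d j (d i f) = ∑ i, ∑ j, b j * a i * d j (d i f) := by
      rw [Finset.sum_comm]
      refine Finset.sum_congr rfl fun i _ => Finset.sum_congr rfl fun j _ => ?_
      rw [hcomm]; ring
    rw [h2 a b, h2 b a, h3, hE]
    simp only [sub_mul, Finset.sum_sub_distrib]
    ring
  have hmem : ∀ i j, (fun l => E (v i) (v j l) - E (v j) (v i l)) ∈ gmod π d := by
    intro i j f hf
    rw [← hE, ← hbr, map_sub]
    have h1 : ∀ l g, π g = 0 → π (E (v l) g) = 0 := fun l g hg => by rw [hE]; exact hvm l g hg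
    rw [h1 i _ (h1 j f hf), h1 j _ (h1 i f hf), sub_zero]
  have hcoef : ∀ i j, ∃ e : Fin s.card → A, ∑ l, e l • v l = fun l => E (v i) (v j l) - E (v j) (v i l) := by
    intro i j
    have := hmem i j
    rw [← hvs, Submodule.mem_span_range_iff_exists_fun] at this
    exact this
  choose e he using hcoef
  refine ⟨s.card, v, δ, hvs, fun l f => by rw [hδ, hE], fun i j l => π (e i j l), ?_⟩
  intro i j a
  obtain ⟨f, rfl⟩ := hπ a
  simp only [hδ]
  rw [← map_sub, hbr, ← he i j, hE]
  simp only [Finset.sum_apply, Pi.smul_apply, smul_eq_mul, Finset.sum_mul]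
  rw [Finset.sum_comm, map_sum]
  refine Finset.sum_congr rfl fun l _ => ?_
  rw [hE, ← map_mul, Finset.mul_sum]
  congr 1
  exact Finset.sum_congr rfl fun m _ => by ring

end
end BSLC

namespace BSLC

lemma reg_quot {S L : Type u} [CommRing S] [IsLocalRing S] [IsNoetherianRing S]
    [CommRing L] [IsLocalRing L] [IsNoetherianRing L]
    (hunit : ∀ n : ℕ, n ≠ 0 → IsUnit (n : S)) {N : ℕ} (d : Fin N → Der S)
    (hcomm : ∀ i j a, d i (d j a) = d j (d i a)) (x : Fin N → S)
    (hx : ∀ i j, d i (x j) = if i = j then 1 else 0)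
    (hJP : ∀ f ∈ IsLocalRing.maximalIdeal S, (∀ i, d i f ∈ IsLocalRing.maximalIdeal S) →
      f ∈ IsLocalRing.maximalIdeal S ^ 2)
    (φ : S →+* L) (hφ : Function.Surjective φ) (t : Finset L)
    (ht : Ideal.span (t : Set L) = IsLocalRing.maximalIdeal L)
    (hcard : (t.card : WithBot ℕ∞) = ringKrullDim L) :
    ∃ (b : ℕ) (u : Fin b → L) (D : Fin b → Der S) (D' : Fin b → Der L),
      (∀ i, D i ∈ Submodule.span S (Set.range d)) ∧ (∀ i a, D' i (φ a) = φ (D i a)) ∧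
      (∀ i j a, D' i (D' j a) = D' j (D' i a)) ∧ (∀ i j, D' i (u j) = if i = j then 1 else 0) ∧
      IsLocalRing.maximalIdeal L = Ideal.span (Set.range u) := by
  classical
  have hmax : (IsLocalRing.maximalIdeal L).comap φ = IsLocalRing.maximalIdeal S :=
    IsLocalRing.eq_maximalIdeal (Ideal.comap_isMaximal_of_surjective φ hφ)
  have hφ' := hφ
  choose r hr using hφ'
  let t₀ : Finset S := t.image r
  have hK : RingHom.ker φ ≤ IsLocalRing.maximalIdeal S := by
    rw [← hmax]; intro a ha; rw [Ideal.mem_comap, (RingHom.mem_ker).1 ha]; exact zero_mem _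
  have hmap : (Ideal.span (t₀ : Set S)).map φ = IsLocalRing.maximalIdeal L := by
    rw [Ideal.map_span, ← ht]
    congr 1
    ext y
    simp only [t₀, Finset.coe_image, Set.mem_image, Finset.mem_coe, exists_exists_and_eq_and, hr]
    simp
  have ht₀ : Ideal.span (t₀ : Set S) ⊔ RingHom.ker φ = IsLocalRing.maximalIdeal S := by
    rw [← hmax, ← hmap, Ideal.comap_map_of_surjective φ hφ]
    rfl
  obtain ⟨a, b, w, z, D, hwK, hb, -, hwz, hDc, hDd, hDs⟩ :=
    local_coords d hcomm x hx hJP (RingHom.ker φ) hK t₀ ht₀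
  have hb' : b ≤ t.card := hb.trans Finset.card_image_le
  have hcq := fun {S' : Type _} [CommRing S'] [IsLocalRing S'] (ψ : S →+* S') hψ hker =>
    coords_quot w z (fun i => D (Sum.inr i)) (fun i j a => hDc _ _ a)
      (fun i j => by have := hDd (Sum.inr i) (Sum.inr j); simpa using this)
      (fun i j => by have := hDd (Sum.inr i) (Sum.inl j); simpa using this) hwz (S' := S') ψ hψ hker
  have hker : RingHom.ker φ = Ideal.span (Set.range w) := by
    have hle : Ideal.span (Set.range w) ≤ RingHom.ker φ := by
      rw [Ideal.span_le]; rintro _ ⟨i, rfl⟩; exact hwK i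
    refine le_antisymm ?_ hle
    intro y hy
    by_contra hyw
    let W := Ideal.span (Set.range w)
    haveI : Nontrivial (S ⧸ W) := Ideal.Quotient.nontrivial_iff.mpr (fun h => by
      have h2 := hle.trans hK
      have : (1 : S) ∈ W := by rw [h]; trivial
      exact (Ideal.ne_top_iff_one _).1 (IsLocalRing.maximalIdeal.isMaximal S).ne_top (h2 this))
    haveI : IsLocalRing (S ⧸ W) := IsLocalRing.of_surjective' (Ideal.Quotient.mk W) Ideal.Quotient.mk_surjective
    obtain ⟨D1, -, h2, h3, h4⟩ := hcq (Ideal.Quotient.mk W) Ideal.Quotient.mk_surjective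
      (Ideal.mk_ker)
    have hun : ∀ n : ℕ, n ≠ 0 → IsUnit (n : S ⧸ W) := fun n hn => by
      simpa using (hunit n hn).map (Ideal.Quotient.mk W)
    haveI := coords_domain hun D1 h2 _ h3 h4
    have hdim := coords_dim_le _ h4
    let yb : S ⧸ W := Ideal.Quotient.mk W y
    have hyb : yb ≠ 0 := fun h => hyw (Ideal.Quotient.eq_zero_iff_mem.1 h)
    have h5 := ringKrullDim_quotient_succ_le_of_nonZeroDivisor (mem_nonZeroDivisors_of_ne_zero hyb)
    let ψ : S ⧸ W →+* L := Ideal.Quotient.lift W φ (fun a ha => hle ha)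
    let ψ' : (S ⧸ W) ⧸ Ideal.span {yb} →+* L := Ideal.Quotient.lift _ ψ (by
      intro a ha
      have : Ideal.span {yb} ≤ RingHom.ker ψ := by
        rw [Ideal.span_le, Set.singleton_subset_iff]
        exact (hy : ψ yb = 0)
      exact this ha)
    have h6 : Function.Surjective ψ' := fun l =>
      ⟨Ideal.Quotient.mk _ (Ideal.Quotient.mk _ (r l)), hr l⟩
    have h7 := ringKrullDim_le_of_surjective ψ' h6
    rw [← hcard] at h7
    have h8 : ((t.card : WithBot ℕ∞) + 1) ≤ (b : WithBot ℕ∞) :=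
      (by gcongr : (t.card : WithBot ℕ∞) + 1 ≤ _ + 1).trans (h5.trans hdim)
    have h9 : t.card + 1 ≤ b := by exact_mod_cast h8
    omega
  obtain ⟨D', h1, h2, h3, h4⟩ := hcq φ hφ hker
  exact ⟨b, φ ∘ z, fun i => D (Sum.inr i), D', fun i => hDs _, h1, h2, h3, h4⟩

section
variable {A R S L : Type u} [CommRing A] [CommRing R] [CommRing S] [CommRing L]
  [Algebra A S] [Algebra R L]

lemma loc_surj (π : A →+* R) (hπ : Function.Surjective π) (q : Ideal R) [q.IsPrime]
    (Q : Ideal A) [Q.IsPrime] (hQ : Q = q.comap π)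
    [IsLocalization.AtPrime S Q] [IsLocalization.AtPrime L q] (φ : S →+* L)
    (hφ : ∀ a, φ (algebraMap A S a) = algebraMap R L (π a)) : Function.Surjective φ := by
  intro l
  obtain ⟨⟨r, m⟩, h⟩ := IsLocalization.surj q.primeCompl l
  obtain ⟨a, rfl⟩ := hπ r
  obtain ⟨m, hm⟩ := m
  obtain ⟨s, rfl⟩ := hπ m
  have hs : s ∈ Q.primeCompl := by
    intro h; rw [SetLike.mem_coe, hQ] at h; exact hm h
  refine ⟨IsLocalization.mk' S a ⟨s, hs⟩, ?_⟩
  have hu : IsUnit (algebraMap R L (π s)) := IsLocalization.map_units (M := q.primeCompl) L ⟨π s, hm⟩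
  apply hu.mul_right_cancel
  simp only at h
  rw [h, ← hφ, ← hφ, ← map_mul, IsLocalization.mk'_spec S a (⟨s, hs⟩ : Q.primeCompl)]

lemma span_descend [IsNoetherianRing A] (π : A →+* R) (hπ : Function.Surjective π)
    {N : ℕ} (d : Fin N → Der A) {r : ℕ} (v : Fin r → (Fin N → A)) (δ : Fin r → Der R)
    (hv : Submodule.span A (Set.range v) = gmod π d)
    (hδ : ∀ l f, δ l (π f) = π (∑ i, v l i * d i f))
    (q : Ideal R) [q.IsPrime]
    (Q : Ideal A) [Q.IsPrime] (hQ : Q = q.comap π)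
    [IsLocalization.AtPrime S Q] [IsLocalization.AtPrime L q] (φ : S →+* L)
    (hφ : ∀ a, φ (algebraMap A S a) = algebraMap R L (π a))
    (dS : Fin N → Der S) (hdS : ∀ i b, dS i (algebraMap _ _ b) = algebraMap _ _ (d i b))
    (δ' : Fin r → Der L) (hδ' : ∀ i b, δ' i (algebraMap _ _ b) = algebraMap _ _ (δ i b))
    (D : Der S) (D' : Der L) (hDD : ∀ a, D' (φ a) = φ (D a))
    (hD : D ∈ Submodule.span S (Set.range dS)) :
    D' ∈ Submodule.span L (Set.range δ') := by
  classical
  obtain ⟨s, rfl⟩ := (Submodule.mem_span_range_iff_exists_fun S).1 hD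
  obtain ⟨σ, hσ⟩ := IsLocalization.exist_integer_multiples_of_finite Q.primeCompl s
  choose a ha using hσ
  have ha' : ∀ i, algebraMap A S (a i) = algebraMap A S σ * s i := fun i => by
    rw [ha i, Algebra.smul_def]
  have hDf : ∀ f, φ (algebraMap A S σ * (∑ i, s i • dS i : Der S) (algebraMap A S f)) =
      algebraMap R L (π (∑ i, a i * d i f)) := by
    intro f
    rw [← hφ, der_sum_apply, map_sum (algebraMap A S), Finset.mul_sum]
    congr 1
    refine Finset.sum_congr rfl fun i _ => ?_
    rw [hdS, map_mul, ha']; ring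
  have h1 : ∀ f, π f = 0 → ∃ τ, τ ∉ Q ∧ π (τ * ∑ i, a i * d i f) = 0 := by
    intro f hf
    have h0 : algebraMap R L (π (∑ i, a i * d i f)) = 0 := by
      rw [← hDf, map_mul, ← hDD, hφ f, hf, map_zero, der_zero, mul_zero]
    obtain ⟨⟨m, hm⟩, hm2⟩ := (IsLocalization.map_eq_zero_iff q.primeCompl L _).1 h0
    obtain ⟨τ, rfl⟩ := hπ m
    refine ⟨τ, fun h => hm (by rw [hQ] at h; exact h), by rw [map_mul]; exact hm2⟩
  obtain ⟨G, hG⟩ := IsNoetherian.noetherian (RingHom.ker π)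
  have hGk : ∀ f ∈ G, π f = 0 := fun f hf => by
    have : f ∈ RingHom.ker π := by rw [← hG]; exact Submodule.subset_span hf
    exact this
  have h1' : ∀ f, ∃ τ, τ ∉ Q ∧ (f ∈ G → π (τ * ∑ i, a i * d i f) = 0) := by
    intro f
    by_cases hf : f ∈ G
    · obtain ⟨τ, h, h'⟩ := h1 f (hGk f hf); exact ⟨τ, h, fun _ => h'⟩
    · exact ⟨1, (Ideal.ne_top_iff_one _).1 (Ideal.IsPrime.ne_top ‹_›), fun h => absurd h hf⟩
  choose T hT1 hT2 using h1'
  let τ := ∏ f ∈ G, T f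
  have hτQ : τ ∉ Q := fun h => by
    obtain ⟨f, -, hf⟩ := (Ideal.IsPrime.prod_mem_iff).1 h
    exact hT1 f hf
  have hmem : (fun i => τ * a i) ∈ gmod π d := by
    intro f hf
    have hf' : f ∈ RingHom.ker π := hf
    rw [← hG] at hf'
    clear hf
    simp only [mul_assoc, ← Finset.mul_sum]
    induction hf' using Submodule.span_induction with
    | mem f hf =>
      obtain ⟨c, hc⟩ := Finset.dvd_prod_of_mem T hf
      change τ = _ at hc
      rw [hc, mul_assoc, mul_left_comm, map_mul, hT2 f hf, mul_zero]
    | zero => simp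
    | add x y _ _ hx hy =>
      simp only [der_add, mul_add, Finset.sum_add_distrib, map_add] at hx hy ⊢
      rw [hx, hy, add_zero]
    | smul c x hx h =>
      have hx0 : π x = 0 := by
        have : x ∈ RingHom.ker π := by rw [← hG]; exact hx
        exact this
      have : ∑ i, a i * d i (c • x) = c * ∑ i, a i * d i x + x * ∑ i, a i * d i c := by
        simp only [smul_eq_mul, der_mul, mul_add, Finset.sum_add_distrib, Finset.mul_sum]
        congr 1 <;> exact Finset.sum_congr rfl fun i _ => by ring
      rw [this, mul_add, map_add, mul_left_comm, map_mul, h, mul_left_comm, map_mul, hx0]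
      simp
  rw [← hv, Submodule.mem_span_range_iff_exists_fun] at hmem
  obtain ⟨e, he⟩ := hmem
  have hkey : φ (algebraMap A S (τ * σ)) • D' = ∑ l, algebraMap R L (π (e l)) • δ' l := by
    apply der_localization_unique q.primeCompl
    intro b
    obtain ⟨f, rfl⟩ := hπ b
    rw [der_sum_apply]
    change φ (algebraMap A S (τ * σ)) * D' _ = _
    rw [← hφ f, hDD, ← map_mul, map_mul (algebraMap A S), mul_assoc, map_mul, hDf, hφ, ← map_mul, ← map_mul]
    simp only [hφ, hδ', hδ]
    simp only [← map_mul, ← map_sum]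
    congr 2
    have : ∀ i, τ * a i = ∑ l, e l * v l i := fun i => by
      have := congrFun he i
      simpa using this.symm
    rw [Finset.mul_sum]
    simp only [← mul_assoc, this, Finset.mul_sum, Finset.sum_mul]
    rw [Finset.sum_comm]
  have hu : IsUnit (φ (algebraMap A S (τ * σ))) := by
    apply IsUnit.map
    exact IsLocalization.map_units (M := Q.primeCompl) S ⟨τ * σ, Q.primeCompl.mul_mem hτQ σ.2⟩
  obtain ⟨U, hU⟩ := hu
  have : D' = (↑U⁻¹ : L) • ∑ l, algebraMap R L (π (e l)) • δ' l := by
    rw [← hkey, ← hU, smul_smul, Units.inv_mul, one_smul]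
  rw [this]
  exact Submodule.smul_mem _ _ (Submodule.sum_mem _ fun l _ =>
    Submodule.smul_mem _ _ (Submodule.subset_span ⟨l, rfl⟩))
end

lemma loc_data_aux {A R S L : Type u} [CommRing A] [CommRing R] [CommRing S] [CommRing L]
    [Algebra A S] [Algebra R L] [IsNoetherianRing A] [IsNoetherianRing R]
    (hunit : ∀ n : ℕ, n ≠ 0 → IsUnit (n : A)) (π : A →+* R) (hπ : Function.Surjective π)
    {N : ℕ} (d : Fin N → Der A) (hcomm : ∀ i j a, d i (d j a) = d j (d i a)) (x : Fin N → A)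
    (hx : ∀ i j, d i (x j) = if i = j then 1 else 0)
    (hJP : ∀ Q : Ideal A, Q.IsPrime → JP d Q)
    {r : ℕ} (v : Fin r → (Fin N → A)) (δ : Fin r → Der R)
    (hv : Submodule.span A (Set.range v) = gmod π d)
    (hδ : ∀ l f, δ l (π f) = π (∑ i, v l i * d i f))
    (q : Ideal R) [q.IsPrime]
    (Q : Ideal A) [Q.IsPrime] (hQ : Q = q.comap π) [IsLocalRing S] [IsLocalRing L]
    [IsLocalization.AtPrime S Q] [IsLocalization.AtPrime L q] (φ : S →+* L)
    (hφ : ∀ a, φ (algebraMap A S a) = algebraMap R L (π a))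
    (t : Finset L)
    (ht : Ideal.span (t : Set L) = IsLocalRing.maximalIdeal L)
    (hcard : (t.card : WithBot ℕ∞) = ringKrullDim L) :
    ∃ (b : ℕ) (u : Fin b → L) (D' : Fin b → Der L) (δ' : Fin r → Der L),
      (∀ i j a, D' i (D' j a) = D' j (D' i a)) ∧ (∀ i j, D' i (u j) = if i = j then 1 else 0) ∧
      IsLocalRing.maximalIdeal L = Ideal.span (Set.range u) ∧
      (∀ i b, δ' i (algebraMap _ _ b) = algebraMap _ _ (δ i b)) ∧
      (∀ i, D' i ∈ Submodule.span L (Set.range δ')) := by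
  haveI : IsNoetherianRing S := IsLocalization.isNoetherianRing Q.primeCompl S inferInstance
  haveI : IsNoetherianRing L := IsLocalization.isNoetherianRing q.primeCompl L inferInstance
  obtain ⟨dS, h1, h2, h3, h4⟩ := loc_ext d hcomm x hx Q (hJP Q ‹_›) (S := S)
  obtain ⟨b, u, D, D', k1, k2, k3, k4, k5⟩ := reg_quot (fun n hn => by
      simpa using (hunit n hn).map (algebraMap A S)) dS h2 (fun i => algebraMap A S (x i)) h3 h4 φ
      (loc_surj π hπ q Q hQ φ hφ) t ht hcard
  choose δ' hδ' using fun i => exists_der_localization (S := L) q.primeCompl (δ i)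
  exact ⟨b, u, D', δ', k3, k4, k5, hδ', fun i =>
    span_descend π hπ d v δ hv hδ q Q hQ φ hφ dS h1 δ' hδ' (D i) (D' i) (k2 i) (k1 i)⟩

/-- existence of Bernstein-type functional equations -/
lemma exists_bfun {A R : Type u} [CommRing A] [CommRing R] (hA : Good A)
    (π : A →+* R) (hπ : Function.Surjective π) (hN : IsNoetherianRing R)
    (hreg : ∀ (q : Ideal R) [q.IsPrime], ∃ t : Finset (Localization.AtPrime q),
      Ideal.span (t : Set (Localization.AtPrime q)) = IsLocalRing.maximalIdeal _ ∧
      (t.card : WithBot ℕ∞) = ringKrullDim (Localization.AtPrime q)) :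
    ∃ (r : ℕ) (δ : Fin r → Der R),
      (∃ c : Fin r → Fin r → Fin r → R, ∀ i j a, δ i (δ j a) - δ j (δ i a) = ∑ l, c i j l * δ l a) ∧
      ∀ g : R, ∃ B : Polynomial ℤ, B ≠ 0 ∧ ∃ N, B.map (Int.castRingHom R) * Polynomial.C g ^ N ∈
        EN (fun i => polyDer (δ i)) (Polynomial.C g) Polynomial.X (N + 1) := by
  obtain ⟨hnA, hunit, N, d, x, hcomm, hx, hJP⟩ := hA
  obtain ⟨r, v, δ, hv, hδ, hc⟩ := exists_delta π hπ d hcomm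
  refine ⟨r, δ, hc, fun g => bf_global δ g ?_⟩
  intro q hq
  obtain ⟨t, ht, hcard⟩ := hreg q
  haveI hQp : (q.comap π).IsPrime := Ideal.comap_isPrime π q
  obtain ⟨b, u, D', δ', h1, h2, h3, h4, h5⟩ := loc_data_aux (S := Localization.AtPrime (q.comap π))
    (L := Localization.AtPrime q) hunit π hπ d hcomm x hx hJP v δ hv hδ q (q.comap π) rfl
    (Localization.localRingHom (q.comap π) q π rfl)
    (fun a => Localization.localRingHom_to_map _ _ _ _ a) t ht hcard
  have hu : ∀ n : ℕ, n ≠ 0 → IsUnit (n : Localization.AtPrime q) := fun n hn => by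
    simpa using ((hunit n hn).map π).map (algebraMap R (Localization.AtPrime q))
  haveI := charZero_residue hu
  have hP : PSb (IsLocalRing.ResidueField (Localization.AtPrime q)) b := psb_all b _
  exact bf_local δ g q ⟨u, D', h1, h2, h3, δ', h4, h5⟩ hP

end BSLC

namespace BSLC

/-- modules over the algebra generated by `R` and a family of derivations closed under brackets -/
structure DStr {R ι : Type*} [CommRing R] [Fintype ι] (δ : ι → Der R) (c : ι → ι → ι → R)
    (M : Type*) [AddCommGroup M] [Module R M] where
  op : ι → M →+ M
  leib : ∀ i (a : R) m, op i (a • m) = a • op i m + δ i a • m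
  br : ∀ i j m, op i (op j m) - op j (op i m) = ∑ l, c i j l • op l m

section
variable {R ι : Type*} [CommRing R] [Fintype ι] {δ : ι → Der R} {c : ι → ι → ι → R}
  {M M' M'' : Type*} [AddCommGroup M] [Module R M] [AddCommGroup M'] [Module R M']
  [AddCommGroup M''] [Module R M'']

/-- stable submodules -/
def DStr.Stable (s : DStr δ c M) (N : Submodule R M) : Prop := ∀ i, ∀ m ∈ N, s.op i m ∈ N

/-- ascending chain condition on stable submodules -/
def DStr.Noeth (s : DStr δ c M) : Prop :=
  ∀ f : ℕ →o Submodule R M, (∀ n, s.Stable (f n)) → ∃ n, ∀ m, n ≤ m → f n = f m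

/-- the trivial structure -/
def DStr.self (h : ∀ i j a, δ i (δ j a) - δ j (δ i a) = ∑ l, c i j l * δ l a) : DStr δ c R where
  op i := (δ i : R →+ R)
  leib i a m := by
    change δ i (a * m) = a * δ i m + δ i a * m
    rw [der_mul, mul_comm m]
  br i j m := h i j m

/-- zero structure -/
def DStr.punit : DStr δ c (PUnit : Type _) where
  op i := 0
  leib i a m := rfl
  br i j m := rfl

/-- product structure -/
def DStr.prod (s : DStr δ c M) (s' : DStr δ c M') : DStr δ c (M × M') where
  op i := (s.op i).prodMap (s'.op i)
  leib i a m := by ext <;> simp [s.leib, s'.leib]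
  br i j m := by
    ext
    · simp [s.br, Prod.fst_sum]
    · simp [s'.br, Prod.snd_sum]

/-- linear maps commuting with the operators -/
def DLin (s : DStr δ c M) (s' : DStr δ c M') (f : M →ₗ[R] M') : Prop :=
  ∀ i m, f (s.op i m) = s'.op i (f m)

lemma DStr.Noeth.of_injective {s : DStr δ c M} {s' : DStr δ c M'} (h : s'.Noeth) (f : M →ₗ[R] M')
    (hf : DLin s s' f) (hinj : Function.Injective f) : s.Noeth := by
  intro N hN
  obtain ⟨n, hn⟩ := h ⟨fun n => (N n).map f, fun a b hab => Submodule.map_mono (N.mono hab)⟩ (by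
    rintro n i _ ⟨m, hm, rfl⟩
    exact ⟨s.op i m, hN n i m hm, hf i m⟩)
  exact ⟨n, fun m hm => Submodule.map_injective_of_injective hinj (hn m hm)⟩

lemma DStr.Noeth.of_surjective {s : DStr δ c M} {s' : DStr δ c M'} (h : s.Noeth) (f : M →ₗ[R] M')
    (hf : DLin s s' f) (hsurj : Function.Surjective f) : s'.Noeth := by
  intro N hN
  obtain ⟨n, hn⟩ := h ⟨fun n => (N n).comap f, fun a b hab => Submodule.comap_mono (N.mono hab)⟩ (by
    intro n i m hm
    change f (s.op i m) ∈ N n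
    rw [hf]; exact hN n i _ hm)
  exact ⟨n, fun m hm => Submodule.comap_injective_of_surjective hsurj (hn m hm)⟩

lemma DStr.Noeth.punit : (DStr.punit : DStr δ c PUnit).Noeth := by
  intro N hN
  exact ⟨0, fun m _ => Subsingleton.elim _ _⟩

lemma DStr.Noeth.prod {s : DStr δ c M} {s' : DStr δ c M'} (h : s.Noeth) (h' : s'.Noeth) :
    (s.prod s').Noeth := by
  intro N hN
  obtain ⟨n, hn⟩ := h ⟨fun n => (N n).comap (LinearMap.inl R M M'),
    fun a b hab => Submodule.comap_mono (N.mono hab)⟩ (by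
    intro n i m hm
    have := hN n i _ hm
    change (s.op i m, (0 : M')) ∈ N n
    have e : (s.prod s').op i ((LinearMap.inl R M M') m) = (s.op i m, s'.op i 0) := rfl
    rw [e, map_zero] at this
    exact this)
  obtain ⟨n', hn'⟩ := h' ⟨fun n => (N n).map (LinearMap.snd R M M'),
    fun a b hab => Submodule.map_mono (N.mono hab)⟩ (by
    rintro n i _ ⟨m, hm, rfl⟩
    exact ⟨_, hN n i m hm, rfl⟩)
  have key : ∀ a b, n ≤ a → n' ≤ a → a ≤ b → N b ≤ N a := by
    rintro a b h1 h2 h3 ⟨x, y⟩ hxy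
    have h4 : y ∈ (N a).map (LinearMap.snd R M M') := by
      have e1 := hn' a h2
      have e2 := hn' b (h2.trans h3)
      have e3 : (N a).map (LinearMap.snd R M M') = (N b).map (LinearMap.snd R M M') := e1.symm.trans e2
      rw [e3]; exact ⟨_, hxy, rfl⟩
    obtain ⟨⟨x', y'⟩, h5, rfl⟩ := h4
    have h6 : x - x' ∈ (N b).comap (LinearMap.inl R M M') := by
      have := (N b).sub_mem hxy (N.mono h3 h5)
      simpa using this
    have e3 : (N a).comap (LinearMap.inl R M M') = (N b).comap (LinearMap.inl R M M') :=
      (hn a h1).symm.trans (hn b (h1.trans h3))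
    rw [← e3] at h6
    have := (N a).add_mem h6 h5
    simpa using this
  refine ⟨max n n', fun m hm => le_antisymm (N.mono hm) ?_⟩
  exact key _ _ (le_max_left _ _) (le_max_right _ _) hm

/-- sub-structure -/
def DStr.sub (s : DStr δ c M) (N : Submodule R M) (hN : s.Stable N) : DStr δ c N where
  op i :=
    { toFun := fun m => ⟨s.op i m, hN i m m.2⟩
      map_zero' := by ext; simp
      map_add' := fun a b => by ext; simp }
  leib i a m := by ext; simp [s.leib]
  br i j m := by ext; simp [s.br]

/-- quotient structure -/
def DStr.quot (s : DStr δ c M) (N : Submodule R M) (hN : s.Stable N) : DStr δ c (M ⧸ N) where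
  op i := QuotientAddGroup.map N.toAddSubgroup N.toAddSubgroup (s.op i) (fun m hm => hN i m hm)
  leib i a m := by
    obtain ⟨m, rfl⟩ := N.mkQ_surjective m
    exact congrArg N.mkQ (s.leib i a m)
  br i j m := by
    obtain ⟨m, rfl⟩ := N.mkQ_surjective m
    have := congrArg N.mkQ (s.br i j m)
    rw [map_sum] at this
    exact this

lemma DStr.quot_mk (s : DStr δ c M) (N : Submodule R M) (hN : s.Stable N) : DLin s (s.quot N hN) N.mkQ :=
  fun _ _ => rfl

lemma DStr.Noeth.sub {s : DStr δ c M} (h : s.Noeth) (N : Submodule R M) (hN : s.Stable N) :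
    (s.sub N hN).Noeth := h.of_injective N.subtype (fun _ _ => rfl) N.injective_subtype

lemma DStr.Noeth.quot {s : DStr δ c M} (h : s.Noeth) (N : Submodule R M) (hN : s.Stable N) :
    (s.quot N hN).Noeth := h.of_surjective N.mkQ (fun _ _ => rfl) N.mkQ_surjective

end

section Ass
variable {R ι : Type*} [CommRing R] [IsNoetherianRing R] [Fintype ι] {δ : ι → Der R}
  {c : ι → ι → ι → R} {M : Type*} [AddCommGroup M] [Module R M]

/-- primes which are the colon of an element modulo `N` -/
def relAss (N : Submodule R M) : Set (Ideal R) := {P | P.IsPrime ∧ ∃ x, ∀ a, a ∈ P ↔ a • x ∈ N}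

/-- annihilator primes of elements of `N` -/
def assOn (N : Submodule R M) : Set (Ideal R) := {P | P.IsPrime ∧ ∃ x ∈ N, ∀ a : R, a ∈ P ↔ a • x = 0}

lemma relAss_nonempty (N : Submodule R M) (hN : N ≠ ⊤) : (relAss N).Nonempty := by
  let col : M → Ideal R := fun x => N.comap (LinearMap.toSpanSingleton R M x)
  have hcol : ∀ x a, a ∈ col x ↔ a • x ∈ N := fun x a => Iff.rfl
  obtain ⟨y, hy⟩ : ∃ y, y ∉ N := by
    by_contra h; push Not at h; exact hN (eq_top_iff.2 fun x _ => h x)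
  obtain ⟨P, ⟨x, hx, rfl⟩, hmax⟩ := set_has_maximal_iff_noetherian.2 ‹IsNoetherianRing R›
    {P | ∃ x, x ∉ N ∧ P = col x} ⟨col y, y, hy, rfl⟩
  refine ⟨col x, ⟨?_, ?_⟩, x, hcol x⟩
  · rw [Ideal.ne_top_iff_one, hcol, one_smul]; exact hx
  · intro a b hab
    by_contra h
    push Not at h
    refine hmax (col (b • x)) ⟨b • x, fun h' => h.2 h', rfl⟩ ?_
    refine lt_of_le_of_ne ?_ ?_
    · intro r hr
      rw [hcol] at hr ⊢
      rw [smul_comm]; exact N.smul_mem _ hr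
    · intro e
      apply h.1
      rw [e, hcol, smul_smul]
      exact hab

lemma DStr.Noeth.finite_ass {s : DStr δ c M} (h : s.Noeth) :
    {P : Ideal R | P.IsPrime ∧ ∃ x : M, ∀ a : R, a ∈ P ↔ a • x = 0}.Finite := by
  classical
  let 𝒮 : Set {N : Submodule R M // s.Stable N} := {N | (assOn N.1).Finite}
  have hwf : WellFoundedGT {N : Submodule R M // s.Stable N} := by
    rw [wellFoundedGT_iff_monotone_chain_condition]
    intro f
    obtain ⟨n, hn⟩ := h ⟨fun n => (f n).1, fun a b hab => f.mono hab⟩ (fun n => (f n).2)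
    exact ⟨n, fun m hm => Subtype.ext (hn m hm)⟩
  have hne : 𝒮.Nonempty := by
    refine ⟨⟨⊥, ?_⟩, ?_⟩
    · intro i m hm
      rw [Submodule.mem_bot] at hm ⊢; rw [hm, map_zero]
    · refine Set.Finite.subset Set.finite_empty ?_
      rintro P ⟨hP, x, hx, hx'⟩
      rw [Submodule.mem_bot] at hx
      exact hP.ne_top (by rw [Ideal.eq_top_iff_one, hx', hx, smul_zero])
  obtain ⟨⟨N, hN⟩, hfin, hmax⟩ := hwf.wf.has_min 𝒮 hne
  change (assOn N).Finite at hfin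
  by_cases htop : N = ⊤
  · subst htop
    refine hfin.subset ?_
    rintro P ⟨hP, x, hx⟩
    exact ⟨hP, x, trivial, hx⟩
  exfalso
  obtain ⟨q, hq, hqmax⟩ := set_has_maximal_iff_noetherian.2 ‹IsNoetherianRing R› _ (relAss_nonempty N htop)
  let N' : Submodule R M :=
    { carrier := {x | ∃ k : ℕ, ∀ a ∈ q ^ k, a • x ∈ N}
      zero_mem' := ⟨0, fun a _ => by rw [smul_zero]; exact zero_mem _⟩
      add_mem' := by
        rintro x y ⟨k, hk⟩ ⟨l, hl⟩
        refine ⟨k + l, fun a ha => ?_⟩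
        rw [smul_add]
        exact add_mem (hk a (Ideal.pow_le_pow_right (by omega) ha)) (hl a (Ideal.pow_le_pow_right (by omega) ha))
      smul_mem' := by
        rintro r x ⟨k, hk⟩
        exact ⟨k, fun a ha => by rw [smul_comm]; exact N.smul_mem _ (hk a ha)⟩ }
  have hN' : s.Stable N' := by
    rintro i x ⟨k, hk⟩
    refine ⟨k + 1, fun a ha => ?_⟩
    have h1 : a • s.op i x = s.op i (a • x) - δ i a • x := by rw [s.leib]; abel
    rw [h1]
    exact sub_mem (hN i _ (hk a (Ideal.pow_le_pow_right (by omega) ha))) (hk _ (der_pow_mem _ _ _ _ ha))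
  have hle : N ≤ N' := fun x hx => ⟨0, fun a _ => N.smul_mem _ hx⟩
  obtain ⟨hqp, x, hx⟩ := hq
  have hlt : N < N' := by
    refine lt_of_le_of_ne hle ?_
    intro e
    have hxN : x ∈ N := by
      rw [e]; exact ⟨1, fun a ha => by rw [pow_one] at ha; exact (hx a).1 ha⟩
    exact hqp.ne_top (by rw [Ideal.eq_top_iff_one, hx, one_smul]; exact hxN)
  refine hmax ⟨N', hN'⟩ ?_ hlt
  change (assOn N').Finite
  refine (hfin.union (Set.finite_singleton q)).subset ?_
  rintro P ⟨hP, y, ⟨k, hk⟩, hy⟩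
  by_cases hPN : P ∈ assOn N
  · exact Or.inl hPN
  right
  have h1 : ∀ a, a ∈ P ↔ a • y ∈ N := by
    intro a
    constructor
    · intro ha; rw [(hy a).1 ha]; exact zero_mem _
    · intro ha
      by_contra haP
      refine hPN ⟨hP, a • y, ha, fun b => ?_⟩
      rw [smul_smul, ← hy]
      exact ⟨fun hb => P.mul_mem_right _ hb, fun hb => (hP.mem_or_mem hb).resolve_right haP⟩
  have h2 : q ≤ P := hP.le_of_pow_le (n := k) (fun a ha => (h1 a).2 (hk a ha))
  by_contra hne
  exact hqmax P ⟨hP, y, h1⟩ (lt_of_le_of_ne h2 (fun e => hne (by rw [Set.mem_singleton_iff, e])))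
end Ass
end BSLC

namespace BSLC

section Cyc
variable {R ι : Type*} [CommRing R] [Fintype ι] {δ : ι → Der R}
  {c : ι → ι → ι → R} {M : Type*} [AddCommGroup M] [Module R M] (s : DStr δ c M) (m₀ : M)

/-- order filtration, shifted by one -/
def DStr.G : ℕ → Submodule R M
  | 0 => ⊥
  | k + 1 => Submodule.span R ({m₀} ∪ (DStr.G k : Set M) ∪ {x | ∃ i, ∃ y ∈ DStr.G k, x = s.op i y})

lemma DStr.G_le (k : ℕ) : s.G m₀ k ≤ s.G m₀ (k + 1) := fun x hx => by
  rw [DStr.G]; exact Submodule.subset_span (Or.inl (Or.inr hx))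

lemma DStr.m₀_mem (k : ℕ) : m₀ ∈ s.G m₀ (k + 1) := by
  rw [DStr.G]; exact Submodule.subset_span (Or.inl (Or.inl rfl))

lemma DStr.op_mem (k : ℕ) (i : ι) (y : M) (hy : y ∈ s.G m₀ k) : s.op i y ∈ s.G m₀ (k + 1) := by
  rw [DStr.G]; exact Submodule.subset_span (Or.inr ⟨i, y, hy, rfl⟩)

lemma DStr.G_mono : Monotone (s.G m₀) := monotone_nat_of_le_succ (s.G_le m₀)

/-- iterated operators applied to the generator -/
def DStr.wd : List ι → M
  | [] => m₀
  | i :: l => s.op i (DStr.wd l)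

lemma DStr.wd_mem (l : List ι) : s.wd m₀ l ∈ s.G m₀ (l.length + 1) := by
  induction l with
  | nil => exact s.m₀_mem m₀ 0
  | cons i l ih => exact s.op_mem m₀ _ i _ ih

lemma DStr.wd_perm {l l' : List ι} (h : l.Perm l') : s.wd m₀ l - s.wd m₀ l' ∈ s.G m₀ l.length := by
  induction h with
  | nil => simp
  | cons i h ih =>
    rw [DStr.wd, DStr.wd, ← map_sub]
    exact s.op_mem m₀ _ i _ ih
  | swap i j l =>
    rw [DStr.wd, DStr.wd, DStr.wd, DStr.wd, s.br]
    refine sum_mem fun k _ => Submodule.smul_mem _ _ (s.op_mem m₀ _ _ _ (s.wd_mem m₀ l))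
  | trans h1 h2 ih1 ih2 =>
    rw [← h1.length_eq] at ih2
    simpa using add_mem ih1 ih2

/-- standard words -/
noncomputable def DStr.ew (α : ι →₀ ℕ) : M := s.wd m₀ (Finsupp.toMultiset α).toList

lemma len_toList (α : ι →₀ ℕ) : (Finsupp.toMultiset α).toList.length = α.degree := by
  rw [Multiset.length_toList, Finsupp.card_toMultiset]; rfl

lemma DStr.ew_mem (α : ι →₀ ℕ) : s.ew m₀ α ∈ s.G m₀ (α.degree + 1) := by
  have := s.wd_mem m₀ (Finsupp.toMultiset α).toList
  rwa [len_toList] at this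

lemma DStr.op_ew (i : ι) (α : ι →₀ ℕ) :
    s.op i (s.ew m₀ α) - s.ew m₀ (Finsupp.single i 1 + α) ∈ s.G m₀ (α.degree + 1) := by
  have : (i :: (Finsupp.toMultiset α).toList).Perm (Finsupp.toMultiset (Finsupp.single i 1 + α)).toList := by
    rw [← Multiset.coe_eq_coe, Multiset.coe_toList, ← Multiset.cons_coe, Multiset.coe_toList, map_add]
    simp
  have h := s.wd_perm m₀ this
  rw [List.length_cons, len_toList] at h
  exact h

/-- evaluation of symbols -/
noncomputable def DStr.ev : MvPolynomial ι R →ₗ[R] M := Finsupp.linearCombination R (s.ew m₀) ∘ₗ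
  (MvPolynomial.basisMonomials ι R).repr.toLinearMap

lemma DStr.ev_monomial (α : ι →₀ ℕ) (a : R) : s.ev m₀ (MvPolynomial.monomial α a) = a • s.ew m₀ α := by
  have h : MvPolynomial.monomial α a = a • MvPolynomial.basisMonomials ι R α := by
    rw [MvPolynomial.coe_basisMonomials, MvPolynomial.smul_monomial, smul_eq_mul, mul_one]
  rw [h, map_smul, DStr.ev, LinearMap.comp_apply, LinearEquiv.coe_coe, Module.Basis.repr_self]
  simp

lemma DStr.ev_mem (k : ℕ) (p : MvPolynomial ι R) (hp : p.IsHomogeneous k) : s.ev m₀ p ∈ s.G m₀ (k + 1) := by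
  rw [← MvPolynomial.support_sum_monomial_coeff p, map_sum]
  refine sum_mem fun α hα => ?_
  rw [s.ev_monomial]
  have : α.degree = k := hp.degree_eq_sum_deg_support hα |>.symm
  rw [← this]
  exact Submodule.smul_mem _ _ (s.ew_mem m₀ α)

lemma DStr.ev_X (k : ℕ) (i : ι) (p : MvPolynomial ι R) (hp : p.IsHomogeneous k) :
    s.op i (s.ev m₀ p) - s.ev m₀ (MvPolynomial.X i * p) ∈ s.G m₀ (k + 1) := by
  rw [← MvPolynomial.support_sum_monomial_coeff p, map_sum, map_sum, Finset.mul_sum, map_sum,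
    ← Finset.sum_sub_distrib]
  refine sum_mem fun α hα => ?_
  have hd : α.degree = k := hp.degree_eq_sum_deg_support hα |>.symm
  rw [s.ev_monomial, s.leib, MvPolynomial.X, MvPolynomial.monomial_mul, one_mul, s.ev_monomial, ← hd]
  have h1 := Submodule.smul_mem _ (p.coeff α) (s.op_ew m₀ i α)
  have h2 := Submodule.smul_mem _ (δ i (p.coeff α)) (s.ew_mem m₀ α)
  have := add_mem h1 h2
  rw [smul_sub] at this
  convert this using 1
  abel

lemma DStr.G_decomp (k : ℕ) (x : M) (hx : x ∈ s.G m₀ (k + 1)) :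
    ∃ p : MvPolynomial ι R, p.IsHomogeneous k ∧ x - s.ev m₀ p ∈ s.G m₀ k := by
  induction k generalizing x with
  | zero =>
    rw [DStr.G] at hx
    have : ({m₀} ∪ (s.G m₀ 0 : Set M) ∪ {x | ∃ i, ∃ y ∈ s.G m₀ 0, x = s.op i y}) ⊆ Submodule.span R {m₀} := by
      rintro y ((hy | hy) | ⟨i, z, hz, rfl⟩)
      · exact Submodule.subset_span hy
      · rw [DStr.G] at hy; rw [(Submodule.mem_bot R).1 hy]; exact zero_mem _
      · rw [DStr.G] at hz; rw [(Submodule.mem_bot R).1 hz, map_zero]; exact zero_mem _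
    have hx' := Submodule.span_le.2 this hx
    obtain ⟨a, rfl⟩ := Submodule.mem_span_singleton.1 hx'
    refine ⟨MvPolynomial.monomial 0 a, MvPolynomial.isHomogeneous_monomial _ (by simp), ?_⟩
    rw [s.ev_monomial]
    have : s.ew m₀ 0 = m₀ := by simp [DStr.ew, DStr.wd]
    rw [this, sub_self]; exact zero_mem _
  | succ k ih =>
    rw [DStr.G] at hx
    induction hx using Submodule.span_induction with
    | mem x hx =>
      rcases hx with (hx | hx) | ⟨i, y, hy, rfl⟩
      · refine ⟨0, MvPolynomial.isHomogeneous_zero _ _ _, ?_⟩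
        rw [Set.mem_singleton_iff.1 hx, map_zero, sub_zero]; exact s.m₀_mem m₀ k
      · exact ⟨0, MvPolynomial.isHomogeneous_zero _ _ _, by rw [map_zero, sub_zero]; exact hx⟩
      · obtain ⟨p, hp, h⟩ := ih y hy
        refine ⟨MvPolynomial.X i * p, ?_, ?_⟩
        · rw [add_comm]; exact (MvPolynomial.isHomogeneous_X _ _).mul hp
        · have h1 := s.op_mem m₀ _ i _ h
          have h2 := s.ev_X m₀ k i p hp
          have := add_mem h1 h2
          rw [map_sub] at this
          simpa using this
    | zero => exact ⟨0, MvPolynomial.isHomogeneous_zero _ _ _, by simp⟩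
    | add x y _ _ hx hy =>
      obtain ⟨p, hp, h⟩ := hx
      obtain ⟨p', hp', h'⟩ := hy
      refine ⟨p + p', hp.add hp', ?_⟩
      have := add_mem h h'
      rw [map_add]; convert this using 1; abel
    | smul a x _ hx =>
      obtain ⟨p, hp, h⟩ := hx
      refine ⟨a • p, ?_, ?_⟩
      · exact (MvPolynomial.homogeneousSubmodule ι R (k+1)).smul_mem a hp
      · rw [map_smul, ← smul_sub]; exact Submodule.smul_mem _ _ h

/-- symbol ideal of a stable submodule -/
noncomputable def DStr.symb (N : Submodule R M) (hN : s.Stable N) : Ideal (MvPolynomial ι R) where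
  carrier := {p | ∀ k, s.ev m₀ (MvPolynomial.homogeneousComponent k p) ∈ N ⊔ s.G m₀ k}
  zero_mem' := by intro k; simp
  add_mem' := by
    intro p q hp hq k
    rw [map_add, map_add]; exact add_mem (hp k) (hq k)
  smul_mem' := by
    intro q p hp
    rw [smul_eq_mul]
    induction q using MvPolynomial.induction_on generalizing p with
    | C a =>
      intro k
      rw [MvPolynomial.C_mul', map_smul, map_smul]; exact Submodule.smul_mem _ _ (hp k)
    | add q q' h h' =>
      intro k
      rw [add_mul, map_add, map_add]; exact add_mem (h hp k) (h' hp k)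
    | mul_X q i h =>
      rw [mul_assoc]
      apply h
      intro k
      cases k with
      | zero =>
        have : MvPolynomial.homogeneousComponent 0 (MvPolynomial.X i * p) = 0 := by
          classical
          rw [MvPolynomial.homogeneousComponent_zero, mul_comm]; simp [MvPolynomial.coeff_mul_X']
        rw [this, map_zero]; exact zero_mem _
      | succ k =>
        have : MvPolynomial.homogeneousComponent (k + 1) (MvPolynomial.X i * p) =
            MvPolynomial.X i * MvPolynomial.homogeneousComponent k p := by
          classical
          ext α
          rw [MvPolynomial.coeff_homogeneousComponent, MvPolynomial.coeff_X_mul', MvPolynomial.coeff_X_mul']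
          split_ifs with h1 h2 h3
          · rw [MvPolynomial.coeff_homogeneousComponent, if_pos]
            have h4 : α = Finsupp.single i 1 + (α - Finsupp.single i 1) := by
              rw [add_tsub_cancel_of_le]
              rw [Finsupp.single_le_iff]
              exact Nat.one_le_iff_ne_zero.2 (Finsupp.mem_support_iff.1 h2)
            rw [h4, map_add, Finsupp.degree_single] at h1
            omega
          · rfl
          · rw [MvPolynomial.coeff_homogeneousComponent, if_neg]
            have h4 : α = Finsupp.single i 1 + (α - Finsupp.single i 1) := by
              rw [add_tsub_cancel_of_le]
              rw [Finsupp.single_le_iff]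
              exact Nat.one_le_iff_ne_zero.2 (Finsupp.mem_support_iff.1 h3)
            rw [h4, map_add, Finsupp.degree_single] at h1
            omega
          · rfl
        rw [this]
        have h1 := s.ev_X m₀ k i _ (MvPolynomial.homogeneousComponent_isHomogeneous k p)
        have h2 : s.op i (s.ev m₀ (MvPolynomial.homogeneousComponent k p)) ∈ N ⊔ s.G m₀ (k + 1) := by
          obtain ⟨y, hy, z, hz, e⟩ := Submodule.mem_sup.1 (hp k)
          rw [← e, map_add]
          exact add_mem (Submodule.mem_sup_left (hN i y hy)) (Submodule.mem_sup_right (s.op_mem m₀ _ _ _ hz))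
        have := sub_mem h2 (Submodule.mem_sup_right (S := N) h1)
        simpa using this

lemma DStr.cyclic_noeth [IsNoetherianRing R]
    (hgen : ∀ N : Submodule R M, s.Stable N → m₀ ∈ N → N = ⊤) : s.Noeth := by
  intro N hN
  haveI : IsNoetherianRing (MvPolynomial ι R) := inferInstance
  obtain ⟨n, hn⟩ := monotone_stabilizes_iff_noetherian.2 this
    ⟨fun n => s.symb m₀ (N n) (hN n), fun a b hab p hp k =>
      sup_le_sup_right (N.mono hab) _ (hp k)⟩
  refine ⟨n, fun m hm => le_antisymm (N.mono hm) ?_⟩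
  have hsy : s.symb m₀ (N n) (hN n) = s.symb m₀ (N m) (hN m) := hn m hm
  have key : ∀ k x, x ∈ N m → x ∈ s.G m₀ k → x ∈ N n := by
    intro k
    induction k with
    | zero => intro x _ hx; rw [DStr.G] at hx; rw [(Submodule.mem_bot R).1 hx]; exact zero_mem _
    | succ k ih =>
      intro x hx hxG
      obtain ⟨p, hp, h⟩ := s.G_decomp m₀ k x hxG
      have h1 : p ∈ s.symb m₀ (N m) (hN m) := by
        intro l
        by_cases hl : l = k
        · subst hl
          rw [MvPolynomial.homogeneousComponent_of_mem hp, if_pos rfl]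
          have e : s.ev m₀ p = x - (x - s.ev m₀ p) := by abel
          rw [e]
          exact sub_mem (Submodule.mem_sup_left hx) (Submodule.mem_sup_right h)
        · rw [MvPolynomial.homogeneousComponent_of_mem hp, if_neg (by omega), map_zero]; exact zero_mem _
      rw [← hsy] at h1
      have h2 := h1 k
      rw [MvPolynomial.homogeneousComponent_of_mem hp, if_pos rfl] at h2
      obtain ⟨y, hy, z, hz, e⟩ := Submodule.mem_sup.1 h2
      have h3 : x - y ∈ N n := by
        refine ih _ (sub_mem hx (N.mono hm hy)) ?_
        have := add_mem h hz
        rw [← e] at this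
        convert this using 1; abel
      simpa using add_mem h3 hy
  have htop : (⨆ k, s.G m₀ k) = ⊤ := by
    have hmem : ∀ x, x ∈ (⨆ k, s.G m₀ k) ↔ ∃ k, x ∈ s.G m₀ k := fun x =>
      Submodule.mem_iSup_of_directed _ (s.G_mono m₀).directed_le
    apply hgen
    · intro i x hx
      obtain ⟨k, hk⟩ := (hmem x).1 hx
      exact (hmem _).2 ⟨k + 1, s.op_mem m₀ k i x hk⟩
    · exact (hmem _).2 ⟨1, s.m₀_mem m₀ 0⟩
  intro x hx
  have : x ∈ (⨆ k, s.G m₀ k) := by rw [htop]; trivial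
  obtain ⟨k, hk⟩ := (Submodule.mem_iSup_of_directed _ (s.G_mono m₀).directed_le).1 this
  exact key k x hx hk
end Cyc
end BSLC

namespace BSLC

section Loc
variable {R ι : Type*} [CommRing R] [Fintype ι] {δ : ι → Der R}
  {c : ι → ι → ι → R} {M M' : Type*} [AddCommGroup M] [Module R M] [AddCommGroup M'] [Module R M']

lemma DStr.exists_loc (s : DStr δ c M) (S : Submonoid R) (f : M →ₗ[R] M') [IsLocalizedModule S f] :
    ∃ s' : DStr δ c M', DLin s s' f := by
  have hinj : ∀ t ∈ S, ∀ x y : M', t • x = t • y → x = y := fun t ht x y h =>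
    IsLocalizedModule.smul_injective f (⟨t, ht⟩ : S) h
  have hsurj : ∀ x : M', ∃ m, ∃ t ∈ S, t • x = f m := fun x => by
    obtain ⟨⟨m, t⟩, h⟩ := IsLocalizedModule.surj S f x
    exact ⟨m, t, t.2, h⟩
  have hdiv : ∀ t ∈ S, ∀ x : M', ∃ y, t • y = x := fun t ht x => by
    obtain ⟨g, hg⟩ := ((Module.End.isUnit_iff _).1 (IsLocalizedModule.map_units f (⟨t, ht⟩ : S))).2 x
    exact ⟨g, hg⟩
  have hex : ∀ i x, ∃ y : M', ∀ m, ∀ t ∈ S, t • x = f m → t • y = f (s.op i m) - δ i t • x := by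
    intro i x
    obtain ⟨m₀, t₀, ht₀, h₀⟩ := hsurj x
    obtain ⟨y, hy⟩ := hdiv t₀ ht₀ (f (s.op i m₀) - δ i t₀ • x)
    refine ⟨y, fun m t ht h => ?_⟩
    have h1 : f (t₀ • m) = f (t • m₀) := by rw [map_smul, map_smul, ← h, ← h₀, smul_comm]
    obtain ⟨⟨e, he⟩, h2⟩ := (IsLocalizedModule.eq_iff_exists S f).1 h1
    have h2' : (e * t₀) • m = (e * t) • m₀ := by rw [mul_smul, mul_smul]; exact h2
    have h3 := congrArg (fun z => f (s.op i z)) h2'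
    simp only [s.leib, map_add, map_smul, ← h, ← h₀, der_mul] at h3
    apply hinj t₀ ht₀
    rw [smul_comm, hy]
    apply hinj e he
    rw [← sub_eq_zero] at h3 ⊢
    rw [← neg_eq_zero, ← h3]
    simp only [add_smul, smul_sub, smul_smul]
    simp only [sub_eq_add_neg, neg_add, neg_neg]
    rw [mul_comm e (t * δ i t₀), mul_comm e (t₀ * δ i t), mul_assoc t, mul_assoc t₀,
      mul_comm (δ i t₀) e, mul_comm (δ i t) e]
    module
  choose F hF using hex
  have huniq : ∀ i x y m t, t ∈ S → t • x = f m → t • y = f (s.op i m) - δ i t • x → F i x = y := by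
    intro i x y m t ht h h'
    apply hinj t ht
    rw [hF i x m t ht h, h']
  have hFf : ∀ i m, F i (f m) = f (s.op i m) := fun i m => by
    apply huniq i _ _ m 1 S.one_mem (one_smul _ _)
    rw [der_one, zero_smul, sub_zero, one_smul]
  have hadd : ∀ i x y, F i (x + y) = F i x + F i y := by
    intro i x y
    obtain ⟨m, t, ht, h⟩ := hsurj x
    obtain ⟨m', t', ht', h'⟩ := hsurj y
    have e1 : (t * t') • x = f (t' • m) := by rw [map_smul, ← h, smul_smul, mul_comm]
    have e2 : (t * t') • y = f (t • m') := by rw [map_smul, ← h', smul_smul]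
    apply huniq i _ _ (t' • m + t • m') (t * t') (S.mul_mem ht ht')
    · rw [smul_add, e1, e2, map_add]
    · rw [smul_add, hF i x _ _ (S.mul_mem ht ht') e1, hF i y _ _ (S.mul_mem ht ht') e2, map_add, map_add,
        smul_add]
      abel
  have hleib : ∀ i (a : R) x, F i (a • x) = a • F i x + δ i a • x := by
    intro i a x
    obtain ⟨m, t, ht, h⟩ := hsurj x
    apply huniq i _ _ (a • m) t ht
    · rw [map_smul, ← h, smul_comm]
    · rw [smul_add, smul_comm t a, hF i x m t ht h, s.leib, map_add, map_smul, map_smul, ← h]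
      module
  let op' : ι → M' →+ M' := fun i => ⟨⟨F i, by have := hFf i 0; simpa using this⟩, hadd i⟩
  refine ⟨⟨op', hleib, ?_⟩, fun i m => (hFf i m).symm⟩
  -- bracket relation
  intro i j x
  change F i (F j x) - F j (F i x) = ∑ l, c i j l • F l x
  obtain ⟨m, t, ht, h⟩ := hsurj x
  -- the difference is R-linear up to the bracket of the derivations on `R`
  have hneg : ∀ i x, F i (-x) = - F i x := fun i x => map_neg (op' i) x
  have hsub : ∀ i x y, F i (x - y) = F i x - F i y := fun i x y => map_sub (op' i) x y
  have hb : ∀ x, F i (F j (t • x)) - F j (F i (t • x)) =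
      t • (F i (F j x) - F j (F i x)) + (δ i (δ j t) - δ j (δ i t)) • x := by
    intro x
    rw [hleib, hleib, hadd, hadd, hleib, hleib, hleib, hleib]
    module
  have hc : (∑ l, c i j l • F l (t • x)) = t • (∑ l, c i j l • F l x) + (∑ l, c i j l * δ l t) • x := by
    rw [Finset.smul_sum, Finset.sum_smul, ← Finset.sum_add_distrib]
    refine Finset.sum_congr rfl fun l _ => ?_
    rw [hleib]; module
  have hE : (δ i (δ j t) - δ j (δ i t)) • m = (∑ l, c i j l * δ l t) • m := by
    have h1 := s.br i j (t • m)
    rw [s.leib, s.leib, map_add, map_add, s.leib, s.leib, s.leib, s.leib] at h1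
    have h2 : (∑ l, c i j l • s.op l (t • m)) =
        t • (∑ l, c i j l • s.op l m) + (∑ l, c i j l * δ l t) • m := by
      rw [Finset.smul_sum, Finset.sum_smul, ← Finset.sum_add_distrib]
      refine Finset.sum_congr rfl fun l _ => ?_
      rw [s.leib]; module
    rw [h2, ← s.br i j m] at h1
    rw [← sub_eq_zero] at h1 ⊢
    rw [← h1]
    module
  have hEx : (δ i (δ j t) - δ j (δ i t)) • x = (∑ l, c i j l * δ l t) • x := by
    apply hinj t ht
    rw [smul_comm, h, smul_comm t, h, ← map_smul, ← map_smul, hE]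
  apply hinj t ht
  have h1 := hb x
  rw [h, hFf, hFf, hFf, hFf, ← map_sub, s.br, map_sum] at h1
  have h3 := hc
  rw [h] at h3
  simp only [hFf, ← map_smul] at h3
  rw [h3, hEx] at h1
  exact (add_right_cancel h1).symm

/-- localized structure -/
noncomputable def DStr.loc (s : DStr δ c M) (S : Submonoid R) : DStr δ c (LocalizedModule S M) :=
  (s.exists_loc S (LocalizedModule.mkLinearMap S M)).choose

lemma DStr.loc_lin (s : DStr δ c M) (S : Submonoid R) :
    DLin s (s.loc S) (LocalizedModule.mkLinearMap S M) :=
  (s.exists_loc S (LocalizedModule.mkLinearMap S M)).choose_spec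

lemma DLin.locMap {s : DStr δ c M} {s' : DStr δ c M'} {f : M →ₗ[R] M'} (hf : DLin s s' f)
    (S : Submonoid R) :
    DLin (s.loc S) (s'.loc S) (IsLocalizedModule.map S (LocalizedModule.mkLinearMap S M)
      (LocalizedModule.mkLinearMap S M') f) := by
  intro i x
  set F := IsLocalizedModule.map S (LocalizedModule.mkLinearMap S M)
      (LocalizedModule.mkLinearMap S M') f with hF
  have hFf : ∀ m, F (LocalizedModule.mkLinearMap S M m) = LocalizedModule.mkLinearMap S M' (f m) :=
    fun m => IsLocalizedModule.map_apply _ _ _ _ _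
  obtain ⟨⟨m, t⟩, h⟩ := IsLocalizedModule.surj S (LocalizedModule.mkLinearMap S M) x
  have h : (t : R) • x = LocalizedModule.mkLinearMap S M m := h
  apply IsLocalizedModule.smul_injective (LocalizedModule.mkLinearMap S M') t
  change (t : R) • F ((s.loc S).op i x) = (t : R) • (s'.loc S).op i (F x)
  have h1 : (t : R) • (s.loc S).op i x = (s.loc S).op i ((t : R) • x) - δ i t • x := by
    rw [(s.loc S).leib]; abel
  have h2 : (t : R) • (s'.loc S).op i (F x) = (s'.loc S).op i ((t : R) • F x) - δ i t • F x := by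
    rw [(s'.loc S).leib]; abel
  rw [← map_smul, h1, h2, map_sub, h, ← s.loc_lin, hFf, hf, ← map_smul F (t : R), h, hFf, map_smul, ← (s'.loc_lin S)]

/-- `M` looks like a localization `R_g` of `R` -/
def LocR (s : DStr δ c M) (g : R) : Prop :=
  ∃ u : ℕ → M, (∀ j, g • u (j + 1) = u j) ∧ Submodule.span R (Set.range u) = ⊤ ∧
    (∀ x y : M, g • x = g • y → x = y) ∧ ∀ i, s.op i (u 0) = 0

lemma LocR.self (h : ∀ i j a, δ i (δ j a) - δ j (δ i a) = ∑ l, c i j l * δ l a) :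
    LocR (DStr.self h) 1 := by
  refine ⟨fun _ => 1, fun j => by simp, ?_, fun x y => by simp, fun i => der_one (δ i)⟩
  rw [eq_top_iff]
  intro x _
  have : x • (1 : R) ∈ Submodule.span R (Set.range fun _ : ℕ => (1 : R)) :=
    Submodule.smul_mem _ _ (Submodule.subset_span ⟨0, rfl⟩)
  simpa using this

lemma LocR.loc {s : DStr δ c M} {g : R} (h : LocR s g) (t : R) :
    LocR (s.loc (Submonoid.powers t)) (g * t) := by
  obtain ⟨u, h1, h2, h3, h4⟩ := h
  let S := Submonoid.powers t
  let η := LocalizedModule.mkLinearMap S M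
  have hinj : ∀ x y : LocalizedModule S M, t • x = t • y → x = y := fun x y h =>
    IsLocalizedModule.smul_injective η (⟨t, Submonoid.mem_powers t⟩ : S) h
  have hdiv : ∀ x : LocalizedModule S M, ∃ y, t • y = x := fun x => by
    obtain ⟨g, hg⟩ := ((Module.End.isUnit_iff _).1
      (IsLocalizedModule.map_units η (⟨t, Submonoid.mem_powers t⟩ : S))).2 x
    exact ⟨g, hg⟩
  have hinjn : ∀ (n : ℕ) (x y : LocalizedModule S M), t ^ n • x = t ^ n • y → x = y := by
    intro n
    induction n with
    | zero => intro x y h; simpa using h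
    | succ n ih => intro x y h; rw [pow_succ, mul_smul, mul_smul] at h; exact hinj _ _ (ih _ _ h)
  choose τ hτ using hdiv
  have hτn : ∀ n x, t ^ n • (τ^[n] x) = x := by
    intro n
    induction n with
    | zero => intro x; simp
    | succ n ih => intro x; rw [pow_succ', mul_smul, Function.iterate_succ_apply, ih, hτ]
  refine ⟨fun j => τ^[j] (η (u j)), ?_, ?_, ?_, ?_⟩
  · intro j
    simp only
    apply hinjn j
    rw [hτn, smul_smul, mul_left_comm, ← pow_succ, mul_smul, hτn, ← map_smul, h1]
  · rw [eq_top_iff]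
    intro x _
    obtain ⟨⟨m, ⟨_, n, rfl⟩⟩, h⟩ := IsLocalizedModule.surj S η x
    have h : t ^ n • x = η m := h
    have hx : x = τ^[n] (η m) := hinjn n _ _ (by rw [h, hτn])
    have hη : ∀ m, ∀ n, τ^[n] (η m) ∈ Submodule.span R (Set.range fun j => τ^[j] (η (u j))) := by
      intro m
      have hm : m ∈ Submodule.span R (Set.range u) := by rw [h2]; trivial
      induction hm using Submodule.span_induction with
      | mem y hy =>
        obtain ⟨j, rfl⟩ := hy
        intro n
        have e1 : ∀ k, u j = g ^ k • u (j + k) := by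
          intro k
          induction k with
          | zero => simp
          | succ k ih => rw [pow_succ, mul_smul, ← add_assoc, h1, ih]
        have : τ^[n] (η (u j)) = (g ^ n * t ^ j) • τ^[j + n] (η (u (j + n))) := by
          apply hinjn n
          rw [hτn, smul_smul, mul_left_comm, ← pow_add, add_comm n j, mul_smul, hτn, ← map_smul, ← e1]
        rw [this]
        exact Submodule.smul_mem _ _ (Submodule.subset_span ⟨j + n, rfl⟩)
      | zero =>
        intro n
        have : τ^[n] (η 0) = 0 := hinjn n _ _ (by rw [hτn]; simp)
        rw [this]; exact zero_mem _
      | add x y _ _ hx hy =>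
        intro n
        have : τ^[n] (η (x + y)) = τ^[n] (η x) + τ^[n] (η y) :=
          hinjn n _ _ (by rw [hτn, smul_add, hτn, hτn, map_add])
        rw [this]; exact add_mem (hx n) (hy n)
      | smul a x _ hx =>
        intro n
        have : τ^[n] (η (a • x)) = a • τ^[n] (η x) :=
          hinjn n _ _ (by rw [hτn, smul_comm, hτn, map_smul])
        rw [this]; exact Submodule.smul_mem _ _ (hx n)
    rw [hx]; exact hη m n
  · intro x y hxy
    rw [mul_comm, mul_smul, mul_smul] at hxy
    have hxy := hinj _ _ hxy
    obtain ⟨⟨m, ⟨_, n, rfl⟩⟩, h⟩ := IsLocalizedModule.surj S η (x - y)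
    have h : t ^ n • (x - y) = η m := h
    have h5 : η (g • m) = η 0 := by
      rw [map_smul, ← h, smul_comm, smul_sub, hxy, sub_self, smul_zero, map_zero]
    obtain ⟨⟨e, he⟩, h6⟩ := (IsLocalizedModule.eq_iff_exists S η).1 h5
    have h6 : e • g • m = e • (0 : M) := h6
    rw [smul_zero, smul_comm] at h6
    have h7 : e • m = 0 := h3 _ _ (by rw [h6, smul_zero])
    have h8 : η m = η 0 := (IsLocalizedModule.eq_iff_exists S η).2 ⟨⟨e, he⟩, by
      change e • m = e • (0 : M); rw [h7, smul_zero]⟩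
    have h9 : x - y = 0 := hinjn n _ _ (by rw [h, h8, map_zero, smul_zero])
    exact sub_eq_zero.1 h9
  · intro i
    change (s.loc S).op i (η (u 0)) = 0
    have := s.loc_lin S i (u 0)
    rw [h4, map_zero] at this
    exact this.symm

lemma LocR.op_u {s : DStr δ c M} {g : R} {u : ℕ → M} (h1 : ∀ j, g • u (j + 1) = u j)
    (h3 : ∀ x y : M, g • x = g • y → x = y) (h4 : ∀ i, s.op i (u 0) = 0) (i : ι) (m : ℕ) :
    s.op i (u m) = (-(m : R) * δ i g) • u (m + 1) := by
  induction m with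
  | zero => rw [h4]; simp
  | succ m ih =>
    rw [← h1 m, s.leib] at ih
    apply h3
    have : g • s.op i (u (m + 1)) = (-(m : R) * δ i g) • u (m + 1) - δ i g • u (m + 1) := by
      rw [← ih]; abel
    rw [this, smul_comm, h1]
    push_cast; module

lemma LocR.noeth [IsNoetherianRing R] {s : DStr δ c M} {g : R} (h : LocR s g)
    (hunit : ∀ n : ℕ, n ≠ 0 → IsUnit (n : R))
    (hB : ∃ B : Polynomial ℤ, B ≠ 0 ∧ ∃ N, B.map (Int.castRingHom R) * Polynomial.C g ^ N ∈
        EN (fun i => polyDer (δ i)) (Polynomial.C g) Polynomial.X (N + 1)) : s.Noeth := by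
  obtain ⟨u, h1, h2, h3, h4⟩ := h
  obtain ⟨B, hB0, N, hB⟩ := hB
  have hunitZ : ∀ n : ℤ, n ≠ 0 → IsUnit (n : R) := by
    intro n hn
    have := hunit n.natAbs (by simpa using hn)
    rcases Int.natAbs_eq n with e | e
    · rw [e]; simpa using this
    · rw [e]; simpa using this.neg
  obtain ⟨l, hl⟩ : ∃ l : ℕ, ∀ j : ℕ, l ≤ j → B.eval (-(j : ℤ) - 1) ≠ 0 := by
    have hfin : {j : ℕ | B.eval (-(j : ℤ) - 1) = 0}.Finite := by
      refine Set.Finite.of_finite_image (f := fun j : ℕ => -(j : ℤ) - 1)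
        ((B.roots.toFinset.finite_toSet).subset ?_) ?_
      · rintro _ ⟨j, hj, rfl⟩
        simpa [hB0] using hj
      · intro a _ b _ hab
        simpa using hab
    obtain ⟨l, hl⟩ := hfin.bddAbove
    exact ⟨l + 1, fun j hj h => by have := hl h; omega⟩
  apply s.cyclic_noeth (u l)
  intro P hP hmem
  have step : ∀ j, l ≤ j → u j ∈ P → u (j + 1) ∈ P := by
    intro j hj hu
    let σ : R := ((-(j : ℤ) - 1 : ℤ) : R)
    let φ : Polynomial R →+* R := Polynomial.evalRingHom σ
    have hφ : ∀ i p, δ i (φ p) = φ (polyDer (δ i) p) := by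
      intro i p
      have hσ : ∀ n, δ i (σ ^ n) = 0 := by
        intro n
        have e : σ = -((j : R)) - 1 := by simp [σ]
        have h0 : δ i σ = 0 := by rw [e, der_sub, der_neg, der_natCast, der_one]; simp
        induction n with
        | zero => rw [pow_zero, der_one]
        | succ n ih => rw [pow_succ, der_mul, ih, h0]; simp
      change δ i (p.eval σ) = (polyDer (δ i) p).eval σ
      have hdeg : (polyDer (δ i) p).natDegree < p.natDegree + 1 := by
        rw [Nat.lt_succ_iff, Polynomial.natDegree_le_iff_coeff_eq_zero]
        intro n hn
        rw [coeff_polyDer, Polynomial.coeff_eq_zero_of_natDegree_lt hn, der_zero]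
      rw [Polynomial.eval_eq_sum_range, Polynomial.eval_eq_sum_range' hdeg, der_sum]
      refine Finset.sum_congr rfl fun n _ => ?_
      rw [der_mul, hσ, coeff_polyDer]; ring
    have hE := EN_map (fun i => polyDer (δ i)) (Polynomial.C g) Polynomial.X δ φ hφ (N + 1)
    have hmem2 := Ideal.mem_map_of_mem φ hB
    rw [← hE, map_mul, map_pow] at hmem2
    have e1 : φ (Polynomial.C g) = g := by simp [φ]
    have e2 : φ Polynomial.X = σ := by simp [φ]
    have e3 : φ (B.map (Int.castRingHom R)) = ((B.eval (-(j : ℤ) - 1) : ℤ) : R) := by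
      change (B.map (Int.castRingHom R)).eval (((-(j : ℤ) - 1 : ℤ) : R)) = _
      exact Polynomial.eval_intCast_map (Int.castRingHom R) B _
    rw [e1, e2, e3] at hmem2
    have key : ∀ n, ∀ y ∈ EN δ g σ n, y • u (n + j) ∈ P := by
      intro n
      induction n with
      | zero => intro y _; rw [zero_add]; exact P.smul_mem _ hu
      | succ n ih =>
        let J : Ideal R := P.comap (LinearMap.toSpanSingleton R M (u (n + 1 + j)))
        have : EN δ g σ (n + 1) ≤ J := by
          apply EN_succ_le
          · intro y hy
            change (g * y) • u (n + 1 + j) ∈ P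
            rw [mul_comm, mul_smul, add_right_comm, h1]; exact ih y hy
          · intro i y hy
            change (g * δ i y + (σ + 1 - n) * δ i g * y) • u (n + 1 + j) ∈ P
            have h5 := hP i _ (ih y hy)
            rw [s.leib, LocR.op_u h1 h3 h4, ← h1 (n + j)] at h5
            rw [add_right_comm n 1 j]
            convert h5 using 1
            simp only [σ]
            push_cast
            module
        intro y hy
        exact this hy
    have h6 := key _ _ hmem2
    have h7 : ∀ k, g ^ k • u (k + 1 + j) = u (1 + j) := by
      intro k
      induction k with
      | zero => simp
      | succ k ih =>
        rw [pow_succ, mul_smul, show k + 1 + 1 + j = (k + 1 + j) + 1 by ring, h1, ih]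
    rw [mul_smul, h7, add_comm] at h6
    obtain ⟨U, hU⟩ := hunitZ _ (hl j hj)
    rw [← hU] at h6
    have := P.smul_mem (↑U⁻¹ : R) h6
    rwa [smul_smul, Units.inv_mul, one_smul] at this
  have hall : ∀ j, u (l + j) ∈ P := by
    intro j
    induction j with
    | zero => exact hmem
    | succ j ih => exact step (l + j) (by omega) ih
  have hdown : ∀ k j, u (j + k) ∈ P → u j ∈ P := by
    intro k
    induction k with
    | zero => intro j h; exact h
    | succ k ih => intro j h; apply ih; rw [← h1]; exact P.smul_mem _ h
  rw [eq_top_iff, ← h2, Submodule.span_le]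
  rintro _ ⟨j, rfl⟩
  exact hdown l j (by rw [add_comm]; exact hall j)
end Loc
end BSLC

namespace BSLC
universe w
section
variable {R : Type w} [CommRing R]

/-- localization at one element -/
noncomputable def Lz (g : R) (M : ModuleCat.{w} R) : ModuleCat.{w} R :=
  ModuleCat.of R (LocalizedModule (Submonoid.powers g) M)

/-- localization map -/
noncomputable def etaz (g : R) (M : ModuleCat.{w} R) : M →ₗ[R] Lz g M :=
  LocalizedModule.mkLinearMap (Submonoid.powers g) M

instance (g : R) (M : ModuleCat.{w} R) : IsLocalizedModule (Submonoid.powers g) (etaz g M) :=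
  inferInstanceAs (IsLocalizedModule _ (LocalizedModule.mkLinearMap (Submonoid.powers g) M))

/-- functoriality of localization -/
noncomputable def lmap (g : R) {M N : ModuleCat.{w} R} (f : M →ₗ[R] N) : Lz g M →ₗ[R] Lz g N :=
  IsLocalizedModule.map (Submonoid.powers g) (etaz g M) (etaz g N) f

lemma lmap_eta (g : R) {M N : ModuleCat.{w} R} (f : M →ₗ[R] N) (x : M) :
    lmap g f (etaz g M x) = etaz g N (f x) := IsLocalizedModule.map_apply _ _ _ _ _

lemma lmap_comp (g : R) {M N P : ModuleCat.{w} R} (f : M →ₗ[R] N) (f' : N →ₗ[R] P) :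
    lmap g (f' ∘ₗ f) = lmap g f' ∘ₗ lmap g f :=
  IsLocalizedModule.map_comp' (Submonoid.powers g) (etaz g M) (etaz g N) (etaz g P) f f'

/-- Cech modules -/
noncomputable def CX : ℕ → List R → ModuleCat.{w} R → ModuleCat.{w} R
  | 0 => fun _ M => M
  | p + 1 => fun gs => List.rec (motive := fun _ => ModuleCat.{w} R → ModuleCat.{w} R)
      (fun _ => ModuleCat.of R PUnit)
      (fun g gs ih M => ModuleCat.of R (ih M × CX p gs (Lz g M))) gs

/-- degree zero -/
noncomputable def z0 (gs : List R) (M : ModuleCat.{w} R) : CX 0 gs M ≃ₗ[R] M := LinearEquiv.refl R M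

/-- the two components -/
noncomputable def pr (p : ℕ) (g : R) (gs : List R) (M : ModuleCat.{w} R) :
    CX (p + 1) (g :: gs) M ≃ₗ[R] (CX (p + 1) gs M × CX p gs (Lz g M)) :=
  LinearEquiv.refl R (CX (p + 1) gs M × CX p gs (Lz g M))

instance (p : ℕ) (M : ModuleCat.{w} R) : Subsingleton (CX (p + 1) [] M) :=
  inferInstanceAs (Subsingleton (PUnit : Type w))

attribute [irreducible] CX

/-- functoriality of the Cech modules -/
noncomputable def cmap : ∀ (gs : List R) (p : ℕ) {M N : ModuleCat.{w} R}, (M →ₗ[R] N) →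
    (CX p gs M →ₗ[R] CX p gs N)
  | [], 0, M, N, f => (z0 [] N).symm.toLinearMap ∘ₗ f ∘ₗ (z0 [] M).toLinearMap
  | g :: gs, 0, M, N, f => (z0 (g :: gs) N).symm.toLinearMap ∘ₗ f ∘ₗ (z0 (g :: gs) M).toLinearMap
  | [], _ + 1, _, _, _ => 0
  | g :: gs, p + 1, M, N, f => (pr p g gs N).symm.toLinearMap ∘ₗ
      (LinearMap.prodMap (cmap gs (p + 1) f) (cmap gs p (lmap g f))) ∘ₗ (pr p g gs M).toLinearMap

/-- Cech differential -/
noncomputable def dX : ∀ (gs : List R) (p : ℕ) (M : ModuleCat.{w} R),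
    (CX p gs M →ₗ[R] CX (p + 1) gs M)
  | [], _, _ => 0
  | g :: gs, 0, M => (pr 0 g gs M).symm.toLinearMap ∘ₗ
      LinearMap.prod (dX gs 0 M ∘ₗ (z0 gs M).symm.toLinearMap)
        ((z0 gs (Lz g M)).symm.toLinearMap ∘ₗ etaz g M) ∘ₗ (z0 (g :: gs) M).toLinearMap
  | g :: gs, p + 1, M => (pr (p + 1) g gs M).symm.toLinearMap ∘ₗ
      LinearMap.prod (dX gs (p + 1) M ∘ₗ LinearMap.fst R (CX (p + 1) gs M) (CX p gs (Lz g M)))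
      (cmap gs (p + 1) (etaz g M) ∘ₗ LinearMap.fst R (CX (p + 1) gs M) (CX p gs (Lz g M)) -
        dX gs p (Lz g M) ∘ₗ LinearMap.snd R (CX (p + 1) gs M) (CX p gs (Lz g M))) ∘ₗ
        (pr p g gs M).toLinearMap

lemma z0_cmap (gs : List R) {M N : ModuleCat.{w} R} (f : M →ₗ[R] N) (x : CX 0 gs M) :
    z0 gs N (cmap gs 0 f x) = f (z0 gs M x) := by
  cases gs <;> simp [cmap]

lemma pr_cmap (p : ℕ) (g : R) (gs : List R) {M N : ModuleCat.{w} R} (f : M →ₗ[R] N)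
    (x : CX (p + 1) (g :: gs) M) : pr p g gs N (cmap (g :: gs) (p + 1) f x) =
      (cmap gs (p + 1) f (pr p g gs M x).1, cmap gs p (lmap g f) (pr p g gs M x).2) := by
  simp [cmap]

lemma dX_nil (p : ℕ) (M : ModuleCat.{w} R) : dX [] p M = 0 := by
  cases p <;> rfl

lemma pr_dX0 (g : R) (gs : List R) (M : ModuleCat.{w} R) (x : CX 0 (g :: gs) M) :
    pr 0 g gs M (dX (g :: gs) 0 M x) = (dX gs 0 M ((z0 gs M).symm (z0 (g :: gs) M x)),
      (z0 gs (Lz g M)).symm (etaz g M (z0 (g :: gs) M x))) := by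
  simp [dX]

lemma pr_dX (p : ℕ) (g : R) (gs : List R) (M : ModuleCat.{w} R) (x : CX (p + 1) (g :: gs) M) :
    pr (p + 1) g gs M (dX (g :: gs) (p + 1) M x) = (dX gs (p + 1) M (pr p g gs M x).1,
      cmap gs (p + 1) (etaz g M) (pr p g gs M x).1 - dX gs p (Lz g M) (pr p g gs M x).2) := by
  simp [dX]

lemma cmap_comp (gs : List R) : ∀ (p : ℕ) {M N P : ModuleCat.{w} R} (f : M →ₗ[R] N) (f' : N →ₗ[R] P)
    (x : CX p gs M), cmap gs p (f' ∘ₗ f) x = cmap gs p f' (cmap gs p f x) := by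
  induction gs with
  | nil =>
    intro p M N P f f' x
    cases p with
    | zero => apply (z0 _ _).injective; simp [z0_cmap]
    | succ p => exact Subsingleton.elim _ _
  | cons g gs ih =>
    intro p M N P f f' x
    cases p with
    | zero => apply (z0 _ _).injective; simp [z0_cmap]
    | succ p =>
      apply (pr _ _ _ _).injective
      simp [pr_cmap, ih, lmap_comp]

lemma cmap_inj (gs : List R) : ∀ (p : ℕ) {M N : ModuleCat.{w} R} (f : M →ₗ[R] N)
    (_ : Function.Injective f), Function.Injective (cmap gs p f) := by
  have h0 : ∀ (gs : List R) {M N : ModuleCat.{w} R} (f : M →ₗ[R] N)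
    (_ : Function.Injective f), Function.Injective (cmap gs 0 f) := by
    intro gs M N f hf x y h
    apply (z0 _ _).injective
    apply hf
    rw [← z0_cmap, h, z0_cmap]
  induction gs with
  | nil =>
    intro p M N f hf
    cases p with
    | zero => exact h0 _ f hf
    | succ p => intro x y _; exact Subsingleton.elim _ _
  | cons g gs ih =>
    intro p
    cases p with
    | zero => intro M N f hf; exact h0 _ f hf
    | succ p =>
      intro M N f hf x y h
      have h1 := congrArg (pr _ _ _ _) h
      rw [pr_cmap, pr_cmap, Prod.mk.injEq] at h1
      apply (pr _ _ _ _).injective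
      exact Prod.ext (ih (p + 1) f hf h1.1)
        (ih p (lmap g f) (IsLocalizedModule.map_injective _ _ _ _ hf) h1.2)

lemma cmap_surj (gs : List R) : ∀ (p : ℕ) {M N : ModuleCat.{w} R} (f : M →ₗ[R] N)
    (_ : Function.Surjective f), Function.Surjective (cmap gs p f) := by
  have h0 : ∀ (gs : List R) {M N : ModuleCat.{w} R} (f : M →ₗ[R] N)
    (_ : Function.Surjective f), Function.Surjective (cmap gs 0 f) := by
    intro gs M N f hf y
    obtain ⟨x, hx⟩ := hf (z0 _ _ y)
    exact ⟨(z0 _ _).symm x, (z0 _ _).injective (by rw [z0_cmap]; simpa using hx)⟩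
  induction gs with
  | nil =>
    intro p M N f hf
    cases p with
    | zero => exact h0 _ f hf
    | succ p => intro y; exact ⟨0, Subsingleton.elim _ _⟩
  | cons g gs ih =>
    intro p
    cases p with
    | zero => intro M N f hf; exact h0 _ f hf
    | succ p =>
      intro M N f hf y
      obtain ⟨a, ha⟩ := ih (p + 1) f hf (pr _ _ _ _ y).1
      obtain ⟨b, hb⟩ := ih p (lmap g f) (IsLocalizedModule.map_surjective _ _ _ _ hf) (pr _ _ _ _ y).2
      refine ⟨(pr _ _ _ _).symm (a, b), (pr _ _ _ _).injective ?_⟩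
      rw [pr_cmap, LinearEquiv.apply_symm_apply]
      exact Prod.ext ha hb

lemma cmap_exact (gs : List R) : ∀ (p : ℕ) {M N P : ModuleCat.{w} R} (f : M →ₗ[R] N) (f' : N →ₗ[R] P)
    (_ : Function.Exact f f'), Function.Exact (cmap gs p f) (cmap gs p f') := by
  have h0 : ∀ (gs : List R) {M N P : ModuleCat.{w} R} (f : M →ₗ[R] N) (f' : N →ₗ[R] P)
    (_ : Function.Exact f f'), Function.Exact (cmap gs 0 f) (cmap gs 0 f') := by
    intro gs M N P f f' h y
    rw [← (z0 _ _).map_eq_zero_iff, z0_cmap, h (z0 _ _ y)]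
    constructor
    · rintro ⟨x, hx⟩
      exact ⟨(z0 _ _).symm x, (z0 _ _).injective (by rw [z0_cmap]; simpa using hx)⟩
    · rintro ⟨x, rfl⟩
      exact ⟨z0 _ _ x, by rw [z0_cmap]⟩
  induction gs with
  | nil =>
    intro p M N P f f' h
    cases p with
    | zero => exact h0 _ f f' h
    | succ p => intro y; exact ⟨fun _ => ⟨0, Subsingleton.elim _ _⟩, fun _ => Subsingleton.elim _ _⟩
  | cons g gs ih =>
    intro p M N P f f' h
    cases p with
    | zero => exact h0 _ f f' h
    | succ p =>
      intro y
      have h1 := ih (p + 1) f f' h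
      have h2 := ih p (lmap g f) (lmap g f') (IsLocalizedModule.map_exact (Submonoid.powers g) _ _ _ f f' h)
      rw [← (pr _ _ _ _).map_eq_zero_iff, pr_cmap, Prod.mk_eq_zero]
      constructor
      · intro hy
        obtain ⟨a, ha⟩ := (h1 _).1 hy.1
        obtain ⟨b, hb⟩ := (h2 _).1 hy.2
        refine ⟨(pr _ _ _ _).symm (a, b), (pr _ _ _ _).injective ?_⟩
        rw [pr_cmap, LinearEquiv.apply_symm_apply]
        exact Prod.ext ha hb
      · rintro ⟨x, rfl⟩
        rw [pr_cmap]
        exact ⟨(h1 _).2 ⟨_, rfl⟩, (h2 _).2 ⟨_, rfl⟩⟩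

lemma z0_symm_cmap (gs : List R) {M N : ModuleCat.{w} R} (f : M →ₗ[R] N) (x : M) :
    (z0 gs N).symm (f x) = cmap gs 0 f ((z0 gs M).symm x) := by
  apply (z0 gs N).injective
  rw [z0_cmap]; simp

lemma cmap_d (gs : List R) : ∀ (p : ℕ) {M N : ModuleCat.{w} R} (f : M →ₗ[R] N) (x : CX p gs M),
    cmap gs (p + 1) f (dX gs p M x) = dX gs p N (cmap gs p f x) := by
  induction gs with
  | nil => intro p M N f x; exact Subsingleton.elim _ _
  | cons g gs ih =>
    intro p M N f x
    apply (pr _ _ _ _).injective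
    cases p with
    | zero =>
      rw [pr_cmap, pr_dX0, pr_dX0, z0_cmap]
      refine Prod.ext ?_ ?_
      · dsimp only
        rw [ih, z0_symm_cmap]
      · dsimp only
        rw [← lmap_eta, z0_symm_cmap gs (lmap g f)]
    | succ p =>
      rw [pr_cmap, pr_dX, pr_dX, pr_cmap]
      refine Prod.ext (ih (p + 1) f _) ?_
      dsimp only
      rw [map_sub, ih, ← cmap_comp, ← cmap_comp]
      have : lmap g f ∘ₗ etaz g M = etaz g N ∘ₗ f := LinearMap.ext fun m => lmap_eta g f m
      rw [this]

lemma dX_dX (gs : List R) : ∀ (p : ℕ) (M : ModuleCat.{w} R) (x : CX p gs M),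
    dX gs (p + 1) M (dX gs p M x) = 0 := by
  induction gs with
  | nil => intro p M x; rfl
  | cons g gs ih =>
    intro p M x
    apply (pr _ _ _ _).injective
    cases p with
    | zero =>
      rw [pr_dX, pr_dX0, map_zero]
      refine Prod.ext (ih 0 M _) ?_
      dsimp only
      rw [cmap_d, z0_symm_cmap, sub_self]; rfl
    | succ p =>
      rw [pr_dX, pr_dX, map_zero]
      refine Prod.ext (ih (p + 1) M _) ?_
      dsimp only
      rw [cmap_d, map_sub, ih, sub_zero, sub_self]; rfl

/-- boundaries -/
noncomputable def BX : ∀ (gs : List R) (p : ℕ) (M : ModuleCat.{w} R), Submodule R (CX p gs M)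
  | _, 0, _ => ⊥
  | gs, p + 1, M => LinearMap.range (dX gs p M)

/-- Cech cohomology -/
abbrev HX (gs : List R) (p : ℕ) (M : ModuleCat.{w} R) : Type w :=
  (LinearMap.ker (dX gs p M)) ⧸ (BX gs p M).comap (LinearMap.ker (dX gs p M)).subtype

section D
variable {ι : Type} [Fintype ι] {δ : ι → Der R} {c : ι → ι → ι → R}

/-- transport of operators -/
def DStr.tr {M N : Type w} [AddCommGroup M] [Module R M] [AddCommGroup N] [Module R N]
    (s : DStr δ c N) (e : M ≃ₗ[R] N) : DStr δ c M where
  op i := (e.symm.toLinearMap.toAddMonoidHom.comp (s.op i)).comp e.toLinearMap.toAddMonoidHom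
  leib i a m := by simp [s.leib]
  br i j m := by
    apply e.injective
    simpa using s.br i j (e m)

lemma DStr.tr_op {M N : Type w} [AddCommGroup M] [Module R M] [AddCommGroup N] [Module R N]
    (s : DStr δ c N) (e : M ≃ₗ[R] N) (i : ι) (m : M) : e ((s.tr e).op i m) = s.op i (e m) := by
  simp [DStr.tr]

lemma DStr.Noeth.tr_noeth {M N : Type w} [AddCommGroup M] [Module R M] [AddCommGroup N] [Module R N]
    {s : DStr δ c N} (h : s.Noeth) (e : M ≃ₗ[R] N) : (s.tr e).Noeth :=
  h.of_injective e.toLinearMap (fun i m => s.tr_op e i m) e.injective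

/-- operators on localization -/
noncomputable def locz (g : R) {M : ModuleCat.{w} R} (s : DStr δ c M) : DStr δ c (Lz g M) :=
  s.loc (Submonoid.powers g)

/-- operators on Cech modules -/
noncomputable def CXD : ∀ (gs : List R) (p : ℕ) {M : ModuleCat.{w} R}, DStr δ c M → DStr δ c (CX p gs M)
  | [], 0, M, s => s.tr (z0 [] M)
  | g :: gs, 0, M, s => s.tr (z0 (g :: gs) M)
  | [], p + 1, M, _ => (DStr.punit : DStr δ c (PUnit : Type w)).tr
      { toFun := fun _ => PUnit.unit
        invFun := fun _ => 0
        map_add' := fun _ _ => rfl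
        map_smul' := fun _ _ => rfl
        left_inv := fun _ => Subsingleton.elim _ _
        right_inv := fun _ => rfl }
  | g :: gs, p + 1, M, s => (DStr.prod (CXD gs (p + 1) s) (CXD gs p (locz g s))).tr (pr p g gs M)

lemma z0_op (gs : List R) {M : ModuleCat.{w} R} (s : DStr δ c M) (i : ι) (x : CX 0 gs M) :
    z0 gs M ((CXD gs 0 s).op i x) = s.op i (z0 gs M x) := by
  cases gs <;> (rw [CXD]; exact s.tr_op _ i x)

lemma z0_symm_op (gs : List R) {M : ModuleCat.{w} R} (s : DStr δ c M) (i : ι) (x : M) :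
    (z0 gs M).symm (s.op i x) = (CXD gs 0 s).op i ((z0 gs M).symm x) := by
  apply (z0 gs M).injective
  rw [z0_op]; simp

lemma pr_op (p : ℕ) (g : R) (gs : List R) {M : ModuleCat.{w} R} (s : DStr δ c M) (i : ι)
    (x : CX (p + 1) (g :: gs) M) : pr p g gs M ((CXD (g :: gs) (p + 1) s).op i x) =
      ((CXD gs (p + 1) s).op i (pr p g gs M x).1, (CXD gs p (locz g s)).op i (pr p g gs M x).2) := by
  rw [CXD]; exact DStr.tr_op _ _ i x

lemma DLin_eta (g : R) {M : ModuleCat.{w} R} (s : DStr δ c M) :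
    DLin s (locz g s) (etaz g M) := s.loc_lin _

lemma DLin_lmap (g : R) {M N : ModuleCat.{w} R} {s : DStr δ c M} {s' : DStr δ c N} {f : M →ₗ[R] N}
    (hf : DLin s s' f) : DLin (locz g s) (locz g s') (lmap g f) := hf.locMap _

lemma DLin_cmap (gs : List R) : ∀ (p : ℕ) {M N : ModuleCat.{w} R} {s : DStr δ c M} {s' : DStr δ c N}
    {f : M →ₗ[R] N} (_ : DLin s s' f), DLin (CXD gs p s) (CXD gs p s') (cmap gs p f) := by
  induction gs with
  | nil =>
    intro p M N s s' f h i x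
    cases p with
    | zero => apply (z0 _ _).injective; rw [z0_op, z0_cmap, z0_cmap, z0_op, h i]
    | succ p => exact Subsingleton.elim _ _
  | cons g gs ih =>
    intro p M N s s' f h i x
    cases p with
    | zero => apply (z0 _ _).injective; rw [z0_op, z0_cmap, z0_cmap, z0_op, h i]
    | succ p =>
      apply (pr _ _ _ _).injective
      rw [pr_op, pr_cmap, pr_cmap, pr_op]
      exact Prod.ext (ih (p + 1) h i _) (ih p (DLin_lmap g h) i _)

lemma DLin_dX (gs : List R) : ∀ (p : ℕ) {M : ModuleCat.{w} R} (s : DStr δ c M),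
    DLin (CXD gs p s) (CXD gs (p + 1) s) (dX gs p M) := by
  induction gs with
  | nil => intro p M s i x; exact Subsingleton.elim _ _
  | cons g gs ih =>
    intro p M s i x
    apply (pr _ _ _ _).injective
    cases p with
    | zero =>
      rw [pr_op, pr_dX0, pr_dX0, z0_op]
      refine Prod.ext ?_ ?_
      · dsimp only
        rw [z0_symm_op, ih]
      · dsimp only
        rw [DLin_eta g s i, z0_symm_op]
    | succ p =>
      rw [pr_op, pr_dX, pr_dX, pr_op]
      refine Prod.ext (ih (p + 1) s i _) ?_
      dsimp only
      rw [map_sub, DLin_cmap gs (p + 1) (DLin_eta g s) i, ih]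

lemma CXD_noeth [IsNoetherianRing R] (hunit : ∀ n : ℕ, n ≠ 0 → IsUnit (n : R))
    (hB : ∀ g : R, ∃ B : Polynomial ℤ, B ≠ 0 ∧ ∃ N, B.map (Int.castRingHom R) * Polynomial.C g ^ N ∈
        EN (fun i => polyDer (δ i)) (Polynomial.C g) Polynomial.X (N + 1)) (gs : List R) :
    ∀ (p : ℕ) {M : ModuleCat.{w} R} (s : DStr δ c M) (g : R) (_ : LocR s g), (CXD gs p s).Noeth := by
  induction gs with
  | nil =>
    intro p; cases p <;> intro M s g h <;> rw [CXD]
    · exact (h.noeth hunit (hB g)).tr_noeth _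
    · exact DStr.Noeth.punit.tr_noeth _
  | cons t gs ih =>
    intro p M s g h
    cases p with
    | zero => rw [CXD]; exact (h.noeth hunit (hB g)).tr_noeth _
    | succ p =>
      rw [CXD]
      exact ((ih (p + 1) s g h).prod (ih p (M := Lz t M) _ (g * t) (h.loc t))).tr_noeth _

lemma ass_HX [IsNoetherianRing R] (hunit : ∀ n : ℕ, n ≠ 0 → IsUnit (n : R))
    (hc : ∀ i j a, δ i (δ j a) - δ j (δ i a) = ∑ l, c i j l * δ l a)
    (hB : ∀ g : R, ∃ B : Polynomial ℤ, B ≠ 0 ∧ ∃ N, B.map (Int.castRingHom R) * Polynomial.C g ^ N ∈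
        EN (fun i => polyDer (δ i)) (Polynomial.C g) Polynomial.X (N + 1)) (gs : List R) (p : ℕ) :
    {P : Ideal R | P.IsPrime ∧ ∃ x : HX gs p (ModuleCat.of R R), ∀ a : R, a ∈ P ↔ a • x = 0}.Finite := by
  let s : DStr δ c (ModuleCat.of R R) := DStr.self hc
  have hN := CXD_noeth hunit hB gs p s 1 (LocR.self hc)
  have hk : (CXD gs p s).Stable (LinearMap.ker (dX gs p (ModuleCat.of R R))) := by
    intro i m hm
    rw [LinearMap.mem_ker] at hm ⊢
    rw [DLin_dX gs p s i m, hm, map_zero]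
  have hb : (CXD gs p s).Stable (BX gs p (ModuleCat.of R R)) := by
    cases p with
    | zero =>
      intro i m hm
      rw [BX, Submodule.mem_bot] at hm ⊢
      rw [hm, map_zero]
    | succ p =>
      rintro i _ ⟨m, rfl⟩
      exact ⟨_, DLin_dX gs p s i m⟩
  exact ((hN.sub _ hk).quot ((BX gs p (ModuleCat.of R R)).comap _)
    (fun i m hm => hb i _ hm)).finite_ass
end D
end
end BSLC

namespace BSLC
universe w
section
variable {R : Type w} [CommRing R]

/-- torsion with respect to a list -/
def Tors (gs : List R) {M : Type w} [AddCommGroup M] [Module R M] (x : M) : Prop :=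
  ∀ g ∈ gs, ∃ n : ℕ, g ^ n • x = 0

lemma etaz_zero_iff (g : R) (M : ModuleCat.{w} R) (x : M) : etaz g M x = 0 ↔ ∃ n : ℕ, g ^ n • x = 0 := by
  rw [IsLocalizedModule.eq_zero_iff (Submonoid.powers g)]
  constructor
  · rintro ⟨⟨_, n, rfl⟩, h⟩
    exact ⟨n, h⟩
  · rintro ⟨n, h⟩
    exact ⟨⟨_, n, rfl⟩, h⟩

lemma etaz_surj (g : R) (M : ModuleCat.{w} R) (y : Lz g M) : ∃ (x : M) (n : ℕ), g ^ n • y = etaz g M x := by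
  obtain ⟨⟨x, ⟨_, n, rfl⟩⟩, h⟩ := IsLocalizedModule.surj (Submonoid.powers g) (etaz g M) y
  exact ⟨x, n, h⟩

lemma Lz_bij (g : R) (M : ModuleCat.{w} R) (n : ℕ) : Function.Bijective (fun y : Lz g M => g ^ n • y) := by
  have := IsLocalizedModule.map_units (S := Submonoid.powers g) (etaz g M) ⟨g ^ n, n, rfl⟩
  rw [Module.End.isUnit_iff] at this
  exact this

lemma dX0_iff (gs : List R) : ∀ (M : ModuleCat.{w} R) (x : CX 0 gs M),
    dX gs 0 M x = 0 ↔ Tors gs (z0 gs M x) := by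
  induction gs with
  | nil => intro M x; exact ⟨fun _ g hg => absurd hg List.not_mem_nil, fun _ => Subsingleton.elim _ _⟩
  | cons g gs ih =>
    intro M x
    rw [← (pr _ _ _ _).map_eq_zero_iff, pr_dX0, Prod.mk_eq_zero, ih, LinearEquiv.apply_symm_apply,
      LinearEquiv.map_eq_zero_iff, etaz_zero_iff]
    constructor
    · rintro ⟨h1, h2⟩ g' hg'
      rcases List.mem_cons.1 hg' with rfl | hg'
      · exact h2
      · exact h1 g' hg'
    · intro h
      exact ⟨fun g' hg' => h g' (List.mem_cons_of_mem _ hg'), h g List.mem_cons_self⟩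

lemma Tors.smul_sub {gs : List R} {M : Type w} [AddCommGroup M] [Module R M] {x y : M}
    (hx : Tors gs x) (hy : Tors gs y) : Tors gs (x - y) := by
  intro g hg
  obtain ⟨n, hn⟩ := hx g hg
  obtain ⟨m, hm⟩ := hy g hg
  refine ⟨n + m, ?_⟩
  rw [_root_.smul_sub, pow_add, mul_smul, mul_smul, hm, smul_comm, hn]; simp

lemma exists_uniform_pow {M : Type w} [AddCommGroup M] [Module R M] (h : R) (x : M) (gs : List R)
    (H : ∀ g ∈ gs, ∃ k m : ℕ, h ^ m • g ^ k • x = 0) : ∃ m, Tors gs (h ^ m • x) := by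
  induction gs with
  | nil => exact ⟨0, by simp [Tors]⟩
  | cons g gs ih =>
    obtain ⟨m, hm⟩ := ih fun g' hg' => H g' (by simp [hg'])
    obtain ⟨k, m', hk⟩ := H g (by simp)
    refine ⟨m + m', fun g' hg' => ?_⟩
    rcases List.mem_cons.1 hg' with rfl | hg'
    · refine ⟨k, ?_⟩
      rw [pow_add, mul_smul, smul_comm, smul_comm (g' ^ k), hk, smul_zero]
    · obtain ⟨n, hn⟩ := hm g' hg'
      refine ⟨n, ?_⟩
      rw [add_comm, pow_add, mul_smul, smul_comm, hn, smul_zero]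

lemma lift_tors (h : R) (gs : List R) (M : ModuleCat.{w} R) (y : Lz h M) (hy : Tors gs y) :
    ∃ (x : M) (n : ℕ), Tors gs x ∧ h ^ n • y = etaz h M x := by
  obtain ⟨x, n, hx⟩ := etaz_surj h M y
  obtain ⟨m, hm⟩ := exists_uniform_pow h x gs (by
    intro g hg
    obtain ⟨k, hk⟩ := hy g hg
    have : etaz h M (g ^ k • x) = 0 := by
      rw [map_smul, ← hx, smul_comm, hk, smul_zero]
    obtain ⟨m, hm⟩ := (etaz_zero_iff _ _ _).1 this
    exact ⟨k, m, hm⟩)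
  exact ⟨h ^ m • x, m + n, hm, by rw [map_smul, ← hx, pow_add, mul_smul]⟩

/-- acyclic modules -/
def Acyc (M : ModuleCat.{w} R) : Prop := ∀ (gs : List R) (g : R) (x : M), Tors gs x →
  ∃ x' : M, Tors gs x' ∧ ∃ m : ℕ, g ^ m • (g • x' - x) = 0

lemma Acyc.lz {M : ModuleCat.{w} R} (hM : Acyc M) (h : R) : Acyc (Lz h M) := by
  intro gs g y hy
  obtain ⟨x, n, hx, hxy⟩ := lift_tors h gs M y hy
  obtain ⟨x', hx', m, hm⟩ := hM gs g x hx
  obtain ⟨y', hy'⟩ := (Lz_bij h M n).2 (etaz h M x')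
  dsimp only at hy'
  refine ⟨y', ?_, m, ?_⟩
  · intro g' hg'
    obtain ⟨k, hk⟩ := hx' g' hg'
    refine ⟨k, (Lz_bij h M n).1 ?_⟩
    dsimp only
    rw [smul_comm, hy', ← map_smul, hk, map_zero, smul_zero]
  · apply (Lz_bij h M n).1
    dsimp only
    rw [smul_comm, smul_sub (h ^ n), hxy, smul_comm (h ^ n), hy', ← map_smul, ← map_sub, ← map_smul, hm,
      map_zero, smul_zero]

lemma Acyc.surj {M : ModuleCat.{w} R} (hM : Acyc M) (g : R) (gs : List R) (y : Lz g M) (hy : Tors gs y) :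
    ∃ x : M, Tors gs x ∧ etaz g M x = y := by
  obtain ⟨x, n, hx, hxy⟩ := lift_tors g gs M y hy
  obtain ⟨x', hx', m, hm⟩ := hM gs (g ^ n) x hx
  refine ⟨x', hx', (Lz_bij g M n).1 ?_⟩
  dsimp only
  rw [hxy, ← sub_eq_zero, ← map_smul, ← map_sub, etaz_zero_iff]
  exact ⟨n * m, by rw [pow_mul]; exact hm⟩

lemma Acyc.vanish (gs : List R) : ∀ {M : ModuleCat.{w} R} (_ : Acyc M) (p : ℕ) (x : CX (p + 1) gs M)
    (_ : dX gs (p + 1) M x = 0), ∃ y, dX gs p M y = x := by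
  induction gs with
  | nil => intro M hM p x hx; exact ⟨0, Subsingleton.elim _ _⟩
  | cons g gs ih =>
    intro M hM p x hx
    rw [← (pr _ _ _ _).map_eq_zero_iff, pr_dX, Prod.mk_eq_zero] at hx
    obtain ⟨a', ha'⟩ := ih hM p _ hx.1
    have h2 := hx.2
    rw [← ha', cmap_d, sub_eq_zero] at h2
    have h3 : dX gs p (Lz g M) ((pr p g gs M x).2 - cmap gs p (etaz g M) a') = 0 := by
      rw [map_sub, h2, sub_self]
    cases p with
    | zero =>
      rw [dX0_iff] at h3
      obtain ⟨z, hz, hz'⟩ := hM.surj g gs _ h3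
      refine ⟨(z0 _ _).symm (z0 _ _ a' + z), (pr _ _ _ _).injective ?_⟩
      rw [pr_dX0, LinearEquiv.apply_symm_apply]
      refine Prod.ext ?_ ?_
      · dsimp only
        rw [map_add, map_add, LinearEquiv.symm_apply_apply, ha', (dX0_iff _ _ _).2 (by simpa using hz),
          add_zero]
      · dsimp only
        rw [map_add (etaz g M), hz', ← z0_cmap, ← map_add, add_sub_cancel, LinearEquiv.symm_apply_apply]
    | succ p =>
      obtain ⟨b', hb'⟩ := ih (hM.lz g) p _ h3
      refine ⟨(pr _ _ _ _).symm (a', - b'), (pr _ _ _ _).injective ?_⟩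
      rw [pr_dX, LinearEquiv.apply_symm_apply]
      refine Prod.ext ha' ?_
      dsimp only
      rw [map_neg, hb']
      abel

lemma tors_iff (gs : List R) {M : Type w} [AddCommGroup M] [Module R M] (x : M) :
    Tors gs x ↔ ∃ k : ℕ, ∀ a ∈ (Ideal.span {g | g ∈ gs}) ^ k, a • x = 0 := by
  constructor
  · intro h
    obtain ⟨n, hn⟩ := Ideal.exists_pow_le_of_le_radical_of_fg
      (I := Ideal.span {g | g ∈ gs}) (J := LinearMap.ker (LinearMap.toSpanSingleton R M x)) (by
        rw [Ideal.span_le]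
        intro g hg
        obtain ⟨n, hn⟩ := h g hg
        exact ⟨n, by simpa using hn⟩) (by classical exact ⟨gs.toFinset, by simp⟩)
    exact ⟨n, fun a ha => by simpa using hn ha⟩
  · rintro ⟨k, hk⟩ g hg
    exact ⟨k, hk _ (Ideal.pow_mem_pow (Ideal.subset_span (show g ∈ {g | g ∈ gs} from hg)) k)⟩

lemma Acyc.of_baer [IsNoetherianRing R] (J : ModuleCat.{w} R) (hJ : Module.Baer R J) : Acyc J := by
  intro gs g x hx
  obtain ⟨k, hk⟩ := (tors_iff gs x).1 hx
  set I := Ideal.span {g | g ∈ gs}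
  -- stabilization of annihilators
  obtain ⟨m, hm⟩ := monotone_stabilizes_iff_noetherian.2 (inferInstanceAs (IsNoetherian R R))
    ⟨fun n => LinearMap.ker (LinearMap.toSpanSingleton R R (g ^ n)), by
      intro a b hab y hy
      simp only [LinearMap.mem_ker, LinearMap.toSpanSingleton_apply, smul_eq_mul] at hy ⊢
      rw [← Nat.add_sub_cancel' hab, pow_add, ← mul_assoc, hy, zero_mul]⟩
  have hm' : ∀ r, r * g ^ (m + 1) = 0 → r * g ^ m = 0 := by
    intro r hr
    have := hm (m + 1) (by omega)
    have h2 : r ∈ LinearMap.ker (LinearMap.toSpanSingleton R R (g ^ (m + 1))) := by simpa using hr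
    have h3 : r ∈ LinearMap.ker (LinearMap.toSpanSingleton R R (g ^ m)) := by
      exact this.ge h2
    simpa using h3
  obtain ⟨c, hc⟩ := Ideal.exists_pow_inf_eq_pow_smul I (M := R) (Ideal.span {g ^ (m + 1)})
  have hAR : ∀ y ∈ I ^ (c + k), y ∈ Ideal.span {g ^ (m + 1)} → ∃ b ∈ I ^ k, y = b * g ^ (m + 1) := by
    intro y hy hy'
    have h1 : y ∈ I ^ (c + k) • (⊤ : Submodule R R) ⊓ Ideal.span {g ^ (m + 1)} := by
      refine ⟨?_, hy'⟩
      simpa using hy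
    rw [hc _ (by omega), Nat.add_sub_cancel_left] at h1
    have h2 : y ∈ I ^ k * Ideal.span {g ^ (m + 1)} := by
      have : I ^ k • (I ^ c • (⊤ : Submodule R R) ⊓ Ideal.span {g ^ (m + 1)}) ≤
        I ^ k • (Ideal.span {g ^ (m + 1)} : Submodule R R) := Submodule.smul_mono le_rfl inf_le_right
      exact this h1
    rw [Ideal.mem_mul_span_singleton] at h2
    obtain ⟨b, hb, rfl⟩ := h2
    exact ⟨b, hb, rfl⟩
  let α : R × (I ^ (c + k) : Ideal R) →ₗ[R] R :=
    LinearMap.coprod (LinearMap.toSpanSingleton R R (g ^ (m + 1))) (Submodule.subtype _)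
  let ψ : R × (I ^ (c + k) : Ideal R) →ₗ[R] J :=
    LinearMap.toSpanSingleton R J (g ^ m • x) ∘ₗ LinearMap.fst R R _
  have hker : LinearMap.ker α ≤ LinearMap.ker ψ := by
    rintro ⟨r, a⟩ hra
    simp only [LinearMap.mem_ker, α, LinearMap.coprod_apply, LinearMap.toSpanSingleton_apply,
      smul_eq_mul, Submodule.subtype_apply] at hra
    have hr : r * g ^ (m + 1) ∈ I ^ (c + k) := by
      rw [eq_neg_of_add_eq_zero_left hra]
      exact neg_mem a.2
    obtain ⟨b, hb, hb'⟩ := hAR _ hr (Ideal.mem_span_singleton'.2 ⟨r, rfl⟩)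
    have h5 := hm' (r - b) (by rw [sub_mul, hb', sub_self])
    rw [sub_mul, sub_eq_zero] at h5
    simp only [LinearMap.mem_ker, ψ, LinearMap.comp_apply, LinearMap.fst_apply,
      LinearMap.toSpanSingleton_apply]
    rw [← mul_smul, h5, mul_comm, mul_smul, hk b hb, smul_zero]
  let φ : LinearMap.range α →ₗ[R] J :=
    ((LinearMap.ker α).liftQ ψ hker) ∘ₗ α.quotKerEquivRange.symm.toLinearMap
  have hφ : ∀ z, φ ⟨α z, z, rfl⟩ = ψ z := by
    intro z
    have : (⟨α z, z, rfl⟩ : LinearMap.range α) = α.quotKerEquivRange (Submodule.Quotient.mk z) := rfl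
    rw [this]
    simp [φ]
  obtain ⟨e, he⟩ := hJ (LinearMap.range α) φ
  have he' : ∀ z, α z • e 1 = ψ z := by
    intro z
    rw [← hφ, ← he _ ⟨z, rfl⟩, ← map_smul, smul_eq_mul, mul_one]
  refine ⟨e 1, ?_, m, ?_⟩
  · rw [tors_iff]
    refine ⟨c + k, fun a ha => ?_⟩
    have := he' (0, ⟨a, ha⟩)
    simpa only [α, ψ, LinearMap.coprod_apply, map_zero, zero_add, Submodule.subtype_apply,
      LinearMap.comp_apply, LinearMap.fst_apply] using this
  · have := he' (1, 0)
    rw [smul_sub, sub_eq_zero, ← mul_smul, ← pow_succ]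
    simpa only [α, ψ, LinearMap.coprod_apply, map_zero, add_zero, LinearMap.toSpanSingleton_apply,
      LinearMap.comp_apply, LinearMap.fst_apply, one_smul] using this
end
end BSLC

namespace BSLC
universe w
section
variable {R : Type w} [CommRing R]

lemma rel_equiv {A B : Type*} [AddCommGroup A] [Module R A] [AddCommGroup B] [Module R B]
    (S : Submodule R A) (T : Submodule R B) (W : Submodule R (A × B)) (h1 : ∀ a, ∃ b, (a, b) ∈ W)
    (h2 : ∀ b, ∃ a, (a, b) ∈ W) (h3 : ∀ a b, (a, b) ∈ W → (a ∈ S ↔ b ∈ T)) :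
    Nonempty ((A ⧸ S) ≃ₗ[R] (B ⧸ T)) := by
  let p : W →ₗ[R] (A ⧸ S) := S.mkQ ∘ₗ LinearMap.fst R A B ∘ₗ W.subtype
  let q : W →ₗ[R] (B ⧸ T) := T.mkQ ∘ₗ LinearMap.snd R A B ∘ₗ W.subtype
  have hp : Function.Surjective p := by
    intro y
    obtain ⟨a, rfl⟩ := S.mkQ_surjective y
    obtain ⟨b, hb⟩ := h1 a
    exact ⟨⟨(a, b), hb⟩, rfl⟩
  have hq : Function.Surjective q := by
    intro y
    obtain ⟨b, rfl⟩ := T.mkQ_surjective y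
    obtain ⟨a, ha⟩ := h2 b
    exact ⟨⟨(a, b), ha⟩, rfl⟩
  have hk : LinearMap.ker p = LinearMap.ker q := by
    ext ⟨⟨a, b⟩, hw⟩
    simp only [LinearMap.mem_ker, p, q, LinearMap.comp_apply, Submodule.subtype_apply,
      LinearMap.fst_apply, LinearMap.snd_apply, Submodule.mkQ_apply, Submodule.Quotient.mk_eq_zero]
    exact h3 a b hw
  exact ⟨(p.quotKerEquivOfSurjective hp).symm ≪≫ₗ Submodule.quotEquivOfEq _ _ hk ≪≫ₗ
    q.quotKerEquivOfSurjective hq⟩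

open CategoryTheory

lemma cech_shift {M J Z : ModuleCat.{w} R} (f : M →ₗ[R] J) (q : J →ₗ[R] Z) (hf : Function.Injective f)
    (hq : Function.Surjective q) (hfq : Function.Exact f q) (hJ : Acyc J) (gs : List R) (i : ℕ) :
    Nonempty (HX gs (i + 1) Z ≃ₗ[R] HX gs (i + 2) M) := by
  let W : Submodule R (LinearMap.ker (dX gs (i + 1) Z) × LinearMap.ker (dX gs (i + 2) M)) :=
    { carrier := {w | ∃ j : CX (i + 1) gs J, cmap gs (i + 1) q j = w.1 ∧ dX gs (i + 1) J j =
        cmap gs (i + 2) f w.2}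
      add_mem' := by
        rintro a b ⟨j, h1, h2⟩ ⟨j', h1', h2'⟩
        exact ⟨j + j', by simp [h1, h1'], by simp [h2, h2']⟩
      zero_mem' := ⟨0, by simp, by simp⟩
      smul_mem' := by
        rintro c a ⟨j, h1, h2⟩
        exact ⟨c • j, by rw [map_smul, h1]; rfl, by rw [map_smul, h2, ← map_smul]; rfl⟩ }
  refine rel_equiv _ _ W ?_ ?_ ?_
  · rintro ⟨z, hz⟩
    obtain ⟨j, hj⟩ := cmap_surj gs (i + 1) q hq z
    obtain ⟨b, hb⟩ := (cmap_exact gs (i + 2) f q hfq (dX gs (i + 1) J j)).1 (by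
      rw [cmap_d, hj]; exact hz)
    refine ⟨⟨b, cmap_inj gs (i + 3) f hf ?_⟩, j, hj, hb.symm⟩
    rw [cmap_d, hb, dX_dX, map_zero]
  · rintro ⟨b, hb⟩
    obtain ⟨j, hj⟩ := hJ.vanish gs (i + 1) (cmap gs (i + 2) f b) (by
      rw [← cmap_d, LinearMap.mem_ker.1 hb, map_zero])
    refine ⟨⟨cmap gs (i + 1) q j, ?_⟩, j, rfl, hj⟩
    rw [LinearMap.mem_ker, ← cmap_d, hj]
    exact (cmap_exact gs (i + 2) f q hfq _).2 ⟨b, rfl⟩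
  · rintro ⟨z, hz⟩ ⟨b, hb⟩ ⟨j, hj, hj'⟩
    dsimp only at hj hj'
    constructor
    · rintro ⟨z', hz'⟩
      change dX gs i Z z' = z at hz'
      obtain ⟨j', rfl⟩ := cmap_surj gs i q hq z'
      obtain ⟨m, hm⟩ := (cmap_exact gs (i + 1) f q hfq (j - dX gs i J j')).1 (by
        rw [map_sub, hj, cmap_d, hz', sub_self])
      refine ⟨m, cmap_inj gs (i + 2) f hf ?_⟩
      rw [cmap_d, hm, map_sub, dX_dX, sub_zero, hj']
      rfl
    · rintro ⟨m, hm⟩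
      change dX gs (i + 1) M m = b at hm
      obtain ⟨j', hj''⟩ := hJ.vanish gs i (j - cmap gs (i + 1) f m) (by
        rw [map_sub, ← cmap_d, hm, hj', sub_self])
      refine ⟨cmap gs i q j', ?_⟩
      change dX gs i Z (cmap gs i q j') = z
      rw [← cmap_d, hj'', map_sub, hj, (cmap_exact gs (i + 1) f q hfq _).2 ⟨m, rfl⟩, sub_zero]

lemma cech_one {M J Z : ModuleCat.{w} R} (f : M →ₗ[R] J) (q : J →ₗ[R] Z) (hf : Function.Injective f)
    (hq : Function.Surjective q) (hfq : Function.Exact f q) (hJ : Acyc J) (gs : List R)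
    {L0J L0Z L1M : Type w} [AddCommGroup L0J] [Module R L0J] [AddCommGroup L0Z] [Module R L0Z]
    [AddCommGroup L1M] [Module R L1M] (eJ : L0J →ₗ[R] J) (eZ : L0Z →ₗ[R] Z) (heZ : Function.Injective eZ)
    (hJr : ∀ x, (∃ y, eJ y = x) ↔ Tors gs x) (hZr : ∀ x, (∃ y, eZ y = x) ↔ Tors gs x)
    (Lq : L0J →ₗ[R] L0Z) (hLq : ∀ x, eZ (Lq x) = q (eJ x)) (D : L0Z →ₗ[R] L1M)
    (hD : Function.Surjective D) (hDq : ∀ x, D x = 0 ↔ ∃ y, Lq y = x) :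
    Nonempty (L1M ≃ₗ[R] HX gs 1 M) := by
  let W : Submodule R (L1M × LinearMap.ker (dX gs 1 M)) :=
    { carrier := {w | ∃ (ζ : L0Z) (j : CX 0 gs J), D ζ = w.1 ∧ eZ ζ = z0 gs Z (cmap gs 0 q j) ∧
        dX gs 0 J j = cmap gs 1 f w.2}
      add_mem' := by
        rintro a b ⟨ζ, j, h1, h2, h3⟩ ⟨ζ', j', h1', h2', h3'⟩
        exact ⟨ζ + ζ', j + j', by simp [h1, h1'], by rw [map_add, h2, h2', map_add, map_add],
          by simp [h3, h3']⟩
      zero_mem' := ⟨0, 0, by simp, by rw [map_zero, map_zero, map_zero], by simp⟩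
      smul_mem' := by
        rintro c a ⟨ζ, j, h1, h2, h3⟩
        exact ⟨c • ζ, c • j, by rw [map_smul, h1]; rfl, by rw [map_smul, h2, map_smul, map_smul],
          by rw [map_smul, h3, ← map_smul]; rfl⟩ }
  obtain ⟨e⟩ := rel_equiv (⊥ : Submodule R L1M) ((BX gs 1 M).comap (LinearMap.ker (dX gs 1 M)).subtype)
    W (by
    intro a
    obtain ⟨ζ, rfl⟩ := hD a
    obtain ⟨j, hj⟩ := cmap_surj gs 0 q hq ((z0 gs Z).symm (eZ ζ))
    obtain ⟨b, hb⟩ := (cmap_exact gs 1 f q hfq (dX gs 0 J j)).1 (by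
      rw [cmap_d, hj, dX0_iff, LinearEquiv.apply_symm_apply]
      exact (hZr _).1 ⟨_, rfl⟩)
    refine ⟨⟨b, cmap_inj gs 2 f hf ?_⟩, ζ, j, rfl, by rw [hj, LinearEquiv.apply_symm_apply], hb.symm⟩
    rw [cmap_d, hb, dX_dX, map_zero]) (by
    rintro ⟨b, hb⟩
    obtain ⟨j, hj⟩ := hJ.vanish gs 0 (cmap gs 1 f b) (by
      rw [← cmap_d, LinearMap.mem_ker.1 hb, map_zero])
    have hz : dX gs 0 Z (cmap gs 0 q j) = 0 := by
      rw [← cmap_d, hj]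
      exact (cmap_exact gs 1 f q hfq _).2 ⟨b, rfl⟩
    rw [dX0_iff] at hz
    obtain ⟨ζ, hζ⟩ := (hZr _).2 hz
    exact ⟨D ζ, ζ, j, rfl, hζ, hj⟩) (by
    rintro a ⟨b, hb⟩ ⟨ζ, j, rfl, h2, h3⟩
    dsimp only at h2 h3
    constructor
    · intro h
      rw [Submodule.mem_bot, hDq] at h
      obtain ⟨ξ, rfl⟩ := h
      have hj' : dX gs 0 J ((z0 gs J).symm (eJ ξ)) = 0 := by
        rw [dX0_iff, LinearEquiv.apply_symm_apply]
        exact (hJr _).1 ⟨_, rfl⟩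
      obtain ⟨m, hm⟩ := (cmap_exact gs 0 f q hfq (j - (z0 gs J).symm (eJ ξ))).1 (by
        apply (z0 gs Z).injective
        rw [map_sub, map_sub, ← h2, hLq, z0_cmap, LinearEquiv.apply_symm_apply, sub_self, map_zero])
      refine ⟨m, cmap_inj gs 1 f hf ?_⟩
      rw [cmap_d, hm, map_sub, hj', sub_zero, h3]
      rfl
    · rintro ⟨m, hm⟩
      change dX gs 0 M m = b at hm
      have h4 : dX gs 0 J (j - cmap gs 0 f m) = 0 := by
        rw [map_sub, ← cmap_d, hm, h3, sub_self]
      rw [dX0_iff, ← hJr] at h4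
      obtain ⟨ξ, hξ⟩ := h4
      rw [Submodule.mem_bot, hDq]
      refine ⟨ξ, heZ ?_⟩
      rw [hLq, hξ, h2, ← z0_cmap, map_sub, (cmap_exact gs 0 f q hfq _).2 ⟨m, rfl⟩, sub_zero])
  exact ⟨(Submodule.quotEquivOfEqBot _ rfl).symm ≪≫ₗ e⟩

lemma cech_zero {M : ModuleCat.{w} R} (gs : List R)
    {L0M : Type w} [AddCommGroup L0M] [Module R L0M]
    (eM : L0M →ₗ[R] M) (heM : Function.Injective eM)
    (hMr : ∀ x, (∃ y, eM y = x) ↔ Tors gs x) :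
    Nonempty (L0M ≃ₗ[R] HX gs 0 M) := by
  let W : Submodule R (L0M × LinearMap.ker (dX gs 0 M)) :=
    { carrier := {w | eM w.1 = z0 gs M w.2}
      add_mem' := by
        intro a b h h'
        change eM _ = z0 gs M _ at h h'
        change eM (a.1 + b.1) = z0 gs M (a.2.1 + b.2.1)
        rw [map_add, map_add, h, h']
      zero_mem' := by
        change eM 0 = z0 gs M 0
        rw [map_zero, map_zero]
      smul_mem' := by
        intro c a h
        change eM _ = z0 gs M _ at h
        change eM (c • a.1) = z0 gs M (c • a.2.1)
        rw [map_smul, map_smul, h] }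
  obtain ⟨e⟩ := rel_equiv (⊥ : Submodule R L0M) ((BX gs 0 M).comap (LinearMap.ker (dX gs 0 M)).subtype)
    W (by
    intro a
    refine ⟨⟨(z0 gs M).symm (eM a), ?_⟩, ?_⟩
    · rw [LinearMap.mem_ker, dX0_iff, LinearEquiv.apply_symm_apply]
      exact (hMr _).1 ⟨_, rfl⟩
    · change eM a = z0 gs M _
      rw [LinearEquiv.apply_symm_apply]) (by
    rintro ⟨b, hb⟩
    rw [LinearMap.mem_ker, dX0_iff, ← hMr] at hb
    obtain ⟨a, ha⟩ := hb
    exact ⟨a, ha⟩) (by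
    rintro a ⟨b, hb⟩ h
    change eM a = z0 gs M b at h
    rw [Submodule.mem_bot, Submodule.mem_comap, BX, Submodule.mem_bot]
    change a = 0 ↔ b = 0
    rw [← (z0 gs M).map_eq_zero_iff, ← h, map_eq_zero_iff _ heM])
  exact ⟨(Submodule.quotEquivOfEqBot _ rfl).symm ≪≫ₗ e⟩

theorem lc_equiv [IsNoetherianRing R] (gs : List R) (L : ℕ → (ModuleCat.{w} R ⥤ ModuleCat.{w} R))
    (ε : L 0 ⟶ 𝟭 _) (hε : ∀ M, Function.Injective (ε.app M))
    (hεr : ∀ M : ModuleCat.{w} R, ∀ x : M, (∃ y, ε.app M y = x) ↔ Tors gs x)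
    (hD : ∀ (M J Z : ModuleCat.{w} R) (f : M ⟶ J) (q : J ⟶ Z) (_ : Injective J)
      (_ : Function.Injective f) (_ : Function.Surjective q) (_ : Function.Exact f q) (i : ℕ),
      ∃ D : (L i).obj Z ⟶ (L (i + 1)).obj M, Function.Surjective D ∧
        ∀ x, D x = 0 ↔ ∃ y, (L i).map q y = x)
    (hv : ∀ (J : ModuleCat.{w} R) (_ : Injective J) (i : ℕ) (x : (L (i + 1)).obj J), x = 0) (i : ℕ) :
    ∀ M, Nonempty ((L i).obj M ≃ₗ[R] HX gs i M) := by
  have key : ∀ M : ModuleCat.{w} R, ∃ (J Z : ModuleCat.{w} R) (f : M ⟶ J) (q : J ⟶ Z), Injective J ∧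
      Function.Injective f ∧ Function.Surjective q ∧ Function.Exact f q := by
    intro M
    refine ⟨Injective.under M, ModuleCat.of R ((Injective.under M : ModuleCat.{w} R) ⧸ LinearMap.range (Injective.ι M).hom),
      Injective.ι M, ModuleCat.ofHom (Submodule.mkQ _), inferInstance,
      (ModuleCat.mono_iff_injective _).1 inferInstance, Submodule.mkQ_surjective _, ?_⟩
    intro y
    change Submodule.mkQ _ y = 0 ↔ _
    rw [Submodule.mkQ_apply, Submodule.Quotient.mk_eq_zero]
    rfl
  have hac : ∀ J : ModuleCat.{w} R, Injective J → Acyc J := by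
    intro J hJ
    apply Acyc.of_baer
    have : Injective (ModuleCat.of R J) := hJ
    exact Module.Baer.of_injective (Module.injective_module_of_injective_object R J)
  induction i with
  | zero => intro M; exact cech_zero gs (ε.app M).hom (hε M) (hεr M)
  | succ i ih =>
    intro M
    obtain ⟨J, Z, f, q, hJ, hf, hq, hfq⟩ := key M
    obtain ⟨D, hDs, hDk⟩ := hD M J Z f q hJ hf hq hfq i
    cases i with
    | zero =>
      refine cech_one f.hom q.hom hf hq hfq (hac J hJ) gs (ε.app J).hom (ε.app Z).hom (hε Z) (hεr J)
        (hεr Z) ((L 0).map q).hom ?_ D.hom hDs hDk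
      intro x
      have := congrArg (fun φ => φ.hom x) (ε.naturality q)
      exact this
    | succ i =>
      obtain ⟨e⟩ := ih Z
      obtain ⟨e'⟩ := cech_shift f.hom q.hom hf hq hfq (hac J hJ) gs i
      have hDi : Function.Injective D.hom := by
        rw [injective_iff_map_eq_zero]
        intro x hx
        obtain ⟨y, rfl⟩ := (hDk x).1 hx
        rw [hv J hJ i y, map_zero]
      exact ⟨(LinearEquiv.ofBijective D.hom ⟨hDi, hDs⟩).symm ≪≫ₗ e ≪≫ₗ e'⟩
end
end BSLC

namespace BSLC
open CategoryTheory
section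
variable {C : Type*} [Category* C] [Abelian C] [HasProjectiveResolutions C]
  {D : Type*} [Category* D] [Abelian D]

/-- the short complex of complexes -/
noncomputable abbrev scX {F G H : C ⥤ D} [F.Additive] [G.Additive] [H.Additive] (α : F ⟶ G) (β : G ⟶ H)
    (h0 : α ≫ β = 0) (K : ChainComplex C ℕ) : ShortComplex (ChainComplex D ℕ) :=
  ShortComplex.mk ((NatTrans.mapHomologicalComplex α (ComplexShape.down ℕ)).app K)
    ((NatTrans.mapHomologicalComplex β (ComplexShape.down ℕ)).app K) (by
      ext i
      exact congrArg (fun t => NatTrans.app t (K.X i)) h0)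

lemma scX_short {F G H : C ⥤ D} [F.Additive] [G.Additive] [H.Additive] (α : F ⟶ G) (β : G ⟶ H)
    (h0 : α ≫ β = 0) (hS : ∀ (P : C), Projective P →
      (ShortComplex.mk (α.app P) (β.app P) (congrArg (fun t => NatTrans.app t P) h0)).ShortExact)
    {X : C} (P : ProjectiveResolution X) : (scX α β h0 P.complex).ShortExact :=
  HomologicalComplex.shortExact_of_degreewise_shortExact _ (fun i => hS _ (P.projective i))

/-- morphisms of short complexes -/
noncomputable def scXmap {F G H : C ⥤ D} [F.Additive] [G.Additive] [H.Additive] (α : F ⟶ G) (β : G ⟶ H)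
    (h0 : α ≫ β = 0) {K L : ChainComplex C ℕ} (φ : K ⟶ L) : scX α β h0 K ⟶ scX α β h0 L where
  τ₁ := (F.mapHomologicalComplex _).map φ
  τ₂ := (G.mapHomologicalComplex _).map φ
  τ₃ := (H.mapHomologicalComplex _).map φ
  comm₁₂ := ((NatTrans.mapHomologicalComplex α (ComplexShape.down ℕ)).naturality φ)
  comm₂₃ := ((NatTrans.mapHomologicalComplex β (ComplexShape.down ℕ)).naturality φ)

/-- typed version of the comparison isomorphism -/
noncomputable def eL (F : C ⥤ D) [F.Additive] (n : ℕ) {X : C} (P : ProjectiveResolution X) :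
    (F.leftDerived n).obj X ≅
      ((F.mapHomologicalComplex (ComplexShape.down ℕ)).obj P.complex).homology n :=
  P.isoLeftDerivedObj F n

lemma eL_nat (F : C ⥤ D) [F.Additive] (n : ℕ) {X Y : C} (f : X ⟶ Y) (P : ProjectiveResolution X)
    (Q : ProjectiveResolution Y) : (F.leftDerived n).map f ≫ (eL F n Q).hom =
      (eL F n P).hom ≫ HomologicalComplex.homologyMap ((F.mapHomologicalComplex _).map
        (ProjectiveResolution.lift f P Q)) n :=
  ProjectiveResolution.isoLeftDerivedObj_hom_naturality f P Q (ProjectiveResolution.lift f P Q)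
    (ProjectiveResolution.lift_commutes_zero f P Q) F n

lemma eL_app {F G : C ⥤ D} [F.Additive] [G.Additive] (α : F ⟶ G) {X : C} (P : ProjectiveResolution X)
    (n : ℕ) : (NatTrans.leftDerived α n).app X ≫ (eL G n P).hom = (eL F n P).hom ≫
      HomologicalComplex.homologyMap ((NatTrans.mapHomologicalComplex α _).app P.complex) n := by
  rw [ProjectiveResolution.leftDerived_app_eq α P]
  refine (Category.assoc _ _ _).trans ?_
  congr 1
  refine (Category.assoc _ _ _).trans ?_
  refine (congrArg (_ ≫ ·) (Iso.inv_hom_id _)).trans ?_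
  exact Category.comp_id _

section conn
variable {F G H : C ⥤ D} [F.Additive] [G.Additive] [H.Additive] (α : F ⟶ G) (β : G ⟶ H)
    (h0 : α ≫ β = 0) (hS : ∀ (P : C), Projective P →
      (ShortComplex.mk (α.app P) (β.app P) (congrArg (fun t => NatTrans.app t P) h0)).ShortExact)
    (i : ℕ)

/-- typed connecting map -/
noncomputable def dl {X : C} (P : ProjectiveResolution X) :
    ((H.mapHomologicalComplex (ComplexShape.down ℕ)).obj P.complex).homology (i + 1) ⟶
      ((F.mapHomologicalComplex (ComplexShape.down ℕ)).obj P.complex).homology i :=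
  (scX_short α β h0 hS P).δ (i + 1) i (by simp)

lemma dl_nat {X Y : C} (P : ProjectiveResolution X) (Q : ProjectiveResolution Y)
    (φ : P.complex ⟶ Q.complex) : dl α β h0 hS i P ≫
      HomologicalComplex.homologyMap ((F.mapHomologicalComplex _).map φ) i =
      HomologicalComplex.homologyMap ((H.mapHomologicalComplex _).map φ) (i + 1) ≫ dl α β h0 hS i Q :=
  HomologicalComplex.HomologySequence.δ_naturality (scXmap α β h0 φ)
      (scX_short α β h0 hS P) (scX_short α β h0 hS Q) (i + 1) i (by simp)

/-- connecting transformation -/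
noncomputable def conn : H.leftDerived (i + 1) ⟶ F.leftDerived i where
  app X := (eL H (i + 1) (projectiveResolution X)).hom ≫
    dl α β h0 hS i (projectiveResolution X) ≫ (eL F i (projectiveResolution X)).inv
  naturality X Y f := by
    have h1 := eL_nat H (i + 1) f (projectiveResolution X) (projectiveResolution Y)
    have h2 := eL_nat F i f (projectiveResolution X) (projectiveResolution Y)
    rw [← cancel_mono (eL F i (projectiveResolution Y)).hom]
    simp only [Category.assoc, Iso.inv_hom_id, Category.comp_id]
    rw [h2, Iso.inv_hom_id_assoc, dl_nat, reassoc_of% h1]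

lemma conn_hom {X : C} : (conn α β h0 hS i).app X ≫ (eL F i (projectiveResolution X)).hom =
    (eL H (i + 1) (projectiveResolution X)).hom ≫ dl α β h0 hS i (projectiveResolution X) := by
  simp [conn]

lemma conn_exact₁ (X : C) : ∃ h, (ShortComplex.mk ((conn α β h0 hS i).app X)
      ((NatTrans.leftDerived α i).app X) h).Exact := by
  have hS' := scX_short α β h0 hS (projectiveResolution X)
  have hc : dl α β h0 hS i (projectiveResolution X) ≫ HomologicalComplex.homologyMap
    ((NatTrans.mapHomologicalComplex α (ComplexShape.down ℕ)).app (projectiveResolution X).complex) i = 0 :=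
    hS'.δ_comp (i + 1) i (by simp)
  have he : (ShortComplex.mk _ _ hc).Exact := hS'.homology_exact₁ (i + 1) i (by simp)
  have hz : (conn α β h0 hS i).app X ≫ (NatTrans.leftDerived α i).app X = 0 := by
    rw [← cancel_mono (eL G i (projectiveResolution X)).hom, Category.assoc, eL_app,
      reassoc_of% (conn_hom α β h0 hS i (X := X)), hc, Limits.comp_zero, Limits.zero_comp]
  refine ⟨hz, (ShortComplex.exact_iff_of_iso ?_).2 he⟩
  exact ShortComplex.isoMk (eL H (i + 1) (projectiveResolution X)) (eL F i (projectiveResolution X))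
    (eL G i (projectiveResolution X)) (conn_hom α β h0 hS i).symm (eL_app α _ i).symm

lemma conn_mono (X : C) (hG : Limits.IsZero ((G.leftDerived (i + 1)).obj X)) :
    Mono ((conn α β h0 hS i).app X) := by
  have hS' := scX_short α β h0 hS (projectiveResolution X)
  have h3 := hS'.homology_exact₃ (i + 1) i (by simp)
  have hz : Limits.IsZero ((scX α β h0 (projectiveResolution X).complex).X₂.homology (i + 1)) :=
    hG.of_iso (eL G (i + 1) (projectiveResolution X)).symm
  have hm : Mono (dl α β h0 hS i (projectiveResolution X)) := h3.mono_g (hz.eq_of_src _ _)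
  rw [conn]
  infer_instance
end conn

lemma from_natural {F G : C ⥤ D} [F.Additive] [G.Additive] (α : F ⟶ G) (X : C) :
    F.fromLeftDerivedZero.app X ≫ α.app X =
      (NatTrans.leftDerived α 0).app X ≫ G.fromLeftDerivedZero.app X := by
  have hF : F.fromLeftDerivedZero.app X = (eL F 0 (projectiveResolution X)).hom ≫
    HomologicalComplex.homologyι _ 0 ≫ (projectiveResolution X).fromLeftDerivedZero' F :=
    (projectiveResolution X).fromLeftDerivedZero_eq F
  have hG : G.fromLeftDerivedZero.app X = (eL G 0 (projectiveResolution X)).hom ≫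
    HomologicalComplex.homologyι _ 0 ≫ (projectiveResolution X).fromLeftDerivedZero' G :=
    (projectiveResolution X).fromLeftDerivedZero_eq G
  have h1 : (projectiveResolution X).fromLeftDerivedZero' F ≫ α.app X = HomologicalComplex.opcyclesMap
      ((NatTrans.mapHomologicalComplex α (ComplexShape.down ℕ)).app (projectiveResolution X).complex) 0 ≫
        (projectiveResolution X).fromLeftDerivedZero' G := by
    rw [← cancel_epi (HomologicalComplex.pOpcycles _ _),
      ProjectiveResolution.pOpcycles_comp_fromLeftDerivedZero'_assoc,
      HomologicalComplex.p_opcyclesMap_assoc,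
      ProjectiveResolution.pOpcycles_comp_fromLeftDerivedZero']
    exact α.naturality _
  rw [hF, hG, Category.assoc, Category.assoc, h1, reassoc_of% (eL_app α (projectiveResolution X) 0),
    HomologicalComplex.homologyι_naturality_assoc]
end
end BSLC

namespace BSLC
open CategoryTheory
section
variable {R : Type u} [CommRing R]

/-- Hom into Y, opposite -/
noncomputable abbrev FY (Y : ModuleCat.{u} R) : ModuleCat.{u} R ⥤ (ModuleCat.{u} R)ᵒᵖ :=
  ((linearYoneda R (ModuleCat.{u} R)).obj Y).rightOp

/-- functoriality -/
noncomputable abbrev FYm {Y Z : ModuleCat.{u} R} (f : Y ⟶ Z) : FY Z ⟶ FY Y :=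
  NatTrans.rightOp ((linearYoneda R (ModuleCat.{u} R)).map f)

lemma FYm_zero {M J Z : ModuleCat.{u} R} (f : M ⟶ J) (q : J ⟶ Z) (h : f ≫ q = 0) :
    FYm q ≫ FYm f = 0 := by
  ext X
  apply Quiver.Hom.unop_inj
  ext (x : X ⟶ M)
  change (x ≫ f) ≫ q = 0
  rw [Category.assoc, h, Limits.comp_zero]

lemma FY_short {M J Z : ModuleCat.{u} R} (f : M ⟶ J) (q : J ⟶ Z) (h : f ≫ q = 0)
    (hf : Function.Injective f) (hq : Function.Surjective q) (he : Function.Exact f q)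
    (P : ModuleCat.{u} R) (hP : Projective P) :
    (ShortComplex.mk ((FYm q).app P) ((FYm f).app P)
      (congrArg (fun t => NatTrans.app t P) (FYm_zero f q h))).ShortExact := by
  have hfm : Mono f := (ModuleCat.mono_iff_injective f).2 hf
  have hqe : Epi q := (ModuleCat.epi_iff_surjective q).2 hq
  have hex : (ShortComplex.mk f q h).Exact := by
    rw [ShortComplex.moduleCat_exact_iff]
    intro x hx
    exact (he x).1 hx
  let S : ShortComplex (ModuleCat.{u} R) := ShortComplex.mk
    (((linearYoneda R (ModuleCat.{u} R)).map f).app (Opposite.op P))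
    (((linearYoneda R (ModuleCat.{u} R)).map q).app (Opposite.op P)) (by
      ext (x : P ⟶ M)
      change (x ≫ f) ≫ q = 0
      rw [Category.assoc, h, Limits.comp_zero])
  have hS : S.ShortExact := by
    refine ShortComplex.ShortExact.mk' ?_ ?_ ?_
    · rw [ShortComplex.moduleCat_exact_iff]
      intro (x : P ⟶ J) (hx : x ≫ q = 0)
      exact ⟨hex.lift x hx, hex.lift_f x hx⟩
    · rw [ModuleCat.mono_iff_injective]
      intro (x : P ⟶ M) (y : P ⟶ M) (hx : x ≫ f = y ≫ f)
      exact (cancel_mono f).1 hx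
    · rw [ModuleCat.epi_iff_surjective]
      intro (x : P ⟶ Z)
      exact ⟨Projective.factorThru x q, Projective.factorThru_comp x q⟩
  exact hS.op

lemma FY_zero (J : ModuleCat.{u} R) (hJ : Injective J) (X : ModuleCat.{u} R) (i : ℕ) :
    Limits.IsZero (((FY J).leftDerived (i + 1)).obj X) := by
  let P := projectiveResolution X
  refine Limits.IsZero.of_iso ?_ (eL (FY J) (i + 1) P)
  rw [← HomologicalComplex.exactAt_iff_isZero_homology, HomologicalComplex.exactAt_iff' _ (i+2) (i+1) i (by simp) (by simp)]
  have hP : (ShortComplex.mk _ _ (P.complex.d_comp_d (i+2) (i+1) i)).Exact := P.exact_succ i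
  have hS : (ShortComplex.mk (((linearYoneda R (ModuleCat.{u} R)).obj J).map (P.complex.d (i+1) i).op)
     (((linearYoneda R (ModuleCat.{u} R)).obj J).map (P.complex.d (i+2) (i+1)).op) (by
      rw [← Functor.map_comp, ← op_comp, P.complex.d_comp_d]; exact Functor.map_zero _ _ _)).Exact := by
    rw [ShortComplex.moduleCat_exact_iff]
    intro (x : P.complex.X (i+1) ⟶ J) (hx : P.complex.d (i+2) (i+1) ≫ x = 0)
    exact ⟨hP.descToInjective x hx, hP.comp_descToInjective x hx⟩
  exact hS.op

/-- Ext in the second slot -/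
noncomputable abbrev EXT (i : ℕ) (Y : ModuleCat.{u} R) : (ModuleCat.{u} R)ᵒᵖ ⥤ ModuleCat.{u} R :=
  (Ext R (ModuleCat.{u} R) i).flip.obj Y

lemma EXT_zero (J : ModuleCat.{u} R) (hJ : Injective J) (X) (i : ℕ) :
    Limits.IsZero ((EXT (i + 1) J).obj X) := (FY_zero J hJ X.unop i).unop

lemma EXT_conn {M J Z : ModuleCat.{u} R} (f : M ⟶ J) (q : J ⟶ Z) (hJ : Injective J)
    (hf : Function.Injective f) (hq : Function.Surjective q) (he : Function.Exact f q) (i : ℕ) :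
    ∃ D : EXT i Z ⟶ EXT (i + 1) M, ∀ X, Function.Surjective (D.app X) ∧
      ∀ x, D.app X x = 0 ↔ ∃ y, ((Ext R (ModuleCat.{u} R) i).flip.map q).app X y = x := by
  have h : f ≫ q = 0 := by
    ext x
    exact (he (f x)).2 ⟨x, rfl⟩
  let c := conn (FYm q) (FYm f) (FYm_zero f q h) (FY_short f q h hf hq he) i
  refine ⟨NatTrans.leftOp c, fun X => ⟨?_, ?_⟩⟩
  · have hm : Mono (c.app X.unop) := conn_mono _ _ _ _ i X.unop (FY_zero J hJ X.unop i)
    have : Epi (c.app X.unop).unop := inferInstance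
    exact (ModuleCat.epi_iff_surjective _).1 this
  · obtain ⟨h', hex⟩ := conn_exact₁ (FYm q) (FYm f) (FYm_zero f q h) (FY_short f q h hf hq he) i X.unop
    have := (ShortComplex.ShortExact.moduleCat_exact_iff_function_exact _).1 hex.unop
    exact this
end
end BSLC

namespace BSLC
open CategoryTheory
section
variable {R : Type u} [CommRing R]

instance FY_pres (Y : ModuleCat.{u} R) : Limits.PreservesFiniteColimits (FY Y) := by
  have h1 : Limits.PreservesLimits ((linearYoneda R (ModuleCat.{u} R)).obj Y ⋙ forget _) :=
    (inferInstance : Limits.PreservesLimits (yoneda.obj Y))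
  have h2 : Limits.PreservesLimits ((linearYoneda R (ModuleCat.{u} R)).obj Y) :=
    Limits.preservesLimits_of_reflects_of_preserves _ (forget _)
  have h3 : Limits.PreservesFiniteLimits ((linearYoneda R (ModuleCat.{u} R)).obj Y) := inferInstance
  exact Limits.preservesFiniteColimits_rightOp _

/-- Ext zero is Hom -/
noncomputable def e0 (M : ModuleCat.{u} R) : EXT 0 M ⟶ (linearYoneda R (ModuleCat.{u} R)).obj M :=
  NatTrans.leftOp (FY M).leftDerivedZeroIsoSelf.inv

lemma e0_bij (M : ModuleCat.{u} R) (X) : Function.Bijective ((e0 M).app X) := by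
  have : IsIso ((FY M).leftDerivedZeroIsoSelf.inv.app X.unop).unop := inferInstance
  have h2 : IsIso ((e0 M).app X) := this
  exact ConcreteCategory.bijective_of_isIso _

lemma e0_nat {M N : ModuleCat.{u} R} (f : M ⟶ N) :
    (Ext R (ModuleCat.{u} R) 0).flip.map f ≫ e0 N = e0 M ≫ (linearYoneda R (ModuleCat.{u} R)).map f := by
  have h := fun X => from_natural (FYm f) X
  have h2 : (FY N).leftDerivedZeroIsoSelf.inv ≫ NatTrans.leftDerived (FYm f) 0 =
      FYm f ≫ (FY M).leftDerivedZeroIsoSelf.inv := by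
    rw [Iso.inv_comp_eq, ← Category.assoc, Iso.eq_comp_inv]
    ext X
    exact (h X).symm
  ext X : 2
  exact congrArg (fun t => (NatTrans.app t X.unop).unop) h2

section filt
variable {J : Type} [SmallCategory J] [IsFiltered J]

instance forget_pres0 : Limits.PreservesColimitsOfShape J (forget (ModuleCat.{u} R)) := by
  have : Limits.PreservesFilteredColimitsOfSize.{0, 0} (forget (ModuleCat.{u} R)) :=
    Limits.preservesFilteredColimitsOfSize_shrink _
  exact Limits.PreservesFilteredColimitsOfSize.preserves_filtered_colimits J

lemma colim_rep (F : J ⥤ ModuleCat.{u} R) (x : ↑(Limits.colimit F)) :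
    ∃ j, ∃ y : F.obj j, Limits.colimit.ι F j y = x := Limits.Concrete.colimit_exists_rep F x

lemma colim_map_ι {F G : J ⥤ ModuleCat.{u} R} (φ : F ⟶ G) (j : J) (x : F.obj j) :
    Limits.colim.map φ (Limits.colimit.ι F j x) = Limits.colimit.ι G j (φ.app j x) := by
  have := Limits.colimit.ι_map φ j
  exact ConcreteCategory.congr_hom this x

lemma colim_zero (F : J ⥤ ModuleCat.{u} R) (j : J) (x : F.obj j) (h : Limits.colimit.ι F j x = 0) :
    ∃ (k : J) (t : j ⟶ k), F.map t x = 0 := by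
  have h0 : Limits.colimit.ι F j x = Limits.colimit.ι F j 0 := by rw [h, map_zero]
  obtain ⟨k, f, g, hk⟩ := Limits.Concrete.colimit_exists_of_rep_eq F x 0 h0
  exact ⟨k, f, by rw [hk]; exact map_zero (F.map g).hom⟩

lemma colim_surj {F G : J ⥤ ModuleCat.{u} R} (φ : F ⟶ G) (h : ∀ j, Function.Surjective (φ.app j)) :
    Function.Surjective (Limits.colim.map φ) := by
  intro x
  obtain ⟨j, y, rfl⟩ := colim_rep G x
  obtain ⟨z, rfl⟩ := h j y
  exact ⟨Limits.colimit.ι F j z, colim_map_ι φ j z⟩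

lemma colim_exact {F G H : J ⥤ ModuleCat.{u} R} (φ : F ⟶ G) (ψ : G ⟶ H)
    (h : ∀ j x, ψ.app j x = 0 ↔ ∃ y, φ.app j y = x) (x : ↑(Limits.colim.obj G)) :
    Limits.colim.map ψ x = 0 ↔ ∃ y, Limits.colim.map φ y = x := by
  constructor
  · intro hx
    obtain ⟨j, y, rfl⟩ := colim_rep G x
    rw [colim_map_ι] at hx
    obtain ⟨k, t, hk⟩ := colim_zero H j _ hx
    have h1 : ψ.app k (G.map t y) = 0 := by
      rw [← hk]
      exact ConcreteCategory.congr_hom (ψ.naturality t) y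
    obtain ⟨z, hz⟩ := (h k _).1 h1
    refine ⟨Limits.colimit.ι F k z, ?_⟩
    rw [colim_map_ι, hz]
    exact ConcreteCategory.congr_hom (Limits.colimit.w G t) y
  · rintro ⟨y, rfl⟩
    obtain ⟨j, z, rfl⟩ := colim_rep F y
    rw [colim_map_ι, colim_map_ι, (h j _).2 ⟨z, rfl⟩, map_zero]
end filt

/-- local cohomology, flipped -/
noncomputable def LC (I : Ideal R) (i : ℕ) : ModuleCat.{u} R ⥤ ModuleCat.{u} R :=
  (localCohomology.diagram (localCohomology.idealPowersDiagram I) i).flip ⋙ Limits.colim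

lemma LC_iso (I : Ideal R) (i : ℕ) (M : ModuleCat.{u} R) :
    Nonempty ((localCohomology I i).obj M ≅ (LC I i).obj M) :=
  ⟨(Limits.colimitIsoFlipCompColim
    (localCohomology.diagram (localCohomology.idealPowersDiagram I) i)).app M⟩

lemma LC_conn (I : Ideal R) {M J Z : ModuleCat.{u} R} (f : M ⟶ J) (q : J ⟶ Z) (hJ : Injective J)
    (hf : Function.Injective f) (hq : Function.Surjective q) (he : Function.Exact f q) (i : ℕ) :
    ∃ D : (LC I i).obj Z ⟶ (LC I (i + 1)).obj M, Function.Surjective D ∧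
      ∀ x, D x = 0 ↔ ∃ y, (LC I i).map q y = x := by
  obtain ⟨D, hD⟩ := EXT_conn f q hJ hf hq he i
  let W := (localCohomology.ringModIdeals (localCohomology.idealPowersDiagram I)).op
  exact ⟨Limits.colim.map (Functor.whiskerLeft W D),
    colim_surj (Functor.whiskerLeft W D) (fun j => (hD (W.obj j)).1),
    colim_exact (Functor.whiskerLeft W ((Ext R (ModuleCat.{u} R) i).flip.map q))
      (Functor.whiskerLeft W D) (fun j => (hD (W.obj j)).2)⟩

lemma LC_zero (I : Ideal R) (J : ModuleCat.{u} R) (hJ : Injective J) (i : ℕ)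
    (x : (LC I (i + 1)).obj J) : x = 0 := by
  let W := (localCohomology.ringModIdeals (localCohomology.idealPowersDiagram I)).op
  obtain ⟨j, y, rfl⟩ := colim_rep (W ⋙ EXT (i + 1) J) x
  have hs : Subsingleton ↑((W ⋙ EXT (i + 1) J).obj j) := ModuleCat.subsingleton_of_isZero (EXT_zero J hJ (W.obj j) i)
  rw [Subsingleton.elim y 0]
  exact map_zero _

/-- evaluation at one -/
noncomputable def ev1 (K : Ideal R) (M : ModuleCat.{u} R) :
    ((linearYoneda R (ModuleCat.{u} R)).obj M).obj (Opposite.op (ModuleCat.of R (R ⧸ K))) ⟶ M :=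
  ModuleCat.ofHom (X := (ModuleCat.of R (R ⧸ K) ⟶ M))
    { toFun := fun f => f (1 : R ⧸ K)
      map_add' := fun _ _ => rfl
      map_smul' := fun _ _ => rfl }

lemma ev1_inj (K : Ideal R) (M : ModuleCat.{u} R) : Function.Injective (ev1 K M) := by
  intro (f : ModuleCat.of R (R ⧸ K) ⟶ M) (g : ModuleCat.of R (R ⧸ K) ⟶ M)
    (h : f (1 : R ⧸ K) = g (1 : R ⧸ K))
  apply ModuleCat.hom_ext
  apply LinearMap.ext
  intro (x : R ⧸ K)
  obtain ⟨r, rfl⟩ := Ideal.Quotient.mk_surjective x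
  have h1 : (Ideal.Quotient.mk K r) = r • (1 : R ⧸ K) := by
    rw [Algebra.smul_def, mul_one]; rfl
  rw [h1]
  refine (map_smul f.hom r (1 : R ⧸ K)).trans (.trans ?_ (map_smul g.hom r (1 : R ⧸ K)).symm)
  exact congrArg (r • ·) h

lemma ev1_range (K : Ideal R) (M : ModuleCat.{u} R) (x : M) :
    (∃ y, ev1 K M y = x) ↔ ∀ a ∈ K, a • x = 0 := by
  constructor
  · rintro ⟨y, rfl⟩ a ha
    let f : ModuleCat.of R (R ⧸ K) ⟶ M := y
    have h1 : a • (1 : R ⧸ K) = 0 := by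
      rw [Algebra.smul_def, mul_one]
      exact Ideal.Quotient.eq_zero_iff_mem.2 ha
    refine (map_smul f.hom a (1 : R ⧸ K)).symm.trans ?_
    rw [h1]
    exact map_zero f.hom
  · intro h
    let f : R ⧸ K →ₗ[R] M := Submodule.liftQ K (LinearMap.toSpanSingleton R M x) (fun a ha => h a ha)
    refine ⟨(ModuleCat.ofHom f : ModuleCat.of R (R ⧸ K) ⟶ M), ?_⟩
    change f (Submodule.Quotient.mk 1) = x
    exact (Submodule.liftQ_apply K _ (1 : R)).trans (one_smul R x)

/-- the component of the augmentation -/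
noncomputable def psiL (I : Ideal R) (M : ModuleCat.{u} R) (t : ℕᵒᵖᵒᵖ) :
    ((localCohomology.diagram (localCohomology.idealPowersDiagram I) 0).flip.obj M).obj t ⟶ M :=
  (e0 M).app ((localCohomology.ringModIdeals (localCohomology.idealPowersDiagram I)).op.obj t) ≫
    ev1 (I ^ t.unop.unop) M

lemma psiL_inj (I : Ideal R) (M : ModuleCat.{u} R) (t : ℕᵒᵖᵒᵖ) : Function.Injective (psiL I M t) := by
  intro x y h
  exact (e0_bij M _).1 (ev1_inj _ _ h)

lemma psiL_range (I : Ideal R) (M : ModuleCat.{u} R) (t : ℕᵒᵖᵒᵖ) (x : M) :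
    (∃ y, psiL I M t y = x) ↔ ∀ a ∈ I ^ t.unop.unop, a • x = 0 := by
  rw [← ev1_range]
  constructor
  · rintro ⟨y, hy⟩
    exact ⟨_, hy⟩
  · rintro ⟨y, hy⟩
    obtain ⟨z, rfl⟩ := (e0_bij M _).2 y
    exact ⟨z, hy⟩

lemma psiL_w (I : Ideal R) (M : ModuleCat.{u} R) {s t : ℕᵒᵖᵒᵖ} (w : s ⟶ t) :
    ((localCohomology.diagram (localCohomology.idealPowersDiagram I) 0).flip.obj M).map w ≫
      psiL I M t = psiL I M s := by
  have h := (e0 M).naturality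
    ((localCohomology.ringModIdeals (localCohomology.idealPowersDiagram I)).op.map w)
  have h2 : ((linearYoneda R (ModuleCat.{u} R)).obj M).map
    ((localCohomology.ringModIdeals (localCohomology.idealPowersDiagram I)).op.map w) ≫
      ev1 (I ^ t.unop.unop) M = ev1 (I ^ s.unop.unop) M := by
    ext f
    rfl
  refine (Category.assoc _ _ _).symm.trans ?_
  refine (congrArg (· ≫ ev1 (I ^ t.unop.unop) M) h).trans ?_
  refine (Category.assoc _ _ _).trans ?_
  exact congrArg (_ ≫ ·) h2

lemma psiL_nat (I : Ideal R) {M N : ModuleCat.{u} R} (f : M ⟶ N) (t : ℕᵒᵖᵒᵖ) :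
    ((localCohomology.diagram (localCohomology.idealPowersDiagram I) 0).flip.map f).app t ≫
      psiL I N t = psiL I M t ≫ f := by
  have h := congrArg (fun u => NatTrans.app u
    ((localCohomology.ringModIdeals (localCohomology.idealPowersDiagram I)).op.obj t)) (e0_nat f)
  have h2 : ((linearYoneda R (ModuleCat.{u} R)).map f).app
    ((localCohomology.ringModIdeals (localCohomology.idealPowersDiagram I)).op.obj t) ≫
      ev1 (I ^ t.unop.unop) N = ev1 (I ^ t.unop.unop) M ≫ f := by
    ext f
    rfl
  refine (Category.assoc _ _ _).symm.trans ?_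
  refine (congrArg (· ≫ ev1 (I ^ t.unop.unop) N) h).trans ?_
  refine (Category.assoc _ _ _).trans ?_
  refine (congrArg (_ ≫ ·) h2).trans ?_
  exact (Category.assoc _ _ _).symm

/-- the augmentation cocone -/
noncomputable def psiC (I : Ideal R) (M : ModuleCat.{u} R) : Limits.Cocone
    ((localCohomology.diagram (localCohomology.idealPowersDiagram I) 0).flip.obj M) :=
  { pt := M, ι := { app := psiL I M, naturality := fun s t w =>
        (psiL_w I M w).trans (Category.comp_id _).symm } }

/-- the augmentation on objects -/
noncomputable def LCεa (I : Ideal R) (M : ModuleCat.{u} R) : Limits.colimit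
    ((localCohomology.diagram (localCohomology.idealPowersDiagram I) 0).flip.obj M) ⟶ M :=
  Limits.colimit.desc
    ((localCohomology.diagram (localCohomology.idealPowersDiagram I) 0).flip.obj M) (psiC I M)

lemma LCεa_ι (I : Ideal R) (M : ModuleCat.{u} R) (t : ℕᵒᵖᵒᵖ) : Limits.colimit.ι
    ((localCohomology.diagram (localCohomology.idealPowersDiagram I) 0).flip.obj M) t ≫ LCεa I M =
      psiL I M t := Limits.colimit.ι_desc (psiC I M) t

/-- the augmentation -/
noncomputable def LCε (I : Ideal R) : LC I 0 ⟶ 𝟭 (ModuleCat.{u} R) where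
  app M := LCεa I M
  naturality M N f := by
    refine Limits.colimit.hom_ext (fun t => ?_)
    change Limits.colimit.ι _ t ≫ Limits.colimMap
      ((localCohomology.diagram (localCohomology.idealPowersDiagram I) 0).flip.map f) ≫ LCεa I N =
      Limits.colimit.ι _ t ≫ LCεa I M ≫ f
    rw [Limits.ι_colimMap_assoc, LCεa_ι, psiL_nat, ← Category.assoc, LCεa_ι]

lemma LCε_ι (I : Ideal R) (M : ModuleCat.{u} R) (t : ℕᵒᵖᵒᵖ) (x) :
    (LCε I).app M (Limits.colimit.ι
      ((localCohomology.diagram (localCohomology.idealPowersDiagram I) 0).flip.obj M) t x) =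
        psiL I M t x :=
  ConcreteCategory.congr_hom (LCεa_ι I M t) x

lemma LCε_inj (I : Ideal R) (M : ModuleCat.{u} R) : Function.Injective ((LCε I).app M) := by
  rw [injective_iff_map_eq_zero]
  intro x hx
  obtain ⟨t, y, rfl⟩ := colim_rep
    ((localCohomology.diagram (localCohomology.idealPowersDiagram I) 0).flip.obj M) x
  rw [LCε_ι] at hx
  have : y = 0 := psiL_inj I M t (hx.trans (map_zero (psiL I M t).hom).symm)
  rw [this]
  exact map_zero _

lemma LCε_range (I : Ideal R) (M : ModuleCat.{u} R) (x : M) :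
    (∃ y, (LCε I).app M y = x) ↔ ∃ k : ℕ, ∀ a ∈ I ^ k, a • x = 0 := by
  constructor
  · rintro ⟨y, rfl⟩
    obtain ⟨t, y, rfl⟩ := colim_rep
      ((localCohomology.diagram (localCohomology.idealPowersDiagram I) 0).flip.obj M) y
    rw [LCε_ι]
    exact ⟨t.unop.unop, (psiL_range I M t _).1 ⟨y, rfl⟩⟩
  · rintro ⟨k, hk⟩
    obtain ⟨y, hy⟩ := (psiL_range I M (Opposite.op (Opposite.op k)) x).2 hk
    exact ⟨_, (LCε_ι I M _ y).trans hy⟩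
end
end BSLC

namespace BSLC
open CategoryTheory
lemma final_aux {k : Type u} [Field k] [CharZero k] {n : ℕ}
    {R : Type u} [CommRing R] [Algebra (MvPowerSeries (Fin n) k) R]
    (hft : Algebra.FiniteType (MvPowerSeries (Fin n) k) R)
    (hN : IsNoetherianRing R)
    (hreg : ∀ (q : Ideal R) [q.IsPrime], ∃ t : Finset (Localization.AtPrime q),
      Ideal.span (t : Set (Localization.AtPrime q)) = IsLocalRing.maximalIdeal _ ∧
      (t.card : WithBot ℕ∞) = ringKrullDim (Localization.AtPrime q))
    (I : Ideal R) (i : ℕ) :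
    {P : Ideal R | P.IsPrime ∧ ∃ x : (localCohomology I i).obj (ModuleCat.of R R),
      ∀ a : R, a ∈ P ↔ a • x = 0}.Finite := by
  obtain ⟨m, f, hf⟩ := Algebra.FiniteType.iff_quotient_mvPolynomial''.1 hft
  obtain ⟨A, _, hA, ⟨e⟩⟩ := good_cover (good_mvps k n) m
  let π : A →+* R := f.toRingHom.comp e.toRingHom
  have hπ : Function.Surjective π := hf.comp e.surjective
  obtain ⟨r, δ, ⟨c, hc⟩, hB⟩ := exists_bfun hA π hπ hN hreg
  have hunit : ∀ n : ℕ, n ≠ 0 → IsUnit (n : R) := by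
    intro n hn
    have := (hA.2.1 n hn).map π
    rwa [map_natCast] at this
  obtain ⟨S, hS⟩ := (isNoetherianRing_iff_ideal_fg R).1 hN I
  have hgs : Ideal.span {g | g ∈ S.toList} = I := by
    rw [← hS]
    congr 1
    ext g
    exact Finset.mem_toList
  obtain ⟨E⟩ := lc_equiv S.toList (LC I) (LCε I) (LCε_inj I)
    (fun M x => by rw [tors_iff, hgs]; exact LCε_range I M x)
    (fun M J Z f q hJ hf hq he i => LC_conn I f q hJ hf hq he i)
    (fun J hJ i x => LC_zero I J hJ i x) i (ModuleCat.of R R)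
  obtain ⟨E'⟩ := LC_iso I i (ModuleCat.of R R)
  let E2 := E'.toLinearEquiv.trans E
  refine (ass_HX hunit hc hB S.toList i).subset ?_
  rintro P ⟨hP, x, hx⟩
  refine ⟨hP, E2 x, fun a => ?_⟩
  rw [hx a, ← map_smul E2 a x]
  exact (LinearEquiv.map_eq_zero_iff E2).symm
end BSLC

/-- Let `k` be a field of characteristic zero and let `R` be a regular ring that is a
finitely generated algebra over the formal power series ring `k[[x_1, …, x_n]]`.  Then
for every ideal `I ⊆ R` and every `i ≥ 0`, the local cohomology module `H^i_I(R)` has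
finitely many associated prime ideals. -/
theorem finite_associatedPrimes_localCohomology_of_finiteType_over_powerSeries
    (k : Type u) [Field k] [CharZero k] (n : ℕ)
    (R : Type u) [CommRing R] [Algebra (MvPowerSeries (Fin n) k) R]
    (hft : Algebra.FiniteType (MvPowerSeries (Fin n) k) R)
    (hreg : IsRegularRing' R)
    (I : Ideal R) (i : ℕ) :
    (associatedPrimesAnn R ((localCohomology I i).obj (ModuleCat.of R R))).Finite := by
  obtain ⟨hN, hloc⟩ := hreg
  refine (BSLC.final_aux hft hN (fun q _ => (hloc q).2) I i).subset ?_
  rintro P ⟨hP, x, hx⟩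
  refine ⟨hP, x, fun a => ?_⟩
  rw [hx]
  exact Submodule.mem_annihilator_span_singleton x a
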